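/- (Marker–Steinhorn Theorem.) Let M be an o-minimal structure and let N be a tame elementary extension of M. Then for every a ∈ N^n, the type tp(a/M) is definable: for every first-order formula φ(u,v) with parameters from M and with v an n-tuple of variables, the set {u ∈ M^m : N ⊨ φ(u,a)} is a definable subset of M^m (definable in M with parameters). -/

import Mathlib

open FirstOrder Set

/-- `M` is an o-minimal `L`-structure: a densely linearly ordered structure without endpoints,
whose order is `∅`-definable, and in which every definable (with parameters) subset of `M`
is a finite union of points and open intervals with endpoints in `M ∪ {±∞}`. -/
def IsOMinimal (L : FirstOrder.Language) (M : Type*) [L.Structure M] [LinearOrder M] : Prop :=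
  Nonempty M ∧ DenselyOrdered M ∧ NoMinOrder M ∧ NoMaxOrder M ∧
  Set.Definable (∅ : Set M) L {v : Fin 2 → M | v 0 < v 1} ∧
  ∀ s : Set M, Set.Definable₁ (Set.univ : Set M) L s →
    ∃ F : Finset (Set M), s = ⋃₀ (F : Set (Set M)) ∧
      ∀ t ∈ F, (∃ a : M, t = {a}) ∨ (∃ a b : M, t = Set.Ioo a b) ∨
        (∃ a : M, t = Set.Ioi a) ∨ (∃ a : M, t = Set.Iio a) ∨ t = Set.univ

/-- The fiber over `u` of a set `D ⊆ M^{m+n}`, i.e. the set `φ(u, M^n)`. -/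
def famFiber {M : Type*} {m n : ℕ} (D : Set (Fin m ⊕ Fin n → M)) (u : Fin m → M) :
    Set (Fin n → M) :=
  {v | Sum.elim u v ∈ D}

/-- An `A`-definable family of subsets of `M^n`: the family of fibers `φ(u, M^n)` for `u`
ranging over an `A`-definable index set `Ω`, where `φ` is `A`-definable. -/
def IsDefFamily (L : FirstOrder.Language) {M : Type*} [L.Structure M] (A : Set M) (n : ℕ)
    (S : Set (Set (Fin n → M))) : Prop :=
  ∃ (m : ℕ) (Ω : Set (Fin m → M)) (D : Set (Fin m ⊕ Fin n → M)),
    Set.Definable A L Ω ∧ Set.Definable A L D ∧ S = famFiber D '' Ω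

/-- A family of sets is downward directed: it does not contain `∅` and any two members
contain a common member. -/
def DirectedFam {α : Type*} (S : Set (Set α)) : Prop :=
  ∅ ∉ S ∧ ∀ X ∈ S, ∀ Y ∈ S, ∃ Z ∈ S, Z ⊆ X ∩ Y

/-- `S` is finer than `F`: every member of `F` contains a member of `S`. -/
def FinerThan {α : Type*} (S F : Set (Set α)) : Prop :=
  ∀ X ∈ F, ∃ Y ∈ S, Y ⊆ X

/-- A (complete) `n`-type over `M`: an ultrafilter on the Boolean algebra of definable
subsets of `M^n`. -/
def IsTypeOn (L : FirstOrder.Language) {M : Type*} [L.Structure M] (n : ℕ)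
    (p : Set (Set (Fin n → M))) : Prop :=
  (∀ X ∈ p, Set.Definable (Set.univ : Set M) L X) ∧
  ∅ ∉ p ∧
  (∀ X ∈ p, ∀ Y ∈ p, X ∩ Y ∈ p) ∧
  (∀ X ∈ p, ∀ Y : Set (Fin n → M), Set.Definable (Set.univ : Set M) L Y → X ⊆ Y → Y ∈ p) ∧
  (∀ X : Set (Fin n → M), Set.Definable (Set.univ : Set M) L X → X ∈ p ∨ Xᶜ ∈ p)

/-- A type `p` is `A`-definable if for every `∅`-definable `D ⊆ M^{m+n}` the set of
parameters `u` with `φ(u, M^n) ∈ p` is `A`-definable. -/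
def IsDefTypeOver (L : FirstOrder.Language) {M : Type*} [L.Structure M] (A : Set M) (n : ℕ)
    (p : Set (Set (Fin n → M))) : Prop :=
  ∀ (m : ℕ) (D : Set (Fin m ⊕ Fin n → M)), Set.Definable (∅ : Set M) L D →
    Set.Definable A L {u : Fin m → M | famFiber D u ∈ p}

/-- A family `F` is complete for a family `X` if each member of `X` either contains a member
of `F` or is disjoint from one. -/
def CompleteFor {α : Type*} (F X : Set (Set α)) : Prop :=
  ∀ Y ∈ X, ∃ Z ∈ F, Z ⊆ Y ∨ Z ∩ Y = ∅

/-- A family of subsets of `M^n` is complete if it decides every definable set. -/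
def IsCompleteFam (L : FirstOrder.Language) {M : Type*} [L.Structure M] (n : ℕ)
    (S : Set (Set (Fin n → M))) : Prop :=
  ∀ X : Set (Fin n → M), Set.Definable (Set.univ : Set M) L X → ∃ Z ∈ S, Z ⊆ X ∨ Z ∩ X = ∅

/-- `B` is a basis for the type `p`: a downward directed subfamily generating `p`. -/
def IsBasisOfType {α : Type*} (B p : Set (Set α)) : Prop :=
  B ⊆ p ∧ DirectedFam B ∧ ∀ Y ∈ p, ∃ Z ∈ B, Z ⊆ Y

/-- `p` has an `A`-definable basis. -/
def HasDefBasis (L : FirstOrder.Language) {M : Type*} [L.Structure M] (A : Set M) (n : ℕ)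
    (p : Set (Set (Fin n → M))) : Prop :=
  ∃ B, IsDefFamily L A n B ∧ IsBasisOfType B p

/-- `S` has a finite tame transversal: it is covered by finitely many subfamilies, each of
which extends to a definable type. -/
def HasFTT (L : FirstOrder.Language) {M : Type*} [L.Structure M] (n : ℕ)
    (S : Set (Set (Fin n → M))) : Prop :=
  ∃ (N : ℕ) (p : Fin N → Set (Set (Fin n → M))),
    (∀ i, IsTypeOn L n (p i) ∧ IsDefTypeOver L (Set.univ : Set M) n (p i)) ∧
    ∀ X ∈ S, ∃ i, X ∈ p i

/-- The `(m,n)`-property: among any `m` members of the family, some `n` have nonempty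
intersection. -/
def HasMNProperty {α : Type*} (S : Set (Set α)) (m n : ℕ) : Prop :=
  ∀ F : Finset (Set α), ↑F ⊆ S → F.card = m →
    ∃ G ⊆ F, G.card = n ∧ (⋂₀ (G : Set (Set α))).Nonempty


open FirstOrder Set
set_option linter.unusedVariables false

namespace MS

/-- definable predicates -/
abbrev DP (L : Language) {M : Type*} [L.Structure M] {ι : Type} (P : (ι → M) → Prop) : Prop :=
  Set.Definable (Set.univ : Set M) L {v : ι → M | P v}

section DP
variable {L : Language} {M : Type*} [L.Structure M] {ι κ : Type}

theorem DP.congr {P Q : (ι → M) → Prop} (h : DP L P) (e : ∀ v, Q v ↔ P v) : DP L Q := by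
  have : Q = P := funext fun v => propext (e v)
  rw [this]; exact h

theorem DP.and {P Q : (ι → M) → Prop} (h : DP L P) (h' : DP L Q) : DP L (fun v => P v ∧ Q v) :=
  Set.Definable.inter h h'
theorem DP.or {P Q : (ι → M) → Prop} (h : DP L P) (h' : DP L Q) : DP L (fun v => P v ∨ Q v) :=
  Set.Definable.union h h'
theorem DP.not {P : (ι → M) → Prop} (h : DP L P) : DP L (fun v => ¬ P v) :=
  Set.Definable.compl h
theorem DP.reindex {P : (ι → M) → Prop} (h : DP L P) (σ : ι → κ) :
    DP L (fun v : κ → M => P (v ∘ σ)) := Set.Definable.preimage_comp σ h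
theorem DP.const (p : Prop) : DP L (fun _ : ι → M => p) := by
  by_cases hp : p
  · have : {v : ι → M | p} = Set.univ := by ext; simp [hp]
    rw [DP, this]; exact Set.definable_univ
  · have : {v : ι → M | p} = ∅ := by ext; simp [hp]
    rw [DP, this]; exact Set.definable_empty
theorem DP.ex [Finite κ] {P : (ι ⊕ κ → M) → Prop} (h : DP L P) :
    DP L (fun v : ι → M => ∃ u : κ → M, P (Sum.elim v u)) := Set.Definable.exists_of_finite h
theorem DP.all [Finite κ] {P : (ι ⊕ κ → M) → Prop} (h : DP L P) :
    DP L (fun v : ι → M => ∀ u : κ → M, P (Sum.elim v u)) := Set.Definable.forall_of_finite h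
theorem DP.eq (i j : ι) : DP L (fun v : ι → M => v i = v j) := by
  rw [DP, Set.definable_iff_exists_formula_sum]
  refine ⟨(Language.Term.var (Sum.inr i)).equal (Language.Term.var (Sum.inr j)), ?_⟩
  ext v; simp [Language.Formula.realize_equal]
theorem DP.eqc (i : ι) (c : M) : DP L (fun v : ι → M => v i = c) := by
  rw [DP, Set.definable_iff_exists_formula_sum]
  refine ⟨(Language.Term.var (Sum.inr i)).equal (Language.Term.var (Sum.inl ⟨c, trivial⟩)), ?_⟩
  ext v; simp [Language.Formula.realize_equal]
theorem DP.fall {I : Type*} [Finite I] {P : I → (ι → M) → Prop} (h : ∀ i, DP L (P i)) :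
    DP L (fun v => ∀ i, P i v) := by
  classical
  cases nonempty_fintype I
  have : ∀ s : Finset I, DP L (fun v => ∀ i ∈ s, P i v) := by
    intro s
    induction s using Finset.induction_on with
    | empty => exact (DP.const True).congr (by simp)
    | insert a s _ ih => exact ((h a).and ih).congr (by simp)
  exact (this Finset.univ).congr (by simp)
end DP

class Obj (L : Language) (M : Type*) [L.Structure M] (X : Type*) where
  pt : ∀ {ι : Type}, ((ι → M) → X) → Prop
  const : ∀ {ι : Type} (x : X), pt (fun _ : ι → M => x)
  reindex : ∀ {ι κ : Type} (h : (ι → M) → X) (σ : ι → κ), pt h → pt (fun w : κ → M => h (w ∘ σ))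

section
variable {L : Language} {M : Type*} [L.Structure M]

instance instProp : Obj L M Prop where
  pt P := DP L P
  const p := DP.const p
  reindex _ σ h := h.reindex σ

instance instM : Obj L M M where
  pt {ι} t := DP L (fun w : ι ⊕ Unit → M => w (Sum.inr ()) = t (w ∘ Sum.inl))
  const c := DP.eqc _ c
  reindex h σ H := by
    exact (H.reindex (Sum.map σ id))

instance instProd {X Y : Type*} [Obj L M X] [Obj L M Y] : Obj L M (X × Y) where
  pt h := Obj.pt L (fun v => (h v).1) ∧ Obj.pt L (fun v => (h v).2)
  const c := ⟨Obj.const _, Obj.const _⟩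
  reindex h σ H := ⟨Obj.reindex (fun v => (h v).1) σ H.1, Obj.reindex (fun v => (h v).2) σ H.2⟩

instance instPi {I : Type*} [Finite I] {X : Type*} [Obj L M X] : Obj L M (I → X) where
  pt h := ∀ i, Obj.pt L (fun v => h v i)
  const c i := Obj.const _
  reindex h σ H i := Obj.reindex (fun v => h v i) σ (H i)

instance instUnit : Obj L M Unit where
  pt _ := True
  const _ := trivial
  reindex _ _ _ := trivial
end

class Ctx (L : Language) (M : Type*) [L.Structure M] (X : Type*) extends Obj L M X where
  κ : Type
  fin : Finite κ
  e : (κ → M) → X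
  surj : Function.Surjective e
  ept : pt e

section
variable {L : Language} {M : Type*} [L.Structure M]

theorem pt_coord {ι : Type} (i : ι) : (instM : Obj L M M).pt (fun v : ι → M => v i) := 
  (DP.eq (Sum.inr ()) (Sum.inl i))

instance ctxM : Ctx L M M where
  κ := Unit
  fin := inferInstance
  e w := w ()
  surj x := ⟨fun _ => x, rfl⟩
  ept := pt_coord _

instance ctxProd {X Y : Type*} [Ctx L M X] [Ctx L M Y] : Ctx L M (X × Y) where
  κ := Ctx.κ L M X ⊕ Ctx.κ L M Y
  fin := by
    have := Ctx.fin (L := L) (M := M) (X := X); have := Ctx.fin (L := L) (M := M) (X := Y)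
    infer_instance
  e w := (Ctx.e (L := L) (w ∘ Sum.inl), Ctx.e (L := L) (w ∘ Sum.inr))
  surj := by
    rintro ⟨x, y⟩
    obtain ⟨u, rfl⟩ := Ctx.surj (L := L) (M := M) x
    obtain ⟨v, rfl⟩ := Ctx.surj (L := L) (M := M) y
    exact ⟨Sum.elim u v, by simp⟩
  ept := ⟨Obj.reindex _ _ (Ctx.ept), Obj.reindex _ _ (Ctx.ept)⟩

instance ctxPi {I : Type} [Finite I] : Ctx L M (I → M) where
  κ := I
  fin := inferInstance
  e w := w
  surj x := ⟨x, rfl⟩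
  ept := fun i => pt_coord i

instance ctxUnit : Ctx L M Unit where
  κ := Empty
  fin := inferInstance
  e _ := ()
  surj x := ⟨fun e => e.elim, rfl⟩
  ept := trivial
end

@[fun_prop]
def Dfn (L : Language) (M : Type*) [L.Structure M] {X Y : Type*} [Obj L M X] [Obj L M Y]
    (g : X → Y) : Prop :=
  ∀ (ι : Type) (h : (ι → M) → X), Obj.pt L h → Obj.pt L (fun v => g (h v))

namespace Dfn
variable {L : Language} {M : Type*} [L.Structure M] {X Y Z : Type*} [Obj L M X] [Obj L M Y]
  [Obj L M Z]

@[fun_prop] theorem id' : Dfn L M (fun x : X => x) := fun _ _ h => h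
@[fun_prop] theorem const' (y : Y) : Dfn L M (fun _ : X => y) := fun _ _ _ => Obj.const y
@[fun_prop] theorem comp' {f : Y → Z} {g : X → Y} (hf : Dfn L M f) (hg : Dfn L M g) :
    Dfn L M (fun x => f (g x)) := fun ι h H => hf ι _ (hg ι h H)
@[fun_prop] theorem fst' {f : X → Y × Z} (hf : Dfn L M f) : Dfn L M (fun x => (f x).1) :=
  fun ι h H => (hf ι h H).1
@[fun_prop] theorem snd' {f : X → Y × Z} (hf : Dfn L M f) : Dfn L M (fun x => (f x).2) :=
  fun ι h H => (hf ι h H).2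
@[fun_prop] theorem mk' {f : X → Y} {g : X → Z} (hf : Dfn L M f) (hg : Dfn L M g) :
    Dfn L M (fun x => (f x, g x)) := fun ι h H => ⟨hf ι h H, hg ι h H⟩
@[fun_prop] theorem apply' {I : Type*} [Finite I] (i : I) : Dfn L M (fun x : I → X => x i) :=
  fun _ _ H => H i
@[fun_prop] theorem pi' {I : Type*} [Finite I] {f : X → I → Y} (hf : ∀ i, Dfn L M (fun x => f x i)) :
    Dfn L M (fun x i => f x i) := fun ι h H i => hf i ι h H

@[fun_prop] theorem and' {P Q : X → Prop} (hP : Dfn L M P) (hQ : Dfn L M Q) :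
    Dfn L M (fun x => P x ∧ Q x) := fun ι h H => DP.and (hP ι h H) (hQ ι h H)
@[fun_prop] theorem or' {P Q : X → Prop} (hP : Dfn L M P) (hQ : Dfn L M Q) :
    Dfn L M (fun x => P x ∨ Q x) := fun ι h H => DP.or (hP ι h H) (hQ ι h H)
@[fun_prop] theorem not' {P : X → Prop} (hP : Dfn L M P) :
    Dfn L M (fun x => ¬ P x) := fun ι h H => DP.not (hP ι h H)
theorem congr {f g : X → Y} (hf : Dfn L M f) (h : ∀ x, g x = f x) : Dfn L M g := by
  have : g = f := funext h
  rw [this]; exact hf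
theorem imp' {P Q : X → Prop} (hP : Dfn L M P) (hQ : Dfn L M Q) :
    Dfn L M (fun x => P x → Q x) :=
  (hP.not'.or' hQ).congr fun x => by simp [imp_iff_not_or]
@[fun_prop] theorem iff' {P Q : X → Prop} (hP : Dfn L M P) (hQ : Dfn L M Q) :
    Dfn L M (fun x => P x ↔ Q x) :=
  ((hP.imp' hQ).and' (hQ.imp' hP)).congr fun x => by simp [iff_iff_implies_and_implies]
@[fun_prop] theorem ex' {Y : Type*} [Ctx L M Y] {P : X → Y → Prop} (hP : Dfn L M (fun p : X × Y => P p.1 p.2)) :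
    Dfn L M (fun x => ∃ y, P x y) := by
  intro ι h H
  have := Ctx.fin (L := L) (M := M) (X := Y)
  have h1 := hP (ι ⊕ Ctx.κ L M Y) (fun w => (h (w ∘ Sum.inl), Ctx.e (L := L) (w ∘ Sum.inr)))
    ⟨Obj.reindex h _ H, Obj.reindex _ _ Ctx.ept⟩
  refine (DP.ex h1).congr fun v => ?_
  constructor
  · rintro ⟨y, hy⟩
    obtain ⟨u, rfl⟩ := Ctx.surj (L := L) (M := M) y
    exact ⟨u, by simpa using hy⟩
  · rintro ⟨u, hu⟩
    exact ⟨_, by simpa using hu⟩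
theorem all' {Y : Type*} [Ctx L M Y] {P : X → Y → Prop} (hP : Dfn L M (fun p : X × Y => P p.1 p.2)) :
    Dfn L M (fun x => ∀ y, P x y) :=
  (ex' (P := fun x y => ¬ P x y) hP.not').not'.congr fun x => by simp
theorem fall' {I : Type*} [Finite I] {P : X → I → Prop} (hP : ∀ i, Dfn L M (fun x => P x i)) :
    Dfn L M (fun x => ∀ i, P x i) := fun ι h H => DP.fall fun i => hP i ι h H
@[fun_prop] theorem fex' {I : Type*} [Finite I] {P : X → I → Prop} (hP : ∀ i, Dfn L M (fun x => P x i)) :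
    Dfn L M (fun x => ∃ i, P x i) :=
  (fall' (P := fun x y => ¬ P x y) (fun i => (hP i).not')).not'.congr fun x => by simp

theorem of_graph {f : X → M} (h : Dfn L M (fun p : X × M => p.2 = f p.1)) : Dfn L M f := by
  intro ι g H
  exact h (ι ⊕ Unit) (fun w => (g (w ∘ Sum.inl), w (Sum.inr ()))) ⟨Obj.reindex g _ H, pt_coord _⟩

theorem graph {f : X → M} (hf : Dfn L M f) {ι : Type} {h : (ι → M) → X} (H : Obj.pt L h) :
  DP L (fun w : ι ⊕ Unit → M => w (Sum.inr ()) = f (h (w ∘ Sum.inl))) := hf ι h H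

end Dfn

variable {L : Language} {M : Type*} [L.Structure M]

/-- substitution of definable functions into a definable predicate -/
theorem DP.subst {κ ι : Type} [Finite κ] {P : (κ → M) → Prop} (hP : DP L P)
    {h : (ι → M) → (κ → M)} (H : Obj.pt L h) : DP L (fun v => P (h v)) := by
  have h1 : DP L (fun w : ι ⊕ κ → M => ∀ i, w (Sum.inr i) = h (w ∘ Sum.inl) i) := by
    refine DP.fall fun i => ?_
    have h2 : DP L (fun w : ι ⊕ Unit → M => w (Sum.inr ()) = h (w ∘ Sum.inl) i) := H i
    exact (h2.reindex (Sum.map id (fun _ => i)))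
  refine (DP.ex (h1.and (hP.reindex Sum.inr))).congr fun v => ?_
  constructor
  · intro hv
    refine ⟨h v, ?_, ?_⟩
    · intro i; simp
    · simpa using hv
  · rintro ⟨u, h1, h2⟩
    have : u = h v := by
      funext i; simpa using h1 i
    subst this
    simpa using h2

theorem dfn_iff_definable {κ : Type} [Finite κ] {P : (κ → M) → Prop} : Dfn L M P ↔ DP L P :=
  ⟨fun h => h κ id (fun i => pt_coord i), fun h _ _ H => DP.subst h H⟩

theorem dfn_iff_definable₁ {P : M → Prop} : Dfn L M P ↔ Set.Definable₁ Set.univ L {x | P x} := by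
  constructor
  · intro h
    exact h (Fin 1) (fun w => w 0) (pt_coord _)
  · intro h
    have : Dfn L M (fun w : Fin 1 → M => P (w 0)) := dfn_iff_definable.2 h
    exact Dfn.comp' (f := fun w : Fin 1 → M => P (w 0)) (g := fun x _ => x) this (Dfn.pi' fun i => Dfn.id')

class ObjEq (L : Language) (M : Type*) [L.Structure M] (X : Type*) [Obj L M X] : Prop where
  eq : Dfn L M (fun p : X × X => p.1 = p.2)

instance : ObjEq L M M where
  eq := by
    have : Dfn L M (fun w : Fin 2 → M => w 0 = w 1) := dfn_iff_definable.2 (DP.eq 0 1)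
    refine Dfn.comp' (f := fun w : Fin 2 → M => w 0 = w 1) (g := fun p : M × M => ![p.1, p.2]) this ?_
    refine Dfn.pi' fun i => ?_
    fin_cases i
    · exact Dfn.fst' Dfn.id'
    · exact Dfn.snd' Dfn.id'
instance {X Y : Type*} [Obj L M X] [Obj L M Y] [ObjEq L M X] [ObjEq L M Y] : ObjEq L M (X × Y) where
  eq := by
    have h1 := ObjEq.eq (L := L) (M := M) (X := X)
    have h2 := ObjEq.eq (L := L) (M := M) (X := Y)
    have : Dfn L M (fun p : (X × Y) × (X × Y) => p.1.1 = p.2.1 ∧ p.1.2 = p.2.2) :=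
      (Dfn.comp' h1 (g := fun p : (X × Y) × (X × Y) => (p.1.1, p.2.1)) (by fun_prop)).and'
      (Dfn.comp' h2 (g := fun p : (X × Y) × (X × Y) => (p.1.2, p.2.2)) (by fun_prop))
    exact this.congr fun p => by simp [Prod.ext_iff]
instance {X I : Type*} [Finite I] [Obj L M X] [ObjEq L M X] : ObjEq L M (I → X) where
  eq := by
    have h1 := ObjEq.eq (L := L) (M := M) (X := X)
    have : Dfn L M (fun p : (I → X) × (I → X) => ∀ i, p.1 i = p.2 i) :=
      Dfn.fall' fun i => Dfn.comp' h1 (g := fun p : (I → X) × (I → X) => (p.1 i, p.2 i)) (by fun_prop)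
    exact this.congr fun p => by simp [funext_iff]

@[fun_prop] theorem Dfn.eq' {X Y : Type*} [Obj L M X] [Obj L M Y] [ObjEq L M Y] {f g : X → Y}
    (hf : Dfn L M f) (hg : Dfn L M g) : Dfn L M (fun x => f x = g x) :=
  Dfn.comp' (ObjEq.eq (L := L) (M := M) (X := Y)) (g := fun x => (f x, g x)) (by fun_prop)
@[fun_prop] theorem Dfn.ne' {X Y : Type*} [Obj L M X] [Obj L M Y] [ObjEq L M Y] {f g : X → Y}
    (hf : Dfn L M f) (hg : Dfn L M g) : Dfn L M (fun x => f x ≠ g x) := (hf.eq' hg).not'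

/-- definable functional relation gives a definable function -/
theorem exists_dfn_fun [Nonempty M] {X : Type*} [Obj L M X] {R : X × M → Prop} (hR : Dfn L M R)
    (hu : ∀ x y y', R (x, y) → R (x, y') → y = y') :
    ∃ f : X → M, Dfn L M f ∧ ∀ x, (∃ y, R (x, y)) → R (x, f x) := by
  classical
  let d : M := Classical.arbitrary M
  let f : X → M := fun x => if h : ∃ y, R (x, y) then h.choose else d
  have hf : ∀ x, (∃ y, R (x, y)) → R (x, f x) := by
    intro x h
    simp only [f, dif_pos h]
    exact h.choose_spec
  refine ⟨f, Dfn.of_graph ?_, hf⟩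
  have : Dfn L M (fun p : X × M => R p ∨ ((¬ ∃ y, R (p.1, y)) ∧ p.2 = d)) := by fun_prop
  refine this.congr fun p => propext ?_
  constructor
  · intro h
    by_cases hx : ∃ y, R (p.1, y)
    · left
      have := hf p.1 hx
      rw [← h] at this; exact this
    · right
      refine ⟨hx, ?_⟩
      rw [h]; simp only [f, dif_neg hx]
  · rintro (h | ⟨h1, h2⟩)
    · exact hu p.1 _ _ h (hf p.1 ⟨p.2, h⟩)
    · rw [h2]; simp only [f, dif_neg h1]

/-- working o-minimality -/
class OM (L : Language) (M : Type*) [L.Structure M] [LinearOrder M] : Prop where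
  lt : Dfn L M (fun p : M × M => p.1 < p.2)
  fin : ∀ A : M → Prop, Dfn L M A → {x | ¬ ∃ a b, a < x ∧ x < b ∧
    ((∀ y, a < y → y < b → A y) ∨ (∀ y, a < y → y < b → ¬ A y))}.Finite
  lub : ∀ A : M → Prop, Dfn L M A → (∃ x, A x) → (∃ b, ∀ x, A x → x ≤ b) → ∃ s, IsLUB {x | A x} s
  glb : ∀ A : M → Prop, Dfn L M A → (∃ x, A x) → (∃ b, ∀ x, A x → b ≤ x) → ∃ s, IsGLB {x | A x} s

@[fun_prop] theorem Dfn.lt' [LinearOrder M] [OM L M] {X : Type*} [Obj L M X] {f g : X → M}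
    (hf : Dfn L M f) (hg : Dfn L M g) : Dfn L M (fun x => f x < g x) :=
  Dfn.comp' (OM.lt (L := L) (M := M)) (g := fun x => (f x, g x)) (by fun_prop)
@[fun_prop] theorem Dfn.le' [LinearOrder M] [OM L M] {X : Type*} [Obj L M X] {f g : X → M}
    (hf : Dfn L M f) (hg : Dfn L M g) : Dfn L M (fun x => f x ≤ g x) :=
  (hg.lt' hf).not'.congr fun x => by simp

theorem all_iff {α : Type*} (p : α → Prop) : (∀ x, p x) ↔ ¬ ∃ x, ¬ p x := by simp

end MS

open FirstOrder Set
set_option linter.unusedVariables false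
set_option linter.unusedSectionVars false
namespace MS

abbrev dualLO (M : Type*) [LinearOrder M] : LinearOrder M := inferInstanceAs (LinearOrder Mᵒᵈ)

section dual
variable {M : Type*} [LinearOrder M]
theorem dualDense [DenselyOrdered M] : @DenselyOrdered M (dualLO M).toLT :=
  inferInstanceAs (DenselyOrdered Mᵒᵈ)
theorem dualMin [NoMaxOrder M] : @NoMinOrder M (dualLO M).toLT :=
  inferInstanceAs (NoMinOrder Mᵒᵈ)
theorem dualMax [NoMinOrder M] : @NoMaxOrder M (dualLO M).toLT :=
  inferInstanceAs (NoMaxOrder Mᵒᵈ)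
theorem OM.dual {L : Language} [L.Structure M] [h : OM L M] : @OM L M _ (dualLO M) :=
  @OM.mk L M _ (dualLO M)
    (by
      change Dfn L M (fun p : M × M => p.2 < p.1)
      fun_prop)
    (by
      intro A hA
      refine (h.fin A hA).subset ?_
      rintro x hx ⟨a, b, h1, h2, h3⟩
      refine hx ⟨b, a, h2, h1, ?_⟩
      rcases h3 with h3 | h3
      · exact Or.inl fun y h1 h2 => h3 y h2 h1
      · exact Or.inr fun y h1 h2 => h3 y h2 h1)
    (fun A hA h1 h2 => h.glb A hA h1 h2)
    (fun A hA h1 h2 => h.lub A hA h1 h2)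
end dual

variable {L : Language} {M : Type*} [L.Structure M] [LinearOrder M] [DenselyOrdered M]
  [NoMinOrder M] [NoMaxOrder M] [Nonempty M] [OM L M]

theorem ri {P : M → Prop} (hP : Dfn L M P) {x b : M}
    (h0 : ∃ y, x < y ∧ ∀ w, x < w → w < y → P w)
    (h1 : ∀ z, x < z → z < b → (∀ w, x < w → w < z → P w) →
      P z ∧ ∃ y, z < y ∧ ∀ w, z < w → w < y → P w) :
    ∀ z, x < z → z < b → P z := by
  intro z0 hz0 hz0b
  by_contra hn
  have hS : Dfn L M (fun y => x < y ∧ ∀ w, x < w → w < y → P w) := by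
    simp only [all_iff, imp_iff_not_or]; fun_prop
  obtain ⟨y0, hy0⟩ := h0
  have hbd : ∀ y, (x < y ∧ ∀ w, x < w → w < y → P w) → y ≤ z0 := by
    rintro y ⟨_, hy⟩
    by_contra hlt
    exact hn (hy z0 hz0 (not_le.1 hlt))
  obtain ⟨s, hs⟩ := OM.lub _ hS ⟨y0, hy0⟩ ⟨z0, hbd⟩
  have hxs : x < s := hy0.1.trans_le (hs.1 hy0)
  have hsz : s ≤ z0 := hs.2 hbd
  have hlow : ∀ w, x < w → w < s → P w := by
    intro w hw hws
    obtain ⟨y, hy, hwy⟩ := (lt_isLUB_iff hs).1 hws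
    exact hy.2 w hw hwy
  obtain ⟨hPs, y, hsy, hy⟩ := h1 s hxs (hsz.trans_lt hz0b) hlow
  have : y ≤ s := hs.1 ⟨hxs.trans hsy, fun w hw hwy => by
    rcases lt_trichotomy w s with h | h | h
    · exact hlow w hw h
    · exact h ▸ hPs
    · exact hy w h hwy⟩
  exact absurd hsy (not_lt.2 this)

theorem const_of_no_bd {A : M → Prop} (hA : Dfn L M A) {a b : M}
    (h : ∀ x, a < x → x < b → ∃ a b, a < x ∧ x < b ∧
    ((∀ y, a < y → y < b → A y) ∨ (∀ y, a < y → y < b → ¬ A y))) :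
    ∀ x y, a < x → x < b → a < y → y < b → (A x ↔ A y) := by
  have key : ∀ x y, a < x → x < y → y < b → (A y ↔ A x) := by
    intro x y hx hxy hy
    have loc : ∀ z, a < z → z < b → ∃ c d, c < z ∧ z < d ∧ ∀ w, c < w → w < d → (A w ↔ A z) := by
      intro z hz hzb
      obtain ⟨c, d, hc, hd, h | h⟩ := h z hz hzb
      · exact ⟨c, d, hc, hd, fun w h1 h2 => by simp [h w h1 h2, h z hc hd]⟩
      · exact ⟨c, d, hc, hd, fun w h1 h2 => by simp [h w h1 h2, h z hc hd]⟩
    refine ri (L := L) (P := fun w => (A w ↔ A x)) (by fun_prop) ?_ ?_ y hxy hy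
    · obtain ⟨c, d, hc, hd, h⟩ := loc x hx (hxy.trans hy)
      exact ⟨d, hd, fun w h1 h2 => h w (hc.trans h1) h2⟩
    · intro z hxz hzb hw
      obtain ⟨c, d, hc, hd, h⟩ := loc z (hx.trans hxz) hzb
      obtain ⟨w, hw1, hw2⟩ := exists_between (max_lt hc hxz)
      have h1 := h w ((le_max_left _ _).trans_lt hw1) (hw2.trans hd)
      have h2 := hw w ((le_max_right _ _).trans_lt hw1) hw2
      have h3 : A z ↔ A x := h1.symm.trans h2
      exact ⟨h3, d, hd, fun w h1 h2 => (h w (hc.trans h1) h2).trans h3⟩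
  intro x y hx hx' hy hy'
  rcases lt_trichotomy x y with h | h | h
  · exact (key x y hx h hy').symm
  · rw [h]
  · exact key y x hy h hx'

theorem exists_right_avoid {F : Set M} (hF : F.Finite) (x : M) :
    ∃ b, x < b ∧ ∀ y, x < y → y < b → y ∉ F := by
  by_cases hne : (F ∩ {y | x < y}).Nonempty
  · obtain ⟨b, hb, hmin⟩ := Set.exists_min_image _ id (hF.inter_of_left _) hne
    refine ⟨b, hb.2, fun y h1 h2 h3 => ?_⟩
    exact absurd h2 (not_lt.2 (hmin y ⟨h3, h1⟩))
  · obtain ⟨b, hb⟩ := exists_gt x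
    exact ⟨b, hb, fun y h1 h2 h3 => hne ⟨y, h3, h1⟩⟩

theorem right_const {A : M → Prop} (hA : Dfn L M A) (x : M) :
    ∃ b, x < b ∧ ((∀ y, x < y → y < b → A y) ∨ (∀ y, x < y → y < b → ¬ A y)) := by
  obtain ⟨b, hb, h⟩ := exists_right_avoid (OM.fin (L := L) A hA) x
  have := const_of_no_bd hA (a := x) (b := b) (fun y h1 h2 => not_not.1 (h y h1 h2))
  obtain ⟨z, hz, hz'⟩ := exists_between hb
  refine ⟨b, hb, ?_⟩
  by_cases hAz : A z
  · exact Or.inl fun y h1 h2 => (this z y hz hz' h1 h2).1 hAz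
  · exact Or.inr fun y h1 h2 => fun h3 => hAz ((this z y hz hz' h1 h2).2 h3)

theorem left_const {A : M → Prop} (hA : Dfn L M A) (x : M) :
    ∃ b, b < x ∧ ((∀ y, b < y → y < x → A y) ∨ (∀ y, b < y → y < x → ¬ A y)) := by
  obtain ⟨b, hb, h⟩ := @right_const L M _ (dualLO M) dualDense dualMin dualMax _ OM.dual A hA x
  exact ⟨b, hb, h.imp (fun h y h1 h2 => h y h2 h1) (fun h y h1 h2 => h y h2 h1)⟩

theorem top_const {A : M → Prop} (hA : Dfn L M A) :
    ∃ b, (∀ y, b < y → A y) ∨ (∀ y, b < y → ¬ A y) := by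
  obtain ⟨b, hb⟩ : ∃ b, ∀ y, b < y → y ∉ {x | ¬ ∃ a b, a < x ∧ x < b ∧
    ((∀ y, a < y → y < b → A y) ∨ (∀ y, a < y → y < b → ¬ A y))} := by
    obtain ⟨b, hb⟩ := (OM.fin (L := L) A hA).bddAbove
    exact ⟨b, fun y hy h => absurd (hb h) (not_le.2 hy)⟩
  have key : ∀ x y, b < x → b < y → (A x ↔ A y) := by
    intro x y hx hy
    obtain ⟨c, hc⟩ := exists_gt (max x y)
    exact const_of_no_bd hA (a := b) (b := c) (fun y h1 h2 => not_not.1 (hb y h1)) x y hx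
      ((le_max_left _ _).trans_lt hc) hy ((le_max_right _ _).trans_lt hc)
  obtain ⟨z, hz⟩ := exists_gt b
  refine ⟨b, ?_⟩
  by_cases hAz : A z
  · exact Or.inl fun y h1 => (key z y hz h1).1 hAz
  · exact Or.inr fun y h1 => fun h3 => hAz ((key z y hz h1).2 h3)

/-- contains an interval -/
def Inf {M : Type*} [LT M] (A : M → Prop) : Prop := ∃ a b, a < b ∧ ∀ x, a < x → x < b → A x

theorem Inf.mono {A B : M → Prop} (h : Inf A) (hAB : ∀ x, A x → B x) : Inf B := by
  obtain ⟨a, b, hab, h⟩ := h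
  exact ⟨a, b, hab, fun x h1 h2 => hAB x (h x h1 h2)⟩

theorem Inf.infinite {A : M → Prop} (h : Inf A) : {x | A x}.Infinite := by
  obtain ⟨a, b, hab, h⟩ := h
  exact (Set.Ioo_infinite hab).mono fun x hx => h x hx.1 hx.2

theorem inf_of_infinite {A : M → Prop} (hA : Dfn L M A) (h : {x | A x}.Infinite) : Inf A := by
  obtain ⟨x, hx, hxb⟩ := h.exists_notMem_finite (OM.fin (L := L) A hA)
  obtain ⟨a, b, h1, h2, h | h⟩ := not_not.1 hxb
  · exact ⟨a, b, h1.trans h2, h⟩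
  · exact absurd hx (h x h1 h2)

theorem not_inf_iff {A : M → Prop} (hA : Dfn L M A) : ¬ Inf A ↔ {x | A x}.Finite := by
  rw [← Set.not_infinite]
  exact not_congr ⟨Inf.infinite, inf_of_infinite hA⟩

theorem Inf.or {A B : M → Prop} (hA : Dfn L M A) (hB : Dfn L M B) (h : Inf (fun x => A x ∨ B x)) :
    Inf A ∨ Inf B := by
  by_contra hn
  rw [not_or, not_inf_iff hA, not_inf_iff hB] at hn
  exact h.infinite ((hn.1.union hn.2).subset fun x hx => hx)

@[fun_prop] theorem Dfn.inf' {X : Type*} [Obj L M X] {A : X → M → Prop}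
    (hA : Dfn L M (fun p : X × M => A p.1 p.2)) : Dfn L M (fun x => Inf (A x)) := by
  unfold Inf
  simp only [all_iff, imp_iff_not_or]; fun_prop

theorem exists_sub {I : Type*} [Finite I] {A : I → M → Prop} (hA : ∀ i, Dfn L M (A i)) {a b : M}
    (hab : a < b) (h : ∀ x, a < x → x < b → ∃ i, A i x) :
    ∃ i a' b', a' < b' ∧ ∀ x, a' < x → x < b' → a < x ∧ x < b ∧ A i x := by
  by_contra hn
  push Not at hn
  have : ∀ i, {x | a < x ∧ x < b ∧ A i x}.Finite := by
    intro i
    have hd : Dfn L M (fun x => a < x ∧ x < b ∧ A i x) := by have := hA i; fun_prop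
    rw [← not_inf_iff hd]
    rintro ⟨a', b', h1, h2⟩
    obtain ⟨x, h3, h4, h5⟩ := hn i a' b' h1
    have := h2 x h3 h4
    exact h5 this.1 this.2.1 this.2.2
  refine Set.Ioo_infinite hab ((Set.finite_iUnion this).subset fun x hx => ?_)
  obtain ⟨i, hi⟩ := h x hx.1 hx.2
  exact Set.mem_iUnion.2 ⟨i, hx.1, hx.2, hi⟩

end MS

open FirstOrder Set
set_option linter.unusedVariables false
set_option linter.unusedSectionVars false
namespace MS
variable {L : Language} {M : Type*} [L.Structure M] [LinearOrder M] [DenselyOrdered M]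
  [NoMinOrder M] [NoMaxOrder M] [Nonempty M] [OM L M]

theorem jump {R : M × M → Prop} (hR : Dfn L M R) (htr : ∀ x y z, R (x, y) → R (y, z) → R (x, z))
    (hto : ∀ x y, R (x, y) ∨ R (y, x)) {a e : M} (hae : a < e)
    (hmin : ∀ x, a < x → x < e → ∃ p q, p < x ∧ x < q ∧ ∀ y, p < y → y < q → y ≠ x → ¬ R (y, x)) :
    ∃ a', a ≤ a' ∧ a' < e ∧ ∀ z, a' < z → z < e →
      ∃ p q, p < z ∧ z < q ∧ ∀ y y', p < y → y < z → z < y' → y' < q → ¬ R (y, y') := by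
  have hB : Dfn L M (fun x => ∀ y, x < y → y < e → ¬ R (y, x)) := by
    simp only [all_iff, imp_iff_not_or]; fun_prop
  -- find `a1` with no `B` on `(a1, e)`
  obtain ⟨a1, ha1, ha1e, hnB⟩ : ∃ a1, a ≤ a1 ∧ a1 < e ∧ ∀ x, a1 < x → x < e →
      ∃ y, x < y ∧ y < e ∧ R (y, x) := by
    obtain ⟨a1, h1, h2 | h2⟩ := left_const hB e
    · exfalso
      obtain ⟨y, hy1, hy2⟩ := exists_between (max_lt hae h1)
      obtain ⟨p, q, hp, hq, hpq⟩ := hmin y ((le_max_left _ _).trans_lt hy1) hy2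
      obtain ⟨w, hw1, hw2⟩ := exists_between (max_lt hp ((le_max_right _ _).trans_lt hy1))
      have h3 := h2 w ((le_max_right _ _).trans_lt hw1) (hw2.trans hy2) y hw2 hy2
      have h4 := hpq w ((le_max_left _ _).trans_lt hw1) (hw2.trans hq) hw2.ne
      exact (hto y w).elim h3 h4
    · refine ⟨max a a1, le_max_left _ _, max_lt hae h1, fun x hx1 hx2 => ?_⟩
      have := h2 x ((le_max_right _ _).trans_lt hx1) hx2
      push Not at this
      exact this
  -- eventually `y ≺ c`
  have hev : ∀ c, a1 < c → c < e → ∃ d, c ≤ d ∧ d < e ∧ ∀ y, d < y → y < e → ¬ R (c, y) := by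
    intro c hc1 hc2
    obtain ⟨d1, h1, h2⟩ := left_const (L := L) (A := fun y => R (c, y)) (by fun_prop) e
    rcases h2 with h2 | h2
    swap
    · exact ⟨max c d1, le_max_left _ _, max_lt hc2 h1, fun y hy1 hy2 =>
        h2 y ((le_max_right _ _).trans_lt hy1) hy2⟩
    exfalso
    obtain ⟨d2, h3, h4⟩ := left_const (L := L) (A := fun y => R (y, c)) (by fun_prop) e
    rcases h4 with h4 | h4
    · -- constant
      have hm : max a1 (max d1 d2) < e := max_lt ha1e (max_lt h1 h3)
      obtain ⟨y, hy1, hy2⟩ := exists_between hm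
      obtain ⟨p, q, hp, hq, hpq⟩ := hmin y (ha1.trans_lt ((le_max_left _ _).trans_lt hy1)) hy2
      have hmy : max d1 d2 < y := (le_max_right _ _).trans_lt hy1
      obtain ⟨w, hw1, hw2⟩ := exists_between (max_lt hp hmy)
      have hdw : max d1 d2 < w := (le_max_right _ _).trans_lt hw1
      have h5 := h4 w ((le_max_right _ _).trans_lt hdw) (hw2.trans hy2)
      have h6 := h2 y ((le_max_left _ _).trans_lt hmy) hy2
      exact hpq w ((le_max_left _ _).trans_lt hw1) (hw2.trans hq) hw2.ne (htr _ _ _ h5 h6)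
    · have hD : Dfn L M (fun d => c ≤ d ∧ d < e ∧ ∀ y, d < y → y < e → ¬ R (y, c)) := by
        simp only [all_iff, imp_iff_not_or]; fun_prop
      have h0 : c ≤ max c d2 ∧ max c d2 < e ∧ ∀ y, max c d2 < y → y < e → ¬ R (y, c) :=
        ⟨le_max_left _ _, max_lt hc2 h3, fun y hy1 hy2 => h4 y ((le_max_right _ _).trans_lt hy1) hy2⟩
      obtain ⟨s, hs⟩ := OM.glb _ hD ⟨_, h0⟩ ⟨c, fun x hx => hx.1⟩
      have hcs : c ≤ s := hs.2 fun x hx => hx.1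
      have hse : s < e := (hs.1 h0).trans_lt h0.2.1
      have hall : ∀ y, s < y → y < e → ¬ R (y, c) := by
        intro y hy1 hy2
        obtain ⟨d, hd, hdy⟩ := (isGLB_lt_iff hs).1 hy1
        exact hd.2.2 y hdy hy2
      by_cases hsc : R (s, c)
      · obtain ⟨y, hy1, hy2, hy3⟩ := hnB s (hc1.trans_le hcs) hse
        exact hall y hy1 hy2 (htr _ _ _ hy3 hsc)
      · have hcs' : c < s := lt_of_le_of_ne hcs fun h => hsc (h ▸ (hto c c).elim id id)
        obtain ⟨p, q, hp, hq, hpq⟩ := hmin s (ha1.trans_lt (hc1.trans_le hcs)) hse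
        have hm := max_lt hp hcs'
        obtain ⟨w, hw1, hw2⟩ := exists_between hm
        have : s ≤ w := hs.1 (show c ≤ w ∧ w < e ∧ ∀ y, w < y → y < e → ¬ R (y, c) from by
          refine ⟨((le_max_right _ _).trans_lt hw1).le, hw2.trans hse, fun y hy1 hy2 hyc => ?_⟩
          rcases lt_trichotomy y s with h | h | h
          · have h7 := hpq y ((le_max_left _ _).trans_lt (hw1.trans hy1)) (h.trans hq) h.ne
            have h8 : R (s, y) := (hto s y).elim id (fun h => absurd h h7)
            exact hsc (htr _ _ _ h8 hyc)
          · exact hsc (h ▸ hyc)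
          · exact hall y h hy2 hyc)
        exact absurd hw2 (not_lt.2 this)
  -- jump points
  have hJ : Dfn L M (fun z => ∃ p q, p < z ∧ z < q ∧
      ∀ y y', p < y → y < z → z < y' → y' < q → ¬ R (y, y')) := by
    simp only [all_iff, imp_iff_not_or]; fun_prop
  have hcof : ∀ c, a1 < c → c < e → ∃ z, c < z ∧ z < e ∧ ∃ p q, p < z ∧ z < q ∧
      ∀ y y', p < y → y < z → z < y' → y' < q → ¬ R (y, y') := by
    intro c hc1 hc2
    have hD : Dfn L M (fun d => c ≤ d ∧ d < e ∧ ∀ y, d < y → y < e → ¬ R (c, y)) := by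
      simp only [all_iff, imp_iff_not_or]; fun_prop
    obtain ⟨d0, h0⟩ := hev c hc1 hc2
    obtain ⟨s, hs⟩ := OM.glb _ hD ⟨_, h0⟩ ⟨c, fun x hx => hx.1⟩
    have hcs : c ≤ s := hs.2 fun x hx => hx.1
    have hse : s < e := (hs.1 h0).trans_lt h0.2.1
    have hall : ∀ y, s < y → y < e → ¬ R (c, y) := by
      intro y hy1 hy2
      obtain ⟨d, hd, hdy⟩ := (isGLB_lt_iff hs).1 hy1
      exact hd.2.2 y hdy hy2
    have hcs' : c < s := by
      refine lt_of_le_of_ne hcs ?_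
      rintro rfl
      obtain ⟨p, q, hp, hq, hpq⟩ := hmin c (ha1.trans_lt hc1) hc2
      obtain ⟨w, hw1, hw2⟩ := exists_between (lt_min hq hc2)
      exact (hto c w).elim (hall w hw1 (hw2.trans_le (min_le_right _ _)))
        (hpq w (hp.trans hw1) (hw2.trans_le (min_le_left _ _)) hw1.ne')
    refine ⟨s, hcs', hse, ?_⟩
    obtain ⟨p, hp, hpc⟩ := left_const (L := L) (A := fun y => R (c, y)) (by fun_prop) s
    rcases hpc with hpc | hpc
    · refine ⟨p, e, hp, hse, fun y y' h1 h2 h3 h4 h5 => ?_⟩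
      exact hall y' h3 h4 (htr _ _ _ (hpc y h1 h2) h5)
    · exfalso
      have hcs2 : R (c, s) := by
        by_contra hcs3
        obtain ⟨w, hw1, hw2⟩ := exists_between (max_lt hp hcs')
        have : s ≤ w := hs.1 (show c ≤ w ∧ w < e ∧ ∀ y, w < y → y < e → ¬ R (c, y) from by
          refine ⟨((le_max_right _ _).trans_lt hw1).le, hw2.trans hse, fun y hy1 hy2 hyc => ?_⟩
          rcases lt_trichotomy y s with h | h | h
          · exact hpc y ((le_max_left _ _).trans_lt (hw1.trans hy1)) h hyc
          · exact hcs3 (h ▸ hyc)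
          · exact hall y h hy2 hyc)
        exact absurd hw2 (not_lt.2 this)
      obtain ⟨p', q, hp', hq, hpq⟩ := hmin s (ha1.trans_lt (hc1.trans hcs')) hse
      obtain ⟨w, hw1, hw2⟩ := exists_between (max_lt hp hp')
      have h1 := hpc w ((le_max_left _ _).trans_lt hw1) hw2
      have h2 := hpq w ((le_max_right _ _).trans_lt hw1) (hw2.trans hq) hw2.ne
      exact h1 (htr _ _ _ hcs2 ((hto s w).elim id (fun h => absurd h h2)))
  obtain ⟨a2, h1, h2 | h2⟩ := left_const hJ e
  · exact ⟨max a a2, le_max_left _ _, max_lt hae h1, fun z hz1 hz2 =>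
      h2 z ((le_max_right _ _).trans_lt hz1) hz2⟩
  · exfalso
    obtain ⟨c, hc1, hc2⟩ := exists_between (max_lt ha1e h1)
    obtain ⟨z, hz1, hz2, hz3⟩ := hcof c ((le_max_left _ _).trans_lt hc1) hc2
    exact h2 z ((le_max_right _ _).trans_lt (hc1.trans hz1)) hz2 hz3

theorem no_local_min {R : M × M → Prop} (hR : Dfn L M R)
    (htr : ∀ x y z, R (x, y) → R (y, z) → R (x, z))
    (hto : ∀ x y, R (x, y) ∨ R (y, x)) {a e : M} (hae : a < e)
    (hmin : ∀ x, a < x → x < e → ∃ p q, p < x ∧ x < q ∧ ∀ y, p < y → y < q → y ≠ x → ¬ R (y, x)) :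
    False := by
  obtain ⟨a', h1, h2, h3⟩ := jump hR htr hto hae hmin
  obtain ⟨e', h4, h5, h6⟩ := @jump L M _ (dualLO M) dualDense dualMin dualMax _ OM.dual R hR htr hto
    e a' h2 (by
      intro x hx hx'
      obtain ⟨p, q, hp, hq, h⟩ := hmin x (h1.trans_lt hx') hx
      exact ⟨q, p, hq, hp, fun y h1 h2 => h y h2 h1⟩)
  change a' < e' at h5
  change e' ≤ e at h4
  obtain ⟨z, hz1, hz2⟩ := exists_between h5
  obtain ⟨p, q, hp, hq, hpq⟩ := h3 z hz1 (hz2.trans_le h4)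
  obtain ⟨q', p', hq', hp', hpq'⟩ := h6 z hz2 hz1
  change z < q' at hq'
  change p' < z at hp'
  obtain ⟨y, hy1, hy2⟩ := exists_between (max_lt hp hp')
  obtain ⟨y', hy1', hy2'⟩ := exists_between (lt_min hq hq')
  have := hpq y y' ((le_max_left _ _).trans_lt hy1) hy2 hy1' (hy2'.trans_le (min_le_left _ _))
  have h7 := hpq' y' y (hy2'.trans_le (min_le_right _ _)) hy1' hy2 ((le_max_right _ _).trans_lt hy1)
  exact (hto y y').elim this h7

theorem pre_inc {R : M × M → Prop} (hR : Dfn L M R)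
    (htr : ∀ x y z, R (x, y) → R (y, z) → R (x, z))
    (hto : ∀ x y, R (x, y) ∨ R (y, x)) {a e : M}
    (hl : ∀ x, a < x → x < e → ∃ p, p < x ∧ ∀ y, p < y → y < x → ¬ R (x, y))
    (hr : ∀ x, a < x → x < e → ∃ p, x < p ∧ ∀ y, x < y → y < p → ¬ R (y, x)) :
    ∀ x y, a < x → x < y → y < e → ¬ R (y, x) := by
  intro x y hx hxy hy
  refine ri (L := L) (P := fun y => ¬ R (y, x)) (b := e) (by fun_prop) ?_ ?_ y hxy hy
  · exact hr x hx (hxy.trans hy)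
  · intro z hz hze hw
    obtain ⟨p, hp, hp'⟩ := hl z (hx.trans hz) hze
    obtain ⟨w, hw1, hw2⟩ := exists_between (max_lt hp hz)
    have h1 := hp' w ((le_max_left _ _).trans_lt hw1) hw2
    have h2 := hw w ((le_max_right _ _).trans_lt hw1) hw2
    have h3 : ¬ R (z, x) := fun h => h1 (htr _ _ _ h ((hto x w).elim id (fun h => absurd h h2)))
    obtain ⟨q, hq, hq'⟩ := hr z (hx.trans hz) hze
    refine ⟨h3, q, hq, fun w hw1 hw2 hw3 => hq' w hw1 hw2 (htr _ _ _ hw3 ?_)⟩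
    exact (hto x z).elim id (fun h => absurd h h3)

/-- monotonicity for preorders -/
theorem mono_pre {R : M × M → Prop} (hR : Dfn L M R)
    (htr : ∀ x y z, R (x, y) → R (y, z) → R (x, z))
    (hto : ∀ x y, R (x, y) ∨ R (y, x)) {a b : M} (hab : a < b) :
    ∃ a' b', a' < b' ∧ (∀ x, a' < x → x < b' → a < x ∧ x < b) ∧
      ((∀ x y, a' < x → x < b' → a' < y → y < b' → R (x, y)) ∨
       (∀ x y, a' < x → x < y → y < b' → ¬ R (y, x)) ∨
       (∀ x y, a' < x → x < y → y < b' → ¬ R (x, y))) := by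
  let A : Fin 3 × Fin 3 → M → Prop := fun i x =>
    (∃ p, p < x ∧ ∀ y, p < y → y < x →
      ((i.1 = 0 → ¬ R (x, y)) ∧ (i.1 = 1 → R (x, y) ∧ R (y, x)) ∧ (i.1 = 2 → ¬ R (y, x)))) ∧
    (∃ p, x < p ∧ ∀ y, x < y → y < p →
      ((i.2 = 0 → ¬ R (x, y)) ∧ (i.2 = 1 → R (x, y) ∧ R (y, x)) ∧ (i.2 = 2 → ¬ R (y, x))))
  have hA : ∀ i, Dfn L M (A i) := by
    intro i
    simp only [A, all_iff, imp_iff_not_or]; fun_prop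
  have hcov : ∀ x, a < x → x < b → ∃ i, A i x := by
    intro x _ _
    have hl : ∃ i : Fin 3, ∃ p, p < x ∧ ∀ y, p < y → y < x →
      ((i = 0 → ¬ R (x, y)) ∧ (i = 1 → R (x, y) ∧ R (y, x)) ∧ (i = 2 → ¬ R (y, x))) := by
      obtain ⟨p, hp, h | h⟩ := left_const (L := L) (A := fun y => R (x, y)) (by fun_prop) x
      · obtain ⟨q, hq, h' | h'⟩ := left_const (L := L) (A := fun y => R (y, x)) (by fun_prop) x
        · exact ⟨1, max p q, max_lt hp hq, fun y h1 h2 => by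
            simp [h y ((le_max_left _ _).trans_lt h1) h2, h' y ((le_max_right _ _).trans_lt h1) h2]⟩
        · exact ⟨2, q, hq, fun y h1 h2 => by simp [h' y h1 h2]⟩
      · exact ⟨0, p, hp, fun y h1 h2 => by simp [h y h1 h2]⟩
    have hr : ∃ i : Fin 3, ∃ p, x < p ∧ ∀ y, x < y → y < p →
      ((i = 0 → ¬ R (x, y)) ∧ (i = 1 → R (x, y) ∧ R (y, x)) ∧ (i = 2 → ¬ R (y, x))) := by
      obtain ⟨p, hp, h | h⟩ := right_const (L := L) (A := fun y => R (x, y)) (by fun_prop) x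
      · obtain ⟨q, hq, h' | h'⟩ := right_const (L := L) (A := fun y => R (y, x)) (by fun_prop) x
        · exact ⟨1, min p q, lt_min hp hq, fun y h1 h2 => by
            simp [h y h1 (h2.trans_le (min_le_left _ _)), h' y h1 (h2.trans_le (min_le_right _ _))]⟩
        · exact ⟨2, q, hq, fun y h1 h2 => by simp [h' y h1 h2]⟩
      · exact ⟨0, p, hp, fun y h1 h2 => by simp [h y h1 h2]⟩
    obtain ⟨i, hi⟩ := hl
    obtain ⟨j, hj⟩ := hr
    exact ⟨(i, j), hi, hj⟩
  obtain ⟨⟨i, j⟩, a1, b1, hab1, h1⟩ := exists_sub hA hab hcov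
  have hsub : ∀ x, a1 < x → x < b1 → a < x ∧ x < b := fun x hx hx' => ⟨(h1 x hx hx').1, (h1 x hx hx').2.1⟩
  have hAx : ∀ x, a1 < x → x < b1 → A (i, j) x := fun x hx hx' => (h1 x hx hx').2.2
  obtain ⟨x0, hx0, hx0'⟩ := exists_between hab1
  by_cases hi1 : i = 1
  · obtain ⟨⟨p, hp, h⟩, _⟩ := hAx x0 hx0 hx0'
    refine ⟨max p a1, x0, max_lt hp hx0, fun x hx hx' => hsub x ((le_max_right _ _).trans_lt hx)
      (hx'.trans hx0'), Or.inl fun x y h1 h2 h3 h4 => ?_⟩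
    have h5 := (h x ((le_max_left _ _).trans_lt h1) h2).2.1 hi1
    have h6 := (h y ((le_max_left _ _).trans_lt h3) h4).2.1 hi1
    exact htr _ _ _ h5.2 h6.1
  by_cases hj1 : j = 1
  · obtain ⟨_, ⟨p, hp, h⟩⟩ := hAx x0 hx0 hx0'
    refine ⟨x0, min p b1, lt_min hp hx0', fun x hx hx' => hsub x (hx0.trans hx)
      (hx'.trans_le (min_le_right _ _)), Or.inl fun x y h1 h2 h3 h4 => ?_⟩
    have h5 := (h x h1 (h2.trans_le (min_le_left _ _))).2.1 hj1
    have h6 := (h y h3 (h4.trans_le (min_le_left _ _))).2.1 hj1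
    exact htr _ _ _ h5.2 h6.1
  refine ⟨a1, b1, hab1, hsub, Or.inr ?_⟩
  have hi : i = 0 ∨ i = 2 := by omega
  have hj : j = 0 ∨ j = 2 := by omega
  rcases hi with hi | hi <;> rcases hj with hj | hj
  · exfalso
    refine no_local_min (L := L) (R := fun p => R (p.2, p.1)) (by fun_prop) (fun x y z h1 h2 => htr _ _ _ h2 h1)
      (fun x y => (hto x y).symm) hab1 fun x hx hx' => ?_
    obtain ⟨⟨p, hp, h⟩, ⟨q, hq, h'⟩⟩ := hAx x hx hx'
    refine ⟨p, q, hp, hq, fun y h1 h2 h3 => ?_⟩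
    rcases lt_or_gt_of_ne h3 with h3 | h3
    · exact (h y h1 h3).1 hi
    · exact (h' y h3 h2).1 hj
  · left
    refine pre_inc hR htr hto ?_ ?_
    · intro x hx hx'
      obtain ⟨⟨p, hp, h⟩, ⟨q, hq, h'⟩⟩ := hAx x hx hx'
      exact ⟨p, hp, fun y h1 h2 => (h y h1 h2).1 hi⟩
    · intro x hx hx'
      obtain ⟨⟨p, hp, h⟩, ⟨q, hq, h'⟩⟩ := hAx x hx hx'
      exact ⟨q, hq, fun y h1 h2 => (h' y h1 h2).2.2 hj⟩
  · right
    refine pre_inc (L := L) (R := fun p => R (p.2, p.1)) (by fun_prop) (fun x y z h1 h2 => htr _ _ _ h2 h1)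
      (fun x y => (hto x y).symm) ?_ ?_
    · intro x hx hx'
      obtain ⟨⟨p, hp, h⟩, ⟨q, hq, h'⟩⟩ := hAx x hx hx'
      exact ⟨p, hp, fun y h1 h2 => (h y h1 h2).2.2 hi⟩
    · intro x hx hx'
      obtain ⟨⟨p, hp, h⟩, ⟨q, hq, h'⟩⟩ := hAx x hx hx'
      exact ⟨q, hq, fun y h1 h2 => (h' y h1 h2).1 hj⟩
  · exfalso
    refine no_local_min hR htr hto hab1 fun x hx hx' => ?_
    obtain ⟨⟨p, hp, h⟩, ⟨q, hq, h'⟩⟩ := hAx x hx hx'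
    refine ⟨p, q, hp, hq, fun y h1 h2 h3 => ?_⟩
    rcases lt_or_gt_of_ne h3 with h3 | h3
    · exact (h y h1 h3).2.2 hi
    · exact (h' y h3 h2).2.2 hj
end MS

open FirstOrder Set
set_option linter.unusedVariables false
set_option linter.unusedSectionVars false
namespace MS

/-- order continuity at a point -/
def ContAt {M K : Type*} [LT M] [LT K] (f : M → K) (x : M) : Prop :=
  (∀ u, u < f x → ∃ c d, c < x ∧ x < d ∧ ∀ y, c < y → y < d → u < f y) ∧
  (∀ u, f x < u → ∃ c d, c < x ∧ x < d ∧ ∀ y, c < y → y < d → f y < u)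

variable {L : Language} {M : Type*} [L.Structure M] [LinearOrder M] [DenselyOrdered M]
  [NoMinOrder M] [NoMaxOrder M] [Nonempty M] [OM L M]

theorem mono_cont {K : Type*} [LinearOrder K] [DenselyOrdered K] {f : M → K} {a b : M} {p q : K}
    (hpq : p < q) (hf : ∀ x y, a < x → x < y → y < b → f x < f y)
    (hs : ∀ w, p < w → w < q → ∃ x, a < x ∧ x < b ∧ f x = w) :
    ∃ a' b', a < a' ∧ a' < b' ∧ b' < b ∧ ∀ x, a' < x → x < b' → ContAt f x := by
  obtain ⟨u, hu1, hu2⟩ := exists_between hpq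
  obtain ⟨v, hv1, hv2⟩ := exists_between hu2
  have hinv : ∀ x y, a < x → x < b → a < y → y < b → f x < f y → x < y := by
    intro x y h1 h2 h3 h4 h5
    by_contra hn
    rcases (not_lt.1 hn).lt_or_eq with h | h
    · exact absurd (hf y x h3 h h2) (not_lt.2 h5.le)
    · rw [h] at h5; exact lt_irrefl _ h5
  obtain ⟨x1, h1, h1', e1⟩ := hs u hu1 hu2
  obtain ⟨x2, h2, h2', e2⟩ := hs v (hu1.trans hv1) hv2
  have h12 : x1 < x2 := hinv _ _ h1 h1' h2 h2' (by rw [e1, e2]; exact hv1)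
  refine ⟨x1, x2, h1, h12, h2', fun x hx hx' => ⟨fun w hw => ?_, fun w hw => ?_⟩⟩
  · have hfx1 : f x1 < f x := hf _ _ h1 hx (hx'.trans h2')
    have hfx2 : f x < f x2 := hf _ _ (h1.trans hx) hx' h2'
    obtain ⟨z, hz1, hz2⟩ := exists_between (max_lt hw hfx1)
    have hzu : u < z := e1 ▸ (le_max_right _ _).trans_lt hz1
    obtain ⟨y0, hy0, hy0', e0⟩ := hs z (hu1.trans hzu) ((hz2.trans hfx2).trans (e2 ▸ hv2))
    refine ⟨y0, x2, hinv _ _ hy0 hy0' (h1.trans hx) (hx'.trans h2') (e0 ▸ hz2), hx', ?_⟩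
    intro y hy hy'
    exact ((le_max_left _ _).trans_lt hz1).trans (e0 ▸ hf _ _ hy0 hy (hy'.trans h2'))
  · have hfx1 : f x1 < f x := hf _ _ h1 hx (hx'.trans h2')
    have hfx2 : f x < f x2 := hf _ _ (h1.trans hx) hx' h2'
    obtain ⟨z, hz1, hz2⟩ := exists_between (lt_min hw hfx2)
    have hzu : z < v := e2 ▸ hz2.trans_le (min_le_right _ _)
    have hzp : p < z := (hu1.trans (e1 ▸ hfx1)).trans hz1
    obtain ⟨y0, hy0, hy0', e0⟩ := hs z hzp (hzu.trans hv2)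
    refine ⟨x1, y0, hx, hinv _ _ (h1.trans hx) (hx'.trans h2') hy0 hy0' (e0 ▸ hz1), ?_⟩
    intro y hy hy'
    have : f y < f y0 := hf _ _ (h1.trans hy) hy' hy0'
    rw [e0] at this
    exact this.trans (hz2.trans_le (min_le_left _ _))

theorem dfn_cont {f : M → M} (hf : Dfn L M f) {a b : M} (hab : a < b) :
    ∃ a' b', a' < b' ∧ (∀ x, a' < x → x < b' → a < x ∧ x < b) ∧
      ∀ x, a' < x → x < b' → ContAt f x := by
  obtain ⟨a', b', h1, h2, h3⟩ := mono_pre (L := L) (R := fun p => f p.1 ≤ f p.2) (by fun_prop)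
    (fun x y z h1 h2 => le_trans h1 h2) (fun x y => le_total _ _) hab
  have himg : ∀ (hinj : Set.InjOn f (Ioo a' b')), ∃ p q, p < q ∧ ∀ w, p < w → w < q →
      ∃ x, a' < x ∧ x < b' ∧ f x = w := by
    intro hinj
    have hinf := (Set.Ioo_infinite h1).image hinj
    have : Inf (fun w => ∃ x, a' < x ∧ x < b' ∧ f x = w) := by
      refine inf_of_infinite (L := L) (by fun_prop) (hinf.mono ?_)
      rintro w ⟨x, hx, rfl⟩
      exact ⟨x, hx.1, hx.2, rfl⟩
    exact this
  rcases h3 with h3 | h3 | h3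
  · refine ⟨a', b', h1, h2, fun x hx hx' => ⟨fun u hu => ⟨a', b', hx, hx', fun y hy hy' => ?_⟩,
      fun u hu => ⟨a', b', hx, hx', fun y hy hy' => ?_⟩⟩⟩
    · exact hu.trans_le (h3 x y hx hx' hy hy')
    · exact (h3 y x hy hy' hx hx').trans_lt hu
  · have h4 : ∀ x y, a' < x → x < y → y < b' → f x < f y := fun x y h5 h6 h7 => not_le.1 (h3 x y h5 h6 h7)
    have hm : StrictMonoOn f (Ioo a' b') := fun x hx y hy hxy => h4 x y hx.1 hxy hy.2
    obtain ⟨p, q, hpq, hs⟩ := himg hm.injOn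
    obtain ⟨a2, b2, h5, h6, h7, h8⟩ := mono_cont hpq h4 hs
    exact ⟨a2, b2, h6, fun x hx hx' => h2 x (h5.trans hx) (hx'.trans h7), h8⟩
  · have h4 : ∀ x y, a' < x → x < y → y < b' → f y < f x := fun x y h5 h6 h7 => not_le.1 (h3 x y h5 h6 h7)
    have hm : StrictAntiOn f (Ioo a' b') := fun x hx y hy hxy => h4 x y hx.1 hxy hy.2
    obtain ⟨p, q, hpq, hs⟩ := himg hm.injOn
    obtain ⟨a2, b2, h5, h6, h7, h8⟩ := mono_cont (K := Mᵒᵈ) (f := f) (p := q) (q := p) hpq h4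
      (fun w h1 h2 => hs w h2 h1)
    exact ⟨a2, b2, h6, fun x hx hx' => h2 x (h5.trans hx) (hx'.trans h7), fun x hx hx' =>
      ⟨(h8 x hx hx').2, (h8 x hx hx').1⟩⟩

theorem box_aux {Q : M × M → Prop} (hQ : Dfn L M Q) {a b e : M} (hab : a < b)
    (h : ∀ s, a < s → s < b → Inf (fun t => e < t ∧ Q (s, t))) :
    ∃ a' b' t1 t2, a' < b' ∧ t1 < t2 ∧ (∀ x, a' < x → x < b' → a < x ∧ x < b) ∧
      ∀ s t, a' < s → s < b' → t1 < t → t < t2 → Q (s, t) := by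
  let S : M × M → Prop := fun p => e ≤ p.2 ∧ ∃ y, p.2 < y ∧ ∀ w, p.2 < w → w < y → Q (p.1, w)
  have hS : Dfn L M S := by simp only [S, all_iff, imp_iff_not_or]; fun_prop
  obtain ⟨α, hα, hα'⟩ := exists_dfn_fun (L := L) (R := fun p : M × M => (∀ x, S (p.1, x) → p.2 ≤ x) ∧
      ∀ y, (∀ x, S (p.1, x) → y ≤ x) → y ≤ p.2)
    (by simp only [all_iff, imp_iff_not_or]; fun_prop)
    (fun x y y' h1 h2 => le_antisymm (h2.2 _ h1.1) (h1.2 _ h2.1))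
  have hglb : ∀ s, a < s → s < b → IsGLB {x | S (s, x)} (α s) := by
    intro s hs hs'
    obtain ⟨p, q, hpq, h1⟩ := h s hs hs'
    obtain ⟨g, hg⟩ := OM.glb (L := L) (fun x => S (s, x)) (by fun_prop) ⟨p, by
      refine ⟨?_, q, hpq, fun w hw hw' => (h1 w hw hw').2⟩
      by_contra hn
      obtain ⟨w, hw, hw'⟩ := exists_between (lt_min hpq (not_le.1 hn))
      exact absurd (h1 w hw (hw'.trans_le (min_le_left _ _))).1
        (not_lt.2 (hw'.trans_le (min_le_right _ _)).le)⟩ ⟨e, fun x hx => hx.1⟩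
    have := hα' s ⟨g, fun x hx => hg.1 hx, fun y hy => hg.2 hy⟩
    exact ⟨fun x hx => this.1 x hx, fun y hy => this.2 y hy⟩
  have hαr : ∀ s, a < s → s < b → ∃ y, α s < y ∧ ∀ w, α s < w → w < y → Q (s, w) := by
    intro s hs hs'
    obtain ⟨y, hy, h1 | h1⟩ := right_const (L := L) (A := fun w => Q (s, w)) (by fun_prop) (α s)
    · exact ⟨y, hy, h1⟩
    · exfalso
      obtain ⟨x, hx, hxy⟩ := (isGLB_lt_iff (hglb s hs hs')).1 hy
      have hx2 := hx
      obtain ⟨_, z, hz, hz'⟩ := hx2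
      obtain ⟨w, hw, hw'⟩ := exists_between (lt_min hz hxy)
      exact h1 w (((hglb s hs hs').1 hx).trans_lt hw) (hw'.trans_le (min_le_right _ _))
        (hz' w hw (hw'.trans_le (min_le_left _ _)))
  let A : M × M → Prop := fun p => ∀ w, α p.1 < w → w < p.2 → Q (p.1, w)
  have hA : Dfn L M A := by simp only [A, all_iff, imp_iff_not_or]; fun_prop
  have hAd : ∀ s y y', y ≤ y' → A (s, y') → A (s, y) := fun s y y' h1 h2 w hw hw' =>
    h2 w hw (hw'.trans_le h1)
  obtain ⟨a1, b1, hab1, hsub1, hcont⟩ := dfn_cont hα hab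
  obtain ⟨a2, b2, hab2, hsub2, hmon⟩ := mono_pre (L := L)
    (R := fun p : M × M => ∀ y, A (p.1, y) → A (p.2, y))
    (by simp only [all_iff, imp_iff_not_or]; fun_prop) (fun x y z h1 h2 w hw => h2 w (h1 w hw))
    (by
      intro x y
      by_contra hn
      push Not at hn
      obtain ⟨⟨u, hu1, hu2⟩, v, hv1, hv2⟩ := hn
      rcases le_total u v with h | h
      · exact hu2 (hAd _ _ _ h hv1)
      · exact hv2 (hAd _ _ _ h hu1)) hab1
  have hmon' : (∀ x y, a2 < x → x < y → y < b2 → ∀ t, A (x, t) → A (y, t)) ∨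
      (∀ x y, a2 < x → x < y → y < b2 → ∀ t, A (y, t) → A (x, t)) := by
    rcases hmon with h | h | h
    · exact Or.inl fun x y h1 h2 h3 => h x y h1 (h2.trans h3) (h1.trans h2) h3
    · left
      intro x y h1 h2 h3 t ht
      have := h x y h1 h2 h3
      push Not at this
      obtain ⟨u, hu1, hu2⟩ := this
      rcases le_total u t with h | h
      · exact absurd (hAd _ _ _ h ht) hu2
      · exact hAd _ _ _ h hu1
    · right
      intro x y h1 h2 h3 t ht
      have := h x y h1 h2 h3
      push Not at this
      obtain ⟨u, hu1, hu2⟩ := this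
      rcases le_total u t with h | h
      · exact absurd (hAd _ _ _ h ht) hu2
      · exact hAd _ _ _ h hu1
  obtain ⟨s0, hs0, hs0'⟩ := exists_between hab2
  have hs1 := hsub2 s0 hs0 hs0'
  have hs2 := hsub1 s0 hs1.1 hs1.2
  obtain ⟨y1, hy1, hy1'⟩ := hαr s0 hs2.1 hs2.2
  obtain ⟨t1, ht1, ht1'⟩ := exists_between hy1
  obtain ⟨c, d, hc, hd, hcd⟩ := (hcont s0 hs1.1 hs1.2).2 t1 ht1
  have hsub : ∀ x, a2 < x → x < b2 → a < x ∧ x < b := fun x h1 h2 =>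
    hsub1 x (hsub2 x h1 h2).1 (hsub2 x h1 h2).2
  rcases hmon' with h1 | h1
  · refine ⟨s0, min d b2, t1, y1, lt_min hd hs0', ht1', fun x hx hx' => hsub x (hs0.trans hx)
      (hx'.trans_le (min_le_right _ _)), fun s t hs hs' ht ht' => ?_⟩
    exact h1 s0 s hs0 hs (hs'.trans_le (min_le_right _ _)) y1 hy1' t
      ((hcd s (hc.trans hs) (hs'.trans_le (min_le_left _ _))).trans ht) ht'
  · refine ⟨max c a2, s0, t1, y1, max_lt hc hs0, ht1', fun x hx hx' => hsub x
      ((le_max_right _ _).trans_lt hx) (hx'.trans hs0'), fun s t hs hs' ht ht' => ?_⟩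
    exact h1 s s0 ((le_max_right _ _).trans_lt hs) hs' hs0' y1 hy1' t
      ((hcd s ((le_max_left _ _).trans_lt hs) (hs'.trans hd)).trans ht) ht'

theorem box {Q : M × M → Prop} (hQ : Dfn L M Q) {a b : M} (hab : a < b)
    (h : ∀ s, a < s → s < b → Inf (fun t => Q (s, t))) :
    ∃ a' b' t1 t2, a' < b' ∧ t1 < t2 ∧ (∀ x, a' < x → x < b' → a < x ∧ x < b) ∧
      ∀ s t, a' < s → s < b' → t1 < t → t < t2 → Q (s, t) := by
  have e : M := Classical.arbitrary M
  obtain ⟨i, a1, b1, hab1, h1⟩ := exists_sub (L := L) (I := Bool)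
    (A := fun i s => (i = true → Inf (fun t => e < t ∧ Q (s, t))) ∧
      (i = false → Inf (fun t => t < e ∧ Q (s, t))))
    (by intro i; simp only [imp_iff_not_or]; fun_prop) hab (by
      intro s hs hs'
      obtain ⟨p, q, hpq, h1⟩ := h s hs hs'
      by_cases hpe : e < q
      · refine ⟨true, fun _ => ⟨max p e, q, max_lt hpq hpe, ?_⟩, by simp⟩
        intro x hx hx'
        exact ⟨(le_max_right _ _).trans_lt hx, h1 x ((le_max_left _ _).trans_lt hx) hx'⟩
      · refine ⟨false, by simp, fun _ => ⟨p, q, hpq, fun x hx hx' => ⟨hx'.trans_le (not_lt.1 hpe), h1 x hx hx'⟩⟩⟩)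
  rcases i with _ | _
  · obtain ⟨b', a', t2, t1, h2, h3, h4, h5⟩ := @box_aux L M _ (dualLO M) dualDense dualMin dualMax _ OM.dual Q hQ
      b1 a1 e hab1 (by
        intro s hs hs'
        obtain ⟨p, q, hpq, h2⟩ := (h1 s hs' hs).2.2.2 rfl
        exact ⟨q, p, hpq, fun x hx hx' => h2 x hx' hx⟩)
    exact ⟨a', b', t1, t2, h2, h3, fun x hx hx' => ⟨(h1 x (h4 x hx' hx).2 (h4 x hx' hx).1).1,
      (h1 x (h4 x hx' hx).2 (h4 x hx' hx).1).2.1⟩, fun s t h6 h7 h8 h9 => h5 s t h7 h6 h9 h8⟩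
  · obtain ⟨a', b', t1, t2, h2, h3, h4, h5⟩ := box_aux hQ hab1
      (fun s hs hs' => (h1 s hs hs').2.2.1 rfl)
    exact ⟨a', b', t1, t2, h2, h3, fun x hx hx' => ⟨(h1 x (h4 x hx hx').1 (h4 x hx hx').2).1,
      (h1 x (h4 x hx hx').1 (h4 x hx hx').2).2.1⟩, h5⟩
end MS

open FirstOrder Set
set_option linter.unusedVariables false
set_option linter.unusedSectionVars false
set_option linter.style.haveILetI false
set_option linter.unusedSimpArgs false
namespace MS

/-- near `t` -/
def Ev {M : Type*} [LT M] (t : M) (P : M → Prop) : Prop :=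
  ∃ a b, a < t ∧ t < b ∧ ∀ x, a < x → x < b → P x

variable {L : Language} {M : Type*} [L.Structure M] [LinearOrder M] [DenselyOrdered M]
  [NoMinOrder M] [NoMaxOrder M] [Nonempty M] [OM L M]

theorem Ev.mono {t : M} {P Q : M → Prop} (h : Ev t P) (hPQ : ∀ x, P x → Q x) : Ev t Q := by
  obtain ⟨a, b, ha, hb, h⟩ := h
  exact ⟨a, b, ha, hb, fun x h1 h2 => hPQ x (h x h1 h2)⟩

theorem Ev.and {t : M} {P Q : M → Prop} (h : Ev t P) (h' : Ev t Q) : Ev t (fun x => P x ∧ Q x) := by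
  obtain ⟨a, b, ha, hb, h⟩ := h
  obtain ⟨a', b', ha', hb', h'⟩ := h'
  exact ⟨max a a', min b b', max_lt ha ha', lt_min hb hb', fun x h1 h2 =>
    ⟨h x ((le_max_left _ _).trans_lt h1) (h2.trans_le (min_le_left _ _)),
     h' x ((le_max_right _ _).trans_lt h1) (h2.trans_le (min_le_right _ _))⟩⟩

theorem Ev.of_forall {t : M} {P : M → Prop} (h : ∀ x, P x) : Ev t P := by
  obtain ⟨a, ha⟩ := exists_lt t
  obtain ⟨b, hb⟩ := exists_gt t
  exact ⟨a, b, ha, hb, fun x _ _ => h x⟩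

theorem Ev.self {t : M} {P : M → Prop} (h : Ev t P) : P t := by
  obtain ⟨a, b, ha, hb, h⟩ := h
  exact h t ha hb

theorem Ev.fall {I : Type*} [Finite I] {t : M} {P : I → M → Prop} (h : ∀ i, Ev t (P i)) :
    Ev t (fun x => ∀ i, P i x) := by
  classical
  cases nonempty_fintype I
  have : ∀ s : Finset I, Ev t (fun x => ∀ i ∈ s, P i x) := by
    intro s
    induction s using Finset.induction_on with
    | empty => exact Ev.of_forall (by simp)
    | insert a s _ ih => exact ((h a).and ih).mono (by simp)
  exact (this Finset.univ).mono (by simp)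

theorem Ev.ioo {t a b : M} (ha : a < t) (hb : t < b) {P : M → Prop}
    (h : ∀ x, a < x → x < b → P x) : Ev t P := ⟨a, b, ha, hb, h⟩

@[fun_prop] theorem Dfn.ev' {X : Type*} [Obj L M X] {t : X → M} {A : X → M → Prop}
    (ht : Dfn L M t) (hA : Dfn L M (fun p : X × M => A p.1 p.2)) :
    Dfn L M (fun x => Ev (t x) (A x)) := by
  unfold Ev
  simp only [all_iff, imp_iff_not_or]; fun_prop

/-- definable compactness -/
theorem dcompact {W : M → M → Prop} (hW : Dfn L M (fun p : M × M => W p.1 p.2)) {t0 p0 p1 : M}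
    (h0 : Ev t0 (fun t => ∀ y, y < p0 → ¬ W t y)) (h1 : Ev t0 (fun t => ∀ y, p1 < y → ¬ W t y))
    (h : ∀ y, ∃ p q, p < y ∧ y < q ∧ Ev t0 (fun t => ∀ y', p < y' → y' < q → ¬ W t y')) :
    Ev t0 (fun t => ∀ y, ¬ W t y) := by
  have hS : Dfn L M (fun y => Ev t0 (fun t => ∀ y', y' < y → ¬ W t y')) := by
    simp only [all_iff, imp_iff_not_or]; fun_prop
  by_cases hb : ∃ b, ∀ y, Ev t0 (fun t => ∀ y', y' < y → ¬ W t y') → y ≤ b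
  · exfalso
    obtain ⟨s, hs⟩ := OM.lub _ hS ⟨p0, h0⟩ hb
    obtain ⟨p, q, hp, hq, hpq⟩ := h s
    obtain ⟨y, hy, hpy⟩ := (lt_isLUB_iff hs).1 hp
    obtain ⟨z, hz, hzq⟩ := exists_between hq
    have : z ≤ s := hs.1 (show Ev t0 (fun t => ∀ y', y' < z → ¬ W t y') from by
      refine (Ev.and hy hpq).mono fun t ht y' hy' => ?_
      by_cases hyy : y' < y
      · exact ht.1 y' hyy
      · exact ht.2 y' (hpy.trans_le (not_lt.1 hyy)) (hy'.trans hzq))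
    exact absurd hz (not_lt.2 this)
  · push Not at hb
    obtain ⟨y, hy, hyp⟩ := hb p1
    refine (Ev.and hy h1).mono fun t ht y' => ?_
    by_cases hyy : y' < y
    · exact ht.1 y' hyy
    · exact ht.2 y' (hyp.trans_le (not_lt.1 hyy))

/-- empty box -/
def EB {M : Type*} [LT M] (Z : M → M → Prop) (t y : M) : Prop :=
  ∃ p q, p < y ∧ y < q ∧ Ev t (fun t' => ∀ y', p < y' → y' < q → ¬ Z t' y')
/-- one-branch box -/
def OB {M : Type*} [LT M] [LE M] (Z : M → M → Prop) (t y : M) : Prop :=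
  Z t y ∧ ∃ p q, p < y ∧ y < q ∧ ∀ p' q', p ≤ p' → p' < y → y < q' → q' ≤ q →
    Ev t (fun t' => ∃ y', (p' < y' ∧ y' < q' ∧ Z t' y') ∧ ∀ z, p' < z → z < q' → Z t' z → z = y')
def NIm {M : Type*} [LT M] (Z : M → M → Prop) (t : M) : Prop :=
  ∃ p, Ev t (fun t' => ∀ y, y < p → ¬ Z t' y)
def NIp {M : Type*} [LT M] (Z : M → M → Prop) (t : M) : Prop :=
  ∃ p, Ev t (fun t' => ∀ y, p < y → ¬ Z t' y)
def Good {M : Type*} [LT M] [LE M] (Z : M → M → Prop) (t : M) : Prop :=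
  NIm Z t ∧ NIp Z t ∧ ∀ y, EB Z t y ∨ OB Z t y

@[fun_prop] theorem Dfn.eb' {X : Type*} [Obj L M X] {t y : X → M} {Z : X → M → M → Prop}
    (ht : Dfn L M t) (hy : Dfn L M y) (hZ : Dfn L M (fun p : X × M × M => Z p.1 p.2.1 p.2.2)) :
    Dfn L M (fun x => EB (Z x) (t x) (y x)) := by
  unfold EB
  simp only [all_iff, imp_iff_not_or]; fun_prop
@[fun_prop] theorem Dfn.ob' {X : Type*} [Obj L M X] {t y : X → M} {Z : X → M → M → Prop}
    (ht : Dfn L M t) (hy : Dfn L M y) (hZ : Dfn L M (fun p : X × M × M => Z p.1 p.2.1 p.2.2)) :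
    Dfn L M (fun x => OB (Z x) (t x) (y x)) := by
  unfold OB
  simp only [all_iff, imp_iff_not_or]; fun_prop
@[fun_prop] theorem Dfn.nim' {X : Type*} [Obj L M X] {t : X → M} {Z : X → M → M → Prop}
    (ht : Dfn L M t) (hZ : Dfn L M (fun p : X × M × M => Z p.1 p.2.1 p.2.2)) :
    Dfn L M (fun x => NIm (Z x) (t x)) := by
  unfold NIm
  simp only [all_iff, imp_iff_not_or]; fun_prop
@[fun_prop] theorem Dfn.nip' {X : Type*} [Obj L M X] {t : X → M} {Z : X → M → M → Prop}
    (ht : Dfn L M t) (hZ : Dfn L M (fun p : X × M × M => Z p.1 p.2.1 p.2.2)) :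
    Dfn L M (fun x => NIp (Z x) (t x)) := by
  unfold NIp
  simp only [all_iff, imp_iff_not_or]; fun_prop
@[fun_prop] theorem Dfn.good' {X : Type*} [Obj L M X] {t : X → M} {Z : X → M → M → Prop}
    (ht : Dfn L M t) (hZ : Dfn L M (fun p : X × M × M => Z p.1 p.2.1 p.2.2)) :
    Dfn L M (fun x => Good (Z x) (t x)) := by
  unfold Good
  simp only [all_iff, imp_iff_not_or]; fun_prop

theorem exists_sep {F : Set M} (hF : F.Finite) : ∃ p q : M → M, (∀ y, p y < y ∧ y < q y) ∧
    ∀ y ∈ F, ∀ y' ∈ F, y ≠ y' → ∀ z, p y < z → z < q y → p y' < z → z < q y' → False := by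
  letI : TopologicalSpace M := Preorder.topology M
  haveI : OrderTopology M := ⟨rfl⟩
  obtain ⟨U, hU, hd⟩ := hF.t2_separation
  have : ∀ y, ∃ p q, p < y ∧ y < q ∧ Ioo p q ⊆ U y := by
    intro y
    obtain ⟨p, q, h1, h2⟩ := mem_nhds_iff_exists_Ioo_subset.1 ((hU y).2.mem_nhds (hU y).1)
    exact ⟨p, q, h1.1, h1.2, h2⟩
  choose p q h1 h2 h3 using this
  refine ⟨p, q, fun y => ⟨h1 y, h2 y⟩, fun y hy y' hy' hne z a1 a2 a3 a4 => ?_⟩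
  exact Set.disjoint_left.1 (hd hy hy' hne) (h3 y ⟨a1, a2⟩) (h3 y' ⟨a3, a4⟩)

/-- the number of points is locally constant at good points -/
theorem good_const {Z : M → M → Prop} (hZ : Dfn L M (fun p : M × M => Z p.1 p.2))
    (hfin : ∀ t, {y | Z t y}.Finite) {t0 : M} (hg : Good Z t0) :
    Ev t0 (fun t => {y | Z t y}.ncard = {y | Z t0 y}.ncard) := by
  obtain ⟨⟨m0, hm0⟩, ⟨m1, hm1⟩, hn⟩ := hg
  let F : Set M := {y | Z t0 y}
  have hF : F.Finite := hfin t0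
  have hO : ∀ y : M, ∃ p q, p < y ∧ y < q ∧ (y ∈ F → ∀ p' q', p ≤ p' → p' < y → y < q' → q' ≤ q →
    Ev t0 (fun t' => ∃ y', (p' < y' ∧ y' < q' ∧ Z t' y') ∧
      ∀ z, p' < z → z < q' → Z t' z → z = y')) := by
    intro y
    rcases hn y with h | h
    · obtain ⟨p, q, hp, hq, h⟩ := h
      exact ⟨p, q, hp, hq, fun hy => absurd hy (h.self y hp hq)⟩
    · obtain ⟨h1, p, q, hp, hq, h⟩ := h
      exact ⟨p, q, hp, hq, fun _ => h⟩
  choose p0 q0 hp0 hq0 h0 using hO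
  obtain ⟨p1, q1, hpq1, hsep⟩ := exists_sep hF
  let p : M → M := fun y => max (p0 y) (p1 y)
  let q : M → M := fun y => min (q0 y) (q1 y)
  have hp : ∀ y, p y < y := fun y => max_lt (hp0 y) (hpq1 y).1
  have hq : ∀ y, y < q y := fun y => lt_min (hq0 y) (hpq1 y).2
  have hev : ∀ y : F, Ev t0 (fun t' => ∃ y', (p y < y' ∧ y' < q y ∧ Z t' y') ∧
      ∀ z, p y < z → z < q y → Z t' z → z = y') := fun y =>
    h0 y y.2 (p y) (q y) (le_max_left _ _) (hp y) (hq y) (min_le_left _ _)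
  haveI : Finite F := hF
  have hW : Dfn L M (fun r : M × M => Z r.1 r.2 ∧ ∀ y : F, ¬ (p y < r.2 ∧ r.2 < q y)) := by
    refine Dfn.and' hZ (Dfn.fall' fun y => ?_)
    fun_prop
  have hWe : Ev t0 (fun t => ∀ z, ¬ (Z t z ∧ ∀ y : F, ¬ (p y < z ∧ z < q y))) := by
    refine dcompact (W := fun t z => (Z t z ∧ ∀ y : F, ¬ (p y < z ∧ z < q y))) hW
      (hm0.mono fun t h y hy h' => h y hy h'.1) (hm1.mono fun t h y hy h' => h y hy h'.1) ?_
    intro y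
    by_cases hy : y ∈ F
    · exact ⟨p y, q y, hp y, hq y, Ev.of_forall fun t y' h1 h2 h3 => h3.2 ⟨y, hy⟩ ⟨h1, h2⟩⟩
    · rcases hn y with h | h
      · obtain ⟨p, q, hp, hq, h⟩ := h
        exact ⟨p, q, hp, hq, h.mono fun t h y' h1 h2 h3 => h y' h1 h2 h3.1⟩
      · exact absurd h.1 hy
  refine ((Ev.fall hev).and hWe).mono fun t ht => ?_
  obtain ⟨h1, h2⟩ := ht
  choose g hg1 hg2 using h1
  symm
  refine Set.ncard_congr (fun y hy => g ⟨y, hy⟩) (fun y hy => (hg1 ⟨y, hy⟩).2.2) ?_ ?_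
  · intro y y' hy hy' he
    by_contra hne
    have e1 := hg1 ⟨y, hy⟩
    have e2 := hg1 ⟨y', hy'⟩
    change g ⟨y,hy⟩ = g ⟨y',hy'⟩ at he
    rw [← he] at e2
    exact hsep y hy y' hy' hne _ ((le_max_right _ _).trans_lt e1.1) (e1.2.1.trans_le (min_le_right _ _))
      ((le_max_right _ _).trans_lt e2.1) (e2.2.1.trans_le (min_le_right _ _))
  · intro z hz
    have := h2 z
    push Not at this
    obtain ⟨y, hy1, hy2⟩ := this hz
    exact ⟨y, y.2, (hg2 y z hy1 hy2 hz).symm⟩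

theorem exists_nim {Z : M → M → Prop} (hZ : Dfn L M (fun p : M × M => Z p.1 p.2))
    (hfin : ∀ t, {y | Z t y}.Finite) {a b : M} (hab : a < b) :
    ∃ t, a < t ∧ t < b ∧ NIm Z t := by
  obtain ⟨μ, hμ, hμ'⟩ := exists_dfn_fun (L := L)
    (R := fun p : M × M => Z p.1 p.2 ∧ ∀ y, Z p.1 y → p.2 ≤ y)
    (by simp only [all_iff, imp_iff_not_or]; fun_prop)
    (fun x y y' h1 h2 => le_antisymm (h1.2 _ h2.1) (h2.2 _ h1.1))
  obtain ⟨i, a1, b1, hab1, h1⟩ := exists_sub (L := L) (I := Bool)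
    (A := fun i s => (i = true → ∃ y, Z s y) ∧ (i = false → ¬ ∃ y, Z s y))
    (by intro i; simp only [imp_iff_not_or]; fun_prop) hab (by
      intro s _ _
      by_cases h : ∃ y, Z s y
      · exact ⟨true, by simpa using h⟩
      · exact ⟨false, by simpa using h⟩)
  obtain ⟨a2, b2, hab2, hsub, hc⟩ := dfn_cont hμ hab1
  obtain ⟨t, ht, ht'⟩ := exists_between hab2
  refine ⟨t, (h1 t (hsub t ht ht').1 (hsub t ht ht').2).1,
    (h1 t (hsub t ht ht').1 (hsub t ht ht').2).2.1, ?_⟩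
  rcases i with _ | _
  · exact ⟨a, a2, b2, ht, ht', fun t' h2 h3 y _ h4 =>
      (h1 t' (hsub t' h2 h3).1 (hsub t' h2 h3).2).2.2.2 rfl ⟨y, h4⟩⟩
  · obtain ⟨p, hp⟩ := exists_lt (μ t)
    refine ⟨p, Ev.mono (Ev.and ((hc t ht ht').1 p hp) (Ev.ioo ht ht' (fun x h1 h2 => And.intro h1 h2))) ?_⟩
    rintro t' ⟨h2, h3, h4⟩ y hy hZy
    obtain ⟨z, hz⟩ := (h1 t' (hsub t' h3 h4).1 (hsub t' h3 h4).2).2.2.1 rfl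
    obtain ⟨m, hm, hm'⟩ := Set.exists_min_image _ id (hfin t') ⟨z, hz⟩
    have := hμ' t' ⟨m, hm, fun y hy => hm' y hy⟩
    exact absurd (h2.trans_le (this.2 y hZy)) (not_lt.2 hy.le)

theorem exists_nip {Z : M → M → Prop} (hZ : Dfn L M (fun p : M × M => Z p.1 p.2))
    (hfin : ∀ t, {y | Z t y}.Finite) {a b : M} (hab : a < b) :
    ∃ t, a < t ∧ t < b ∧ NIp Z t := by
  obtain ⟨t, h1, h2, p, b', a', h3, h4, h⟩ := @exists_nim L M _ (dualLO M) dualDense dualMin dualMax _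
    OM.dual Z hZ hfin b a hab
  exact ⟨t, h2, h1, p, a', b', h4, h3, fun x h1 h2 y hy => h x h2 h1 y hy⟩

theorem normal_open {Z : M → M → Prop} {t y : M} (h : EB Z t y ∨ OB Z t y) :
    Ev y (fun y => EB Z t y ∨ OB Z t y) := by
  rcases h with ⟨p, q, hp, hq, h⟩ | h
  · exact ⟨p, q, hp, hq, fun x h1 h2 => Or.inl ⟨p, q, h1, h2, h⟩⟩
  · have h' := h
    obtain ⟨h0, p, q, hp, hq, h⟩ := h
    refine ⟨p, q, hp, hq, fun x h1 h2 => ?_⟩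
    rcases lt_trichotomy x y with hx | hx | hx
    · left
      obtain ⟨z, hz1, hz2⟩ := exists_between hx
      refine ⟨p, z, h1, hz1, ((h p q le_rfl hp hq le_rfl).and
        (h z q (h1.trans hz1).le hz2 hq le_rfl)).mono ?_⟩
      rintro t' ⟨⟨u, hu, hu'⟩, v, hv, hv'⟩ w hw1 hw2 hw3
      have e1 := hu' w hw1 (hw2.trans (hz2.trans hq)) hw3
      have e2 := hu' v ((h1.trans hz1).trans hv.1) hv.2.1 hv.2.2
      rw [e1, ← e2] at hw2
      exact lt_asymm hw2 hv.1
    · subst hx; exact Or.inr h'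
    · left
      obtain ⟨z, hz1, hz2⟩ := exists_between hx
      refine ⟨z, q, hz2, h2, ((h p q le_rfl hp hq le_rfl).and
        (h p z le_rfl hp hz1 (hz2.trans h2).le)).mono ?_⟩
      rintro t' ⟨⟨u, hu, hu'⟩, v, hv, hv'⟩ w hw1 hw2 hw3
      have e1 := hu' w ((hp.trans hz1).trans hw1) hw2 hw3
      have e2 := hu' v hv.1 (hv.2.1.trans (hz2.trans h2)) hv.2.2
      rw [e1, ← e2] at hw1
      exact lt_asymm hw1 hv.2.1

theorem good_fin {Z : M → M → Prop} (hZ : Dfn L M (fun p : M × M => Z p.1 p.2))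
    (hfin : ∀ t, {y | Z t y}.Finite) : {t | ¬ Good Z t}.Finite := by
  have hG : Dfn L M (fun t => ¬ Good Z t) := by fun_prop
  rw [← not_inf_iff hG]
  rintro ⟨a, b, hab, hbad⟩
  obtain ⟨i, a1, b1, hab1, h1⟩ := exists_sub (L := L) (I := Fin 3)
    (A := fun i s => (i = 0 → ¬ NIm Z s) ∧ (i = 1 → ¬ NIp Z s) ∧
      (i = 2 → NIm Z s ∧ ∃ y, ¬ (EB Z s y ∨ OB Z s y)))
    (by intro i; simp only [imp_iff_not_or]; fun_prop) hab (by
      intro s hs hs'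
      have := hbad s hs hs'
      by_cases h1 : NIm Z s
      · by_cases h2 : NIp Z s
        · refine ⟨2, by simp, by simp, fun _ => ⟨h1, ?_⟩⟩
          by_contra hn
          push Not at hn
          exact this ⟨h1, h2, fun y => hn y⟩
        · exact ⟨1, by simp [h2]⟩
      · exact ⟨0, by simp [h1]⟩)
  have hi : i = 0 ∨ i = 1 ∨ i = 2 := by omega
  rcases hi with hi | hi | hi
  · obtain ⟨t, ht, ht', h⟩ := exists_nim hZ hfin hab1
    exact (h1 t ht ht').2.2.1 hi h
  · obtain ⟨t, ht, ht', h⟩ := exists_nip hZ hfin hab1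
    exact (h1 t ht ht').2.2.2.1 hi h
  have h2 := fun t ht ht' => (h1 t ht ht').2.2.2.2 hi
  obtain ⟨β, hβ, hβ'⟩ := exists_dfn_fun (L := L)
    (R := fun p : M × M => ¬ (EB Z p.1 p.2 ∨ OB Z p.1 p.2) ∧
      ∀ y, y < p.2 → (EB Z p.1 y ∨ OB Z p.1 y))
    (by simp only [all_iff, imp_iff_not_or]; fun_prop)
    (fun x y y' h1 h2 => by
      rcases lt_trichotomy y y' with h | h | h
      · exact absurd (h2.2 _ h) h1.1
      · exact h
      · exact absurd (h1.2 _ h) h2.1)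
  have hβn : ∀ t, a1 < t → t < b1 → ¬ (EB Z t (β t) ∨ OB Z t (β t)) := by
    intro t ht ht'
    obtain ⟨⟨p, hp⟩, y, hy⟩ := h2 t ht ht'
    obtain ⟨s, hs⟩ := OM.glb (L := L) (fun y => ¬ (EB Z t y ∨ OB Z t y)) (by fun_prop) ⟨y, hy⟩
      ⟨p, fun x hx => by
        by_contra hlt
        obtain ⟨r, hr⟩ := exists_lt x
        exact hx (Or.inl ⟨r, p, hr, not_le.1 hlt, hp.mono fun t' h y' _ h2 => h y' h2⟩)⟩
    refine (hβ' t ⟨s, fun hs1 => ?_, fun y hy => ?_⟩).1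
    · obtain ⟨c, d, hc, hd, hcd⟩ := normal_open hs1
      obtain ⟨x, hx, hxd⟩ := (isGLB_lt_iff hs).1 hd
      exact hx (hcd x (hc.trans_le (hs.1 hx)) hxd)
    · by_contra hn
      exact absurd (hs.1 hn) (not_le.2 hy)
  obtain ⟨a2, b2, hab2, hsub2, hcont⟩ := dfn_cont hβ hab1
  obtain ⟨a3, b3, u1, u2, hab3, hu, hsub3, hb3⟩ := box (L := L)
    (Q := fun p : M × M => p.2 < β p.1 ∧ ∀ w, p.2 ≤ w → w < β p.1 → ¬ Z p.1 w)
    (by simp only [all_iff, imp_iff_not_or]; fun_prop) hab2 (by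
      intro s hs hs'
      obtain ⟨c, hc, h⟩ := @exists_right_avoid M (dualLO M) dualDense dualMin dualMax _ _ (hfin s) (β s)
      exact ⟨c, β s, hc, fun x hx hx' => ⟨hx', fun w hw hw' => h w hw' (lt_of_lt_of_le hx hw)⟩⟩)
  obtain ⟨a4, b4, v1, v2, hab4, hv, hsub4, hb4⟩ := box (L := L)
    (Q := fun p : M × M => β p.1 < p.2 ∧ ∀ w, w ≤ p.2 → β p.1 < w → ¬ Z p.1 w)
    (by simp only [all_iff, imp_iff_not_or]; fun_prop) hab3 (by
      intro s hs hs'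
      obtain ⟨c, hc, h⟩ := exists_right_avoid (hfin s) (β s)
      exact ⟨β s, c, hc, fun x hx hx' => ⟨hx, fun w hw hw' => h w hw' (lt_of_le_of_lt hw hx')⟩⟩)
  obtain ⟨u, hu1, hu2⟩ := exists_between hu
  obtain ⟨v, hv1, hv2⟩ := exists_between hv
  obtain ⟨i, a5, b5, hab5, h5⟩ := exists_sub (L := L) (I := Bool)
    (A := fun i s => (i = true → Z s (β s)) ∧ (i = false → ¬ Z s (β s)))
    (by intro i; simp only [imp_iff_not_or]; fun_prop) hab4 (by
      intro s _ _
      by_cases h : Z s (β s)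
      · exact ⟨true, by simpa using h⟩
      · exact ⟨false, by simpa using h⟩)
  obtain ⟨t, ht, ht'⟩ := exists_between hab5
  have hl : ∀ t, a5 < t → t < b5 → u < β t ∧ ∀ w, u ≤ w → w < β t → ¬ Z t w := fun t h h' =>
    hb3 t u (hsub4 t (h5 t h h').1 (h5 t h h').2.1).1 (hsub4 t (h5 t h h').1 (h5 t h h').2.1).2 hu1 hu2
  have hr : ∀ t, a5 < t → t < b5 → β t < v ∧ ∀ w, w ≤ v → β t < w → ¬ Z t w := fun t h h' =>
    hb4 t v (h5 t h h').1 (h5 t h h').2.1 hv1 hv2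
  have ht2 : a2 < t ∧ t < b2 := by
    have h6 := hsub4 t (h5 t ht ht').1 (h5 t ht ht').2.1
    exact hsub3 t h6.1 h6.2
  have hc := hcont t ht2.1 ht2.2
  have ht1 := hsub2 t ht2.1 ht2.2
  refine hβn t ht1.1 ht1.2 ?_
  rcases i with _ | _
  · left
    refine ⟨u, v, (hl t ht ht').1, (hr t ht ht').1, Ev.ioo ht ht' fun s hs hs' y h1 h2 h3 => ?_⟩
    rcases lt_trichotomy y (β s) with h | h | h
    · exact (hl s hs hs').2 y h1.le h h3
    · exact (h5 s hs hs').2.2.2 rfl (h ▸ h3)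
    · exact (hr s hs hs').2 y h2.le h h3
  · right
    refine ⟨(h5 t ht ht').2.2.1 rfl, u, v, (hl t ht ht').1, (hr t ht ht').1, ?_⟩
    intro p q hp hp' hq' hq
    refine (((Ev.and (hc.1 p hp') (hc.2 q hq'))).and
      (Ev.ioo ht ht' (fun x h1 h2 => And.intro h1 h2))).mono ?_
    rintro s ⟨⟨h1, h2⟩, hs, hs'⟩
    refine ⟨β s, ⟨h1, h2, (h5 s hs hs').2.2.1 rfl⟩, fun z hz1 hz2 hz3 => ?_⟩
    rcases lt_trichotomy z (β s) with h | h | h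
    · exact absurd hz3 ((hl s hs hs').2 z (hp.trans_lt hz1).le h)
    · exact h
    · exact absurd hz3 ((hr s hs hs').2 z (hz2.trans_le hq).le h)
end MS

open FirstOrder Set
set_option linter.unusedVariables false
set_option linter.unusedSectionVars false
set_option linter.style.haveILetI false
set_option linter.unusedSimpArgs false
namespace MS

/-- at least `k` elements -/
def AL {M : Type*} [LinearOrder M] (k : ℕ) (A : M → Prop) : Prop :=
  ∃ g : Fin k → M, (∀ i j, i < j → g i < g j) ∧ ∀ i, A (g i)

/-- append a coordinate -/
def sn {M : Type*} {m : ℕ} (c : Fin m → M) (t : M) : Fin (m+1) → M :=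
  Fin.snoc (α := fun _ => M) c t

def ini {M : Type*} {m : ℕ} (v : Fin (m+1) → M) : Fin m → M := fun i => v i.castSucc

@[simp] theorem sn_last {M : Type*} {m : ℕ} (c : Fin m → M) (t : M) : sn c t (Fin.last m) = t := by
  simp [sn]
@[simp] theorem sn_castSucc {M : Type*} {m : ℕ} (c : Fin m → M) (t : M) (i : Fin m) :
    sn c t i.castSucc = c i := by
  simp [sn]
@[simp] theorem ini_sn {M : Type*} {m : ℕ} (c : Fin m → M) (t : M) : ini (sn c t) = c := by
  funext i; simp [ini]
@[simp] theorem sn_ini {M : Type*} {m : ℕ} (v : Fin (m+1) → M) : sn (ini v) (v (Fin.last m)) = v := by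
  funext i
  induction i using Fin.lastCases with
  | last => simp
  | cast i => simp [ini]

variable {L : Language} {M : Type*} [L.Structure M] [LinearOrder M] [DenselyOrdered M]
  [NoMinOrder M] [NoMaxOrder M] [Nonempty M] [OM L M]

@[fun_prop] theorem Dfn.al' {X : Type*} [Obj L M X] {A : X → M → Prop} (k : ℕ)
    (hA : Dfn L M (fun p : X × M => A p.1 p.2)) : Dfn L M (fun x => AL k (A x)) := by
  unfold AL
  refine Dfn.ex' (Dfn.and' (Dfn.fall' fun i => Dfn.fall' fun j => Dfn.imp' ?_ ?_) (Dfn.fall' fun i => ?_)) <;> fun_prop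

theorem AL_iff {A : M → Prop} (hA : {x | A x}.Finite) (k : ℕ) : AL k A ↔ k ≤ {x | A x}.ncard := by
  rw [Set.ncard_eq_toFinset_card _ hA]
  constructor
  · rintro ⟨g, h1, h2⟩
    have hg : StrictMono g := fun i j h => h1 i j h
    have := Finset.card_le_card (s := Finset.univ.map ⟨g, hg.injective⟩) (t := hA.toFinset)
      (by intro x hx; simp at hx ⊢; obtain ⟨i, rfl⟩ := hx; exact h2 i)
    simpa using this
  · intro h
    refine ⟨fun i => hA.toFinset.orderEmbOfCardLe h i, fun i j h => by simpa using h, fun i => ?_⟩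
    have := Finset.orderEmbOfCardLe_mem hA.toFinset h i
    simpa using this

theorem Dfn.le_ncard {X : Type*} [Obj L M X] {A : X → M → Prop} (k : ℕ)
    (hA : Dfn L M (fun p : X × M => A p.1 p.2)) (hf : ∀ x, {y | A x y}.Finite) :
    Dfn L M (fun x => k ≤ {y | A x y}.ncard) :=
  (Dfn.al' k hA).congr fun x => by rw [AL_iff (hf x)]

theorem Dfn.ncard_eq {X : Type*} [Obj L M X] {A : X → M → Prop} (k : ℕ)
    (hA : Dfn L M (fun p : X × M => A p.1 p.2)) (hf : ∀ x, {y | A x y}.Finite) :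
    Dfn L M (fun x => {y | A x y}.ncard = k) :=
  ((Dfn.le_ncard k hA hf).and' (Dfn.le_ncard (k+1) hA hf).not').congr fun x => propext (by omega)

@[fun_prop] theorem Dfn.sn' {X : Type*} [Obj L M X] {m : ℕ} {c : X → Fin m → M} {t : X → M}
    (hc : Dfn L M c) (ht : Dfn L M t) : Dfn L M (fun x => sn (c x) (t x)) := by
  refine Dfn.pi' fun i => ?_
  induction i using Fin.lastCases with
  | last => simpa using ht
  | cast i => simp only [sn_castSucc]; fun_prop

@[fun_prop] theorem Dfn.ini' {X : Type*} [Obj L M X] {m : ℕ} {c : X → Fin (m+1) → M} 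
    (hc : Dfn L M c) : Dfn L M (fun x => ini (c x)) := by
  refine Dfn.pi' fun i => ?_
  unfold ini; fun_prop

/-- fat subsets -/
def Fat {M : Type*} [LT M] : (m : ℕ) → ((Fin m → M) → Prop) → Prop
  | 0, S => S (fun i => i.elim0)
  | (m+1), S => Fat m (fun c => Inf (fun t => S (sn c t)))

theorem Fat.mono {m : ℕ} {A B : (Fin m → M) → Prop} (h : Fat m A) (hAB : ∀ v, A v → B v) : Fat m B := by
  induction m with
  | zero => exact hAB _ h
  | succ m ih => exact ih h fun c hc => hc.mono fun t ht => hAB _ ht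

@[fun_prop] theorem Dfn.fat' {X : Type*} [Obj L M X] {m : ℕ} {A : X → (Fin m → M) → Prop}
    (hA : Dfn L M (fun p : X × (Fin m → M) => A p.1 p.2)) : Dfn L M (fun x => Fat m (A x)) := by
  induction m with
  | zero => unfold Fat; fun_prop
  | succ m ih => 
    unfold Fat
    apply ih
    fun_prop

theorem Fat.or {m : ℕ} {A B : (Fin m → M) → Prop} (hA : Dfn L M A) (hB : Dfn L M B) 
    (h : Fat m (fun v => A v ∨ B v)) : Fat m A ∨ Fat m B := by
  induction m with
  | zero => exact h
  | succ m ih =>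
    unfold Fat at h ⊢
    refine ih (by fun_prop) (by fun_prop) (h.mono fun c hc => Inf.or (L := L) ?_ ?_ hc) <;> fun_prop

theorem not_fat_false {m : ℕ} : ¬ Fat m (fun _ : Fin m → M => False) := by
  induction m with
  | zero => exact id
  | succ m ih =>
    intro h; unfold Fat at h
    refine ih (h.mono fun c hc => ?_)
    obtain ⟨a, b, hab, h⟩ := hc
    obtain ⟨x, h1, h2⟩ := exists_between hab
    exact h x h1 h2

theorem Fat.exists {m : ℕ} {A : (Fin m → M) → Prop} (h : Fat m A) : ∃ v, A v := by
  by_contra hn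
  push Not at hn
  exact not_fat_false (h.mono fun v hv => hn v hv)

theorem not_fat_fex {m : ℕ} {A : ℕ → (Fin m → M) → Prop} (hA : ∀ i, Dfn L M (A i)) 
    (h : ∀ i, ¬ Fat m (A i)) (k : ℕ) : ¬ Fat m (fun v => ∃ i, i < k ∧ A i v) := by
  induction k with
  | zero => intro h; exact not_fat_false (h.mono fun v hv => by simp at hv)
  | succ k ih =>
    intro h'
    have h2 : Fat m (fun v => (∃ i : Fin k, A i v) ∨ A k v) := h'.mono (by
      rintro v ⟨i, hi, hv⟩
      rcases Nat.lt_succ_iff_lt_or_eq.1 hi with h | rfl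
      · exact Or.inl ⟨⟨i, h⟩, hv⟩
      · exact Or.inr hv)
    rcases Fat.or (L := L) (by fun_prop) (hA k) h2 with h3 | h3
    · exact ih (h3.mono fun v ⟨i, hv⟩ => ⟨i, i.2, hv⟩)
    · exact h k h3

/-- uniform finiteness -/
def UF (L : Language) (M : Type*) [L.Structure M] (m : ℕ) : Prop :=
  ∀ Z : (Fin m → M) → M → Prop, Dfn L M (fun p : (Fin m → M) × M => Z p.1 p.2) → 
    (∀ v, {y | Z v y}.Finite) → ∃ K : ℕ, ∀ v, {y | Z v y}.ncard ≤ K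

/-- nonfat sets decompose -/
theorem NF {m : ℕ} (hUF : ∀ k, k < m → UF L M k) {S : (Fin m → M) → Prop} (hS : Dfn L M S)
    (hn : ¬ Fat m S) : ∃ I : Type, ∃ _ : Finite I, ∃ T : I → (Fin m → M) → Prop,
      (∀ i, Dfn L M (T i)) ∧ (∀ v, S v ↔ ∃ i, T i v) ∧
      ∀ i, ∃ d, d + 1 = m ∧ ∃ ρ : (Fin m → M) → (Fin d → M), Dfn L M ρ ∧ 
        ∀ v v', T i v → T i v' → ρ v = ρ v' → v = v' := by
  induction m with
  | zero => 
    refine ⟨Empty, inferInstance, fun i => i.elim, fun i => i.elim, fun v => ?_, fun i => i.elim⟩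
    simp only [IsEmpty.exists_iff, iff_false]
    have : v = fun i => i.elim0 := Subsingleton.elim _ _
    rw [this]; exact hn
  | succ m ih =>
    obtain ⟨I, hI, T, hT, hST, hρ⟩ := ih (fun k hk => hUF k (by omega)) 
      (S := fun c => Inf (fun t => S (sn c t))) (by fun_prop) hn
    have hA : Dfn L M (fun p : (Fin m → M) × M => S (sn p.1 p.2) ∧ ¬ Inf (fun t => S (sn p.1 t))) := by
      fun_prop
    have hAf : ∀ c : Fin m → M, {y | S (sn c y) ∧ ¬ Inf (fun t => S (sn c t))}.Finite := by
      intro c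
      by_cases h : Inf (fun t => S (sn c t))
      · simp [h]
      · simp only [h, not_false_eq_true, and_true]
        exact (not_inf_iff (L := L) (by fun_prop)).1 h
    obtain ⟨l, hl⟩ := hUF m (by omega) _ hA hAf
    have hN : ∀ j : ℕ, Dfn L M (fun v : Fin (m+1) → M => 
      {y | (S (sn (ini v) y) ∧ ¬ Inf (fun t => S (sn (ini v) t))) ∧ y < v (Fin.last m)}.ncard = j) := by
      intro j
      refine Dfn.ncard_eq (L := L) (A := fun (v : Fin (m+1) → M) y => 
        (S (sn (ini v) y) ∧ ¬ Inf (fun t => S (sn (ini v) t))) ∧ y < v (Fin.last m)) j (by fun_prop) ?_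
      intro v
      exact (hAf (ini v)).subset fun y hy => hy.1
    refine ⟨I ⊕ Fin (l+1), inferInstance, Sum.elim (fun i v => S v ∧ T i (ini v)) 
      (fun j v => (S v ∧ ¬ Inf (fun t => S (sn (ini v) t))) ∧ 
      {y | (S (sn (ini v) y) ∧ ¬ Inf (fun t => S (sn (ini v) t))) ∧ y < v (Fin.last m)}.ncard = j), ?_, ?_, ?_⟩
    · rintro (i | j)
      · have := hT i
        simp only [Sum.elim_inl]
        fun_prop
      · have := hN j
        simp only [Sum.elim_inr]
        fun_prop
    · intro v
      constructor
      · intro hv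
        by_cases hi : Inf (fun t => S (sn (ini v) t))
        · obtain ⟨i, hi⟩ := (hST _).1 hi
          exact ⟨Sum.inl i, hv, hi⟩
        · refine ⟨Sum.inr ⟨_, Nat.lt_succ_of_le ?_⟩, ⟨hv, hi⟩, rfl⟩
          exact (Set.ncard_le_ncard (fun y hy => hy.1) (hAf (ini v))).trans (hl (ini v))
      · rintro ⟨i | j, h⟩
        · exact h.1
        · exact h.1.1
    · rintro (i | j)
      · obtain ⟨d, rfl, ρ, hρ1, hρ2⟩ := hρ i
        refine ⟨d+1, rfl, fun v => sn (ρ (ini v)) (v (Fin.last _)), by fun_prop, ?_⟩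
        intro v v' hv hv' he
        have e1 := congrArg ini he
        have e2 := congrFun he (Fin.last _)
        simp only [ini_sn, sn_last] at e1 e2
        rw [← sn_ini v, ← sn_ini v', e2, hρ2 _ _ hv.2 hv'.2 e1]
      · refine ⟨m, rfl, ini, by fun_prop, ?_⟩
        have key : ∀ v v' : Fin (m+1) → M, ini v = ini v' → S v → ¬ Inf (fun t => S (sn (ini v) t)) → 
          {y | (S (sn (ini v) y) ∧ ¬ Inf (fun t => S (sn (ini v) t))) ∧ y < v (Fin.last m)}.ncard = j → 
          {y | (S (sn (ini v') y) ∧ ¬ Inf (fun t => S (sn (ini v') t))) ∧ y < v' (Fin.last m)}.ncard = j → 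
          ¬ v (Fin.last m) < v' (Fin.last m) := by
          intro v v' he hv hi h1 h2 hlt
          rw [← he] at h2
          have := Set.ncard_lt_ncard (s := {y | (S (sn (ini v) y) ∧ ¬ Inf (fun t => S (sn (ini v) t))) ∧ y < v (Fin.last m)}) (t := {y | (S (sn (ini v) y) ∧ ¬ Inf (fun t => S (sn (ini v) t))) ∧ y < v' (Fin.last m)}) ?_ ((hAf (ini v)).subset fun y hy => hy.1)
          · omega
          · refine ⟨fun y hy => ⟨hy.1, hy.2.trans hlt⟩, fun hh => ?_⟩
            exact lt_irrefl _ (hh (show v (Fin.last m) ∈ _ from ⟨⟨by simpa using hv, hi⟩, hlt⟩)).2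
        intro v v' hv hv' he
        rw [← sn_ini v, ← sn_ini v', he]
        congr 1
        exact le_antisymm (not_lt.1 (key v' v he.symm hv'.1.1 hv'.1.2 hv'.2 hv.2)) (not_lt.1 (key v v' he hv.1.1 hv.1.2 hv.2 hv'.2))

end MS

open FirstOrder Set
set_option linter.unusedVariables false
set_option linter.unusedSectionVars false
set_option linter.style.haveILetI false
set_option linter.unusedSimpArgs false
namespace MS

variable {L : Language} {M : Type*} [L.Structure M] [LinearOrder M] [DenselyOrdered M]
  [NoMinOrder M] [NoMaxOrder M] [Nonempty M] [OM L M]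

@[fun_prop] theorem Dfn.update' {X : Type*} [Obj L M X] {m : ℕ} {c : X → Fin m → M} {t : X → M} (i : Fin m)
    (hc : Dfn L M c) (ht : Dfn L M t) : Dfn L M (fun x => Function.update (c x) i (t x)) := by
  refine Dfn.pi' fun j => ?_
  by_cases h : j = i
  · subst h; simpa using ht
  · simp only [Function.update_of_ne h]; fun_prop

theorem update_sn_last {m : ℕ} (c : Fin m → M) (t s : M) : 
    Function.update (sn c t) (Fin.last m) s = sn c s := by
  funext j
  induction j using Fin.lastCases with
  | last => simp
  | cast j => simp [Function.update_of_ne (Fin.castSucc_lt_last j).ne]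
theorem update_sn_cast {m : ℕ} (c : Fin m → M) (t s : M) (i : Fin m) : 
    Function.update (sn c t) i.castSucc s = sn (Function.update c i s) t := by
  funext j
  induction j using Fin.lastCases with
  | last => simp [Function.update_of_ne (Fin.castSucc_lt_last i).ne']
  | cast j => 
    by_cases h : j = i
    · subst h; simp
    · have h' : j.castSucc ≠ i.castSucc := fun e => h (Fin.castSucc_injective _ e)
      simp [Function.update_of_ne h, Function.update_of_ne h']

theorem phi {m : ℕ} (hUF : ∀ k, k < m → UF L M k) (n : (Fin m → M) → ℕ) 
    (hn : ∀ k, Dfn L M (fun v => n v = k)) (B : Fin m → (Fin m → M) → Prop) 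
    (hB : ∀ i, Dfn L M (B i)) (hBf : ∀ i v, {s | B i (Function.update v i s)}.Finite) 
    (hloc : ∀ i v, ¬ B i v → Ev (v i) (fun s => n (Function.update v i s) = n v)) : 
    ∃ K, ¬ Fat m (fun v => K < n v) := by
  classical
  induction m with
  | zero => exact ⟨n (fun i => i.elim0), fun h => lt_irrefl _ h⟩
  | succ m ih =>
    have hn' : ∀ {X : Type _} [Obj L M X] (k : ℕ) {g : X → (Fin (m+1) → M)}, Dfn L M g → 
      Dfn L M (fun x => n (g x) = k) := fun k g hg => Dfn.comp' (hn k) hg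
    let b : (Fin m → M) → M → Prop := fun c t => B (Fin.last m) (sn c t)
    have hb : Dfn L M (fun p : (Fin m → M) × M => b p.1 p.2) := by
      have := hB (Fin.last m)
      simp only [b]; fun_prop
    have hbf : ∀ c, {t | b c t}.Finite := by
      intro c
      have := hBf (Fin.last m) (sn c (Classical.arbitrary M))
      simpa only [update_sn_last] using this
    obtain ⟨l, hl⟩ := hUF m (by omega) b hb hbf
    let cnt : (Fin m → M) → M → ℕ := fun c t => {y | b c y ∧ y < t}.ncard
    have hcnt : ∀ j, Dfn L M (fun p : (Fin m → M) × M => cnt p.1 p.2 = j) := by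
      intro j
      exact Dfn.ncard_eq (A := fun (p : (Fin m → M) × M) y => b p.1 y ∧ y < p.2) j (by fun_prop) 
        (fun p => (hbf p.1).subset fun y hy => hy.1)
    let O : ℕ → (Fin m → M) → M → Prop := fun j c t => ¬ b c t ∧ cnt c t = j
    have hO : ∀ j, Dfn L M (fun p : (Fin m → M) × M => O j p.1 p.2) := by
      intro j
      have := hcnt j
      simp only [O]; fun_prop
    -- constancy of n
    have hlb : ∀ c t, ¬ b c t → Ev t (fun s => n (sn c s) = n (sn c t)) := by
      intro c t h
      have := hloc (Fin.last m) (sn c t) h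
      simpa only [sn_last, update_sn_last] using this
    have hconst : ∀ c t t', t < t' → (∀ x, t ≤ x → x ≤ t' → ¬ b c x) → n (sn c t) = n (sn c t') := by
      intro c t t' htt' hno
      obtain ⟨p, q, hp, hq, h⟩ := hlb c t (hno t le_rfl htt'.le)
      obtain ⟨p', q', hp', hq', h'⟩ := hlb c t' (hno t' htt'.le le_rfl)
      have hA : Dfn L M (fun s => n (sn c s) = n (sn c t)) := hn' _ (by fun_prop)
      have := const_of_no_bd hA (a := p) (b := q') ?_ t t' hp (htt'.trans hq') (hp.trans htt') hq'
      · simpa using this.1 rfl |>.symm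
      · intro x hx hx'
        have hx2 : Ev x (fun s => n (sn c s) = n (sn c x)) := by
          rcases lt_or_ge x t with h1 | h1
          · exact ⟨p, q, hx, h1.trans hq, fun y hy hy' => (h y hy hy').trans (h x hx (h1.trans hq)).symm⟩
          rcases lt_or_ge t' x with h2 | h2
          · exact ⟨p', q', hp'.trans h2, hx', fun y hy hy' => (h' y hy hy').trans (h' x (hp'.trans h2) hx').symm⟩
          exact hlb c x (hno x h1 h2)
        obtain ⟨u, v, hu, hv, hh⟩ := hx2
        refine ⟨u, v, hu, hv, ?_⟩
        by_cases he : n (sn c x) = n (sn c t)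
        · left; intro y h1 h2; rw [hh y h1 h2, he]
        · right; intro y h1 h2; rw [hh y h1 h2]; exact he
    have hOlt : ∀ j c t t', t < t' → O j c t → O j c t' → n (sn c t) = n (sn c t') := by
      intro j c t t' h1 h2 h3
      refine hconst c t t' h1 fun x hx hx' hbx => ?_
      have hne : x ≠ t' := by rintro rfl; exact h3.1 hbx
      have hx' := lt_of_le_of_ne hx' hne
      have : cnt c t < cnt c t' := by
        refine Set.ncard_lt_ncard ?_ ((hbf c).subset fun y hy => hy.1)
        refine ⟨fun y hy => ⟨hy.1, hy.2.trans h1⟩, fun hh => ?_⟩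
        exact absurd (hh (show x ∈ _ from ⟨hbx, hx'⟩)).2 (not_lt.2 hx)
      rw [h2.2, h3.2] at this
      exact lt_irrefl _ this
    have hOc : ∀ j c t t', O j c t → O j c t' → n (sn c t) = n (sn c t') := by
      intro j c t t' h2 h3
      rcases lt_trichotomy t t' with h | rfl | h
      · exact hOlt j c t t' h h2 h3
      · rfl
      · exact (hOlt j c t' t h h3 h2).symm
    -- openness of O
    have hOopen : ∀ j c t, O j c t → Inf (O j c) := by
      intro j c t h
      obtain ⟨q, hq, h'⟩ := exists_right_avoid (hbf c) t
      refine ⟨t, q, hq, fun x hx hx' => ⟨h' x hx hx', ?_⟩⟩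
      rw [← h.2]
      simp only [cnt]
      congr 1
      ext y
      simp only [mem_setOf_eq]
      constructor
      · rintro ⟨h1, h2⟩
        refine ⟨h1, ?_⟩
        rcases lt_trichotomy y t with h3 | rfl | h3
        · exact h3
        · exact absurd h1 h.1
        · exact absurd h1 (h' y h3 (h2.trans hx'))
      · rintro ⟨h1, h2⟩
        exact ⟨h1, h2.trans hx⟩
    let nj : ℕ → (Fin m → M) → ℕ := fun j c => if h : ∃ t, O j c t then n (sn c h.choose) else 0
    have hnj : ∀ j c t, O j c t → nj j c = n (sn c t) := by
      intro j c t h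
      have h' : ∃ t, O j c t := ⟨t, h⟩
      simp only [nj, dif_pos h']
      exact hOc j c _ _ h'.choose_spec h
    have hnj0 : ∀ j c, (¬ ∃ t, O j c t) → nj j c = 0 := by
      intro j c h
      simp only [nj, dif_neg h]
    have hnjd : ∀ j k, Dfn L M (fun c => nj j c = k) := by
      intro j k
      have h1 := hO j
      have h2 : Dfn L M (fun p : (Fin m → M) × M => n (sn p.1 p.2) = k) := Dfn.comp' (hn k) (by fun_prop)
      have h3 : Dfn L M (fun c => (∃ t, O j c t ∧ n (sn c t) = k) ∨ (¬ ∃ t, O j c t) ∧ 0 = k) := by fun_prop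
      refine h3.congr fun c => propext ?_
      by_cases h : ∃ t, O j c t
      · simp only [h, not_true_eq_false, false_and, or_false]
        obtain ⟨t, ht⟩ := h
        constructor
        · intro h; exact ⟨t, ht, by rw [← hnj j c t ht]; exact h⟩
        · rintro ⟨t', ht', h⟩; rw [hnj j c t' ht', h]
      · simp only [hnj0 j c h, h, not_false_eq_true, true_and]
        constructor
        · intro h; exact Or.inr h
        · rintro (⟨t, ht, _⟩ | h)
          · exact absurd ⟨t, ht⟩ h
          · exact h
    have key : ∀ j, ∃ K, ¬ Fat m (fun c => K < nj j c) := by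
      intro j
      have hOj := hO j
      refine ih (fun k hk => hUF k (by omega)) (nj j) (hnjd j) (fun i c => 
        ¬ ((∃ t, Ev (c i) (fun s => O j (Function.update c i s) t) ∧ ¬ B i.castSucc (sn c t)) ∨ 
         Ev (c i) (fun s => ¬ ∃ t, O j (Function.update c i s) t))) ?_ ?_ ?_
      · intro i
        have := hB i.castSucc
        fun_prop
      · intro i c
        have hBi := hB i.castSucc
        rw [← not_inf_iff (L := L) (by fun_prop)]
        rintro ⟨a0, b0, hab, h⟩
        simp only [Function.update_self, Function.update_idem] at h
        by_cases hne : ∃ a1 b1, a1 < b1 ∧ ∀ s, a1 < s → s < b1 → a0 < s ∧ s < b0 ∧ ¬ ∃ t, O j (Function.update c i s) t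
        · obtain ⟨a1, b1, hab1, h1⟩ := hne
          obtain ⟨s, hs, hs'⟩ := exists_between hab1
          obtain ⟨h2, h3, _⟩ := h1 s hs hs'
          exact h s h2 h3 (Or.inr ⟨a1, b1, hs, hs', fun x hx hx' => (h1 x hx hx').2.2⟩)
        · obtain ⟨k, a1, b1, hab1, h1⟩ := exists_sub (L := L) (I := Bool) 
            (A := fun k s => (k = true → ∃ t, O j (Function.update c i s) t) ∧ (k = false → ¬ ∃ t, O j (Function.update c i s) t))
            (by intro k; simp only [imp_iff_not_or]; fun_prop) hab (by
              intro s _ _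
              by_cases h : ∃ t, O j (Function.update c i s) t
              · exact ⟨true, by simpa using h⟩
              · exact ⟨false, by simpa using h⟩)
          cases k
          · exact hne ⟨a1, b1, hab1, fun s hs hs' => ⟨(h1 s hs hs').1, (h1 s hs hs').2.1, (h1 s hs hs').2.2.2 rfl⟩⟩
          obtain ⟨a2, b2, t1, t2, hab2, ht, hsub, hbox⟩ := box (L := L) 
            (Q := fun p : M × M => O j (Function.update c i p.1) p.2) (by fun_prop) hab1 (by
              intro s hs hs'
              obtain ⟨t, ht⟩ := (h1 s hs hs').2.2.1 rfl
              exact hOopen _ _ _ ht)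
          obtain ⟨t, ht1, ht2⟩ := exists_between ht
          have hfin := hBf i.castSucc (sn c t)
          simp only [update_sn_cast] at hfin
          obtain ⟨s, ⟨hs, hs'⟩, hs2⟩ := (Set.Ioo_infinite hab2).exists_notMem_finite hfin
          obtain ⟨h2, h3⟩ := hsub s hs hs'
          obtain ⟨h4, h5, _⟩ := h1 s h2 h3
          refine h s h4 h5 (Or.inl ⟨t, ⟨a2, b2, hs, hs', fun x hx hx' => ?_⟩, hs2⟩)
          exact hbox x t hx hx' ht1 ht2
      · intro i c h
        rcases not_not.1 h with ⟨t, h1, h2⟩ | h1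
        · have h3 := hloc i.castSucc _ h2
          simp only [sn_castSucc, update_sn_cast] at h3
          have h4 := h1.self
          rw [Function.update_eq_self] at h4
          refine (h1.and h3).mono ?_
          rintro x ⟨h5, h6⟩
          rw [hnj _ _ _ h5, hnj _ _ _ h4, h6]
        · have h4 := h1.self
          rw [Function.update_eq_self] at h4
          refine h1.mono fun x hx => ?_
          rw [hnj0 _ _ hx, hnj0 _ _ h4]
    choose K hK using key
    refine ⟨∑ j ∈ Finset.range (l+1), K j, fun hfat => ?_⟩
    refine not_fat_fex (L := L) (A := fun j c => K j < nj j c) ?_ hK (l+1) ?_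
    · intro j
      have h1 := hnjd j
      have h2 : Dfn L M (fun c => ¬ ∃ k : Fin (K j + 1), nj j c = k) := by
        refine Dfn.not' (Dfn.fex' fun k => h1 k)
      refine h2.congr fun c => propext ?_
      constructor
      · rintro h ⟨k, hk⟩
        omega
      · intro h
        by_contra h3
        exact h ⟨⟨nj j c, by omega⟩, rfl⟩
    · refine Fat.mono hfat fun c hc => ?_
      obtain ⟨t, ht, htb⟩ := hc.infinite.exists_notMem_finite (hbf c)
      refine ⟨cnt c t, Nat.lt_succ_of_le ?_, ?_⟩
      · exact (Set.ncard_le_ncard (fun y hy => hy.1) (hbf c)).trans (hl c)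
      · rw [hnj (cnt c t) c t ⟨htb, rfl⟩]
        refine lt_of_le_of_lt ?_ ht
        refine Finset.single_le_sum (f := K) (fun _ _ => Nat.zero_le _) ?_
        rw [Finset.mem_range]
        exact Nat.lt_succ_of_le ((Set.ncard_le_ncard (fun y hy => hy.1) (hbf c)).trans (hl c))

theorem uf (m : ℕ) : UF L M m := by
  classical
  induction m using Nat.strong_induction_on with
  | _ m hUF =>
  intro Z hZ hf
  have hl : ∀ i (v : Fin m → M), Dfn L M (fun p : M × M => Z (Function.update v i p.1) p.2) := by
    intro i v
    exact Dfn.comp' hZ (g := fun p : M × M => (Function.update v i p.1, p.2)) (by fun_prop)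
  have hnd : ∀ k, Dfn L M (fun v => {y | Z v y}.ncard = k) := fun k => Dfn.ncard_eq k hZ hf
  obtain ⟨K, hK⟩ := phi (L := L) hUF (fun v => {y | Z v y}.ncard) hnd
    (fun i v => ¬ Good (fun s y => Z (Function.update v i s) y) (v i)) 
    (by 
      intro i
      have h3 : Dfn L M (fun p : (Fin m → M) × M × M => Z (Function.update p.1 i p.2.1) p.2.2) := 
        Dfn.comp' hZ (g := fun p : (Fin m → M) × M × M => (Function.update p.1 i p.2.1, p.2.2)) (by fun_prop)
      exact Dfn.not' (Dfn.good' (by fun_prop) h3))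
    (by
      intro i v
      simp only [Function.update_self, Function.update_idem]
      exact good_fin (hl i v) (fun t => hf _))
    (by
      intro i v h
      have := good_const (hl i v) (fun t => hf _) (not_not.1 h)
      simpa only [Function.update_eq_self] using this)
  obtain ⟨I, hI, T, hT, hST, hρ⟩ := NF (L := L) hUF (by
      have h2 : Dfn L M (fun v => ¬ ∃ k : Fin (K + 1), {y | Z v y}.ncard = k) := by
        refine Dfn.not' (Dfn.fex' fun k => hnd k)
      refine h2.congr fun c => propext ?_
      constructor
      · rintro h ⟨k, hk⟩
        omega
      · intro h
        by_contra h3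
        exact h ⟨⟨{y | Z c y}.ncard, by omega⟩, rfl⟩) hK
  have : ∀ i, ∃ K', ∀ v, T i v → {y | Z v y}.ncard ≤ K' := by
    intro i
    obtain ⟨d, rfl, ρ, hρ1, hρ2⟩ := hρ i
    have hTi := hT i
    have hfib : ∀ v, T i v → {y | ∃ v', T i v' ∧ ρ v' = ρ v ∧ Z v' y} = {y | Z v y} := by
      intro v hv
      ext y
      constructor
      · rintro ⟨v', h1, h2, h3⟩
        rw [← hρ2 _ _ h1 hv h2]; exact h3
      · intro h; exact ⟨v, hv, rfl, h⟩
    obtain ⟨K', hK'⟩ := hUF d (by omega) (fun w y => ∃ v', T i v' ∧ ρ v' = w ∧ Z v' y) (by fun_prop) (by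
      intro w
      by_cases h : ∃ v, T i v ∧ ρ v = w
      · obtain ⟨v, hv, rfl⟩ := h
        rw [hfib v hv]; exact hf v
      · convert Set.finite_empty
        ext y
        simp only [mem_setOf_eq, mem_empty_iff_false, iff_false]
        rintro ⟨v, h1, h2, _⟩
        exact h ⟨v, h1, h2⟩)
    refine ⟨K', fun v hv => ?_⟩
    rw [← hfib v hv]
    exact hK' _
  choose K' hK' using this
  cases nonempty_fintype I
  refine ⟨K + ∑ i, K' i, fun v => ?_⟩
  by_cases h : K < {y | Z v y}.ncard
  · obtain ⟨i, hi⟩ := (hST v).1 h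
    have h1 := hK' i v hi
    have h2 := Finset.single_le_sum (f := K') (fun _ _ => Nat.zero_le _) (Finset.mem_univ i)
    omega
  · omega

instance {X : Type*} [Ctx L M X] : Finite (Ctx.κ L M X) := Ctx.fin

theorem dfn_comp_e {X : Type*} [Ctx L M X] {P : X → Prop} (hP : Dfn L M P) : 
    Dfn L M (fun w : Ctx.κ L M X → M => P (Ctx.e (L := L) w)) := by
  rw [dfn_iff_definable]
  exact hP _ _ Ctx.ept

theorem ufc {X : Type*} [Ctx L M X] {Z : X → M → Prop} (hZ : Dfn L M (fun p : X × M => Z p.1 p.2))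
    (hf : ∀ v, {y | Z v y}.Finite) : ∃ K : ℕ, ∀ v, {y | Z v y}.ncard ≤ K := by
  obtain ⟨m, ⟨ε⟩⟩ := Finite.exists_equiv_fin (Ctx.κ L M X)
  have h1 := dfn_comp_e hZ
  have h2 : Dfn L M (fun p : (Fin m → M) × M => Z (Ctx.e (L := L) (p.1 ∘ ε)) p.2) := by
    refine Dfn.comp' h1 (g := fun p : (Fin m → M) × M => Sum.elim (p.1 ∘ ε) (fun _ : Unit => p.2)) ?_
    refine Dfn.pi' ?_
    rintro (i | i) 
    · simp only [Sum.elim_inl, Function.comp]; fun_prop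
    · simp only [Sum.elim_inr]; fun_prop
  obtain ⟨K, hK⟩ := uf (L := L) m (fun v y => Z (Ctx.e (L := L) (v ∘ ε)) y) h2 (fun v => hf _)
  refine ⟨K, fun v => ?_⟩
  obtain ⟨u, rfl⟩ := Ctx.surj (L := L) (M := M) v
  have := hK (u ∘ ε.symm)
  simpa [Function.comp_assoc] using this

end MS

open FirstOrder Set
set_option linter.unusedVariables false
set_option linter.unusedSectionVars false
set_option linter.style.haveILetI false
set_option linter.unusedSimpArgs false
namespace MS

variable {L : Language} {M : Type*} [L.Structure M] [LinearOrder M] [DenselyOrdered M]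
  [NoMinOrder M] [NoMaxOrder M] [Nonempty M] [OM L M]

theorem B_fin {Λ : Type*} [Ctx L M Λ] {W : Λ → M → Prop} (hW : Dfn L M (fun p : Λ × M => W p.1 p.2))
    {E : Λ → Λ → Prop} (hE : ∀ l l', E l l' → ∀ x, W l x ↔ W l' x) {k : ℕ}
    (hov : ∀ x (g : Fin (k+1) → Λ), (∀ i, W (g i) x) → ∃ i j, i ≠ j ∧ E (g i) (g j)) :
    {x | ∃ l, ¬ Ev x (W l) ∧ ∃ z, x < z ∧ ∀ y, x < y → y < z → W l y}.Finite := by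
  rw [← not_inf_iff (L := L) (by simp only [all_iff, imp_iff_not_or]; fun_prop)]
  rintro ⟨a, b, hab, h⟩
  obtain ⟨a', b', t1, t2, hab', ht, hsub, hbox⟩ := box (L := L) 
    (Q := fun p : M × M => p.1 < p.2 ∧ ∃ l, ¬ Ev p.1 (W l) ∧ ∀ y, p.1 < y → y ≤ p.2 → W l y)
    (by simp only [all_iff, imp_iff_not_or]; fun_prop) hab (by
      intro x hx hx'
      obtain ⟨l, h1, z, hz, h2⟩ := h x hx hx'
      exact ⟨x, z, hz, fun w hw hw' => ⟨hw, l, h1, fun y hy hy' => h2 y hy (hy'.trans_lt hw')⟩⟩)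
  obtain ⟨z, hz1, hz2⟩ := exists_between ht
  obtain ⟨s, hs, hsc⟩ := (Set.Ioo_infinite hab').exists_subset_card_eq (k+1)
  have hs' : ∀ i, s.orderEmbOfFin hsc i ∈ Ioo a' b' := fun i => hs (by simp)
  have := fun i => hbox (s.orderEmbOfFin hsc i) z (hs' i).1 (hs' i).2 hz1 hz2
  dsimp only at this
  choose h1 g h2 h3 using this
  obtain ⟨i, j, hij, he⟩ := hov z g (fun i => h3 i z (h1 i) le_rfl)
  have key : ∀ i j, i < j → (∀ x, W (g i) x ↔ W (g j) x) → False := by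
    intro i j hij he
    refine h2 j ⟨s.orderEmbOfFin hsc i, z, by simpa using hij, h1 j, fun x hx hx' => ?_⟩
    exact (he x).1 (h3 i x hx hx'.le)
  rcases lt_or_gt_of_ne hij with h | h
  · exact key i j h (hE _ _ he)
  · exact key j i h (fun x => (hE _ _ he x).symm)

theorem ev_extend {A : M → Prop} (hA : Dfn L M A) {x y : M} (hxy : x < y) (hx : Ev x A)
    (h : ∀ e, x < e → e ≤ y → ¬ Ev e A → (∃ z, z < e ∧ ∀ w, z < w → w < e → A w) → False) : A y := by
  have hP : Dfn L M (fun w => Ev w A) := by fun_prop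
  have := ri hP (x := x) (b := y) (by
      obtain ⟨p, q, hp, hq, h'⟩ := hx
      exact ⟨q, hq, fun w hw hw' => ⟨p, q, hp.trans hw, hw', h'⟩⟩) (by
      intro z hz hz' hw
      have hE : Ev z A := by
        by_contra hn
        exact h z hz hz'.le hn ⟨x, hz, fun w h1 h2 => (hw w h1 h2).self⟩
      refine ⟨hE, ?_⟩
      obtain ⟨p, q, hp, hq, h'⟩ := hE
      exact ⟨q, hq, fun w hw hw' => ⟨p, q, hp.trans hw, hw', h'⟩⟩)
  by_contra hn
  exact h y hxy le_rfl (fun he => hn he.self) ⟨x, hxy, fun w h1 h2 => (this w h1 h2).self⟩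

theorem ev_extend' {A : M → Prop} (hA : Dfn L M A) {x y : M} (hxy : y < x) (hx : Ev x A)
    (h : ∀ e, e < x → y ≤ e → ¬ Ev e A → (∃ z, e < z ∧ ∀ w, e < w → w < z → A w) → False) : A y := by
  refine @ev_extend L M _ (dualLO M) dualDense dualMin dualMax _ OM.dual A hA x y hxy ?_ ?_
  · obtain ⟨p, q, hp, hq, h'⟩ := hx
    exact ⟨q, p, hq, hp, fun w h1 h2 => h' w h2 h1⟩
  · intro e he he' hev hz
    refine h e he he' (fun hh => hev ?_) ?_
    · obtain ⟨p, q, hp, hq, h'⟩ := hh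
      exact ⟨q, p, hq, hp, fun w h1 h2 => h' w h2 h1⟩
    · obtain ⟨z, hz, h2⟩ := hz
      exact ⟨z, hz, fun w h3 h4 => h2 w h4 h3⟩

theorem F1 {Γ Λ : Type*} [Ctx L M Γ] [Ctx L M Λ] {W : Γ → Λ → M → Prop} 
    (hW : Dfn L M (fun p : Γ × Λ × M => W p.1 p.2.1 p.2.2))
    {E : Γ → Λ → Λ → Prop} (hE : ∀ c l l', E c l l' → ∀ x, W c l x ↔ W c l' x) {k : ℕ}
    (hov : ∀ c x (g : Fin (k+1) → Λ), (∀ i, W c (g i) x) → ∃ i j, i ≠ j ∧ E c (g i) (g j)) :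
    ∃ r, ∀ c (g : Fin (r+1) → Λ), (∀ i, Inf (W c (g i))) → ∃ i j, i ≠ j ∧ E c (g i) (g j) := by
  have hW1 : ∀ c, Dfn L M (fun p : Λ × M => W c p.1 p.2) := fun c => 
    Dfn.comp' hW (g := fun p : Λ × M => (c, p)) (by fun_prop)
  have hW2 : ∀ c l, Dfn L M (fun x => W c l x) := fun c l => 
    Dfn.comp' hW (g := fun p : M => (c, l, p)) (by fun_prop)
  let B : Γ → M → Prop := fun c x => ∃ l, ¬ Ev x (W c l) ∧ 
    ((∃ z, x < z ∧ ∀ y, x < y → y < z → W c l y) ∨ (∃ z, z < x ∧ ∀ y, z < y → y < x → W c l y))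
  have hB : Dfn L M (fun p : Γ × M => B p.1 p.2) := by
    simp only [B, all_iff, imp_iff_not_or]; fun_prop
  have hBf : ∀ c, {x | B c x}.Finite := by
    intro c
    have h1 := B_fin (L := L) (hW1 c) (hE c) (hov c)
    have h2 := @B_fin L M _ (dualLO M) dualDense dualMin dualMax _ OM.dual Λ _ _ (hW1 c) _ (hE c) k (hov c)
    refine (h1.union h2).subset ?_
    rintro x ⟨l, h1, h2 | h2⟩
    · exact Or.inl ⟨l, h1, h2⟩
    · refine Or.inr ⟨l, fun hh => h1 ?_, ?_⟩
      · obtain ⟨p, q, hp, hq, h'⟩ := hh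
        exact ⟨q, p, hq, hp, fun w h1 h2 => h' w h2 h1⟩
      · obtain ⟨z, hz, h2⟩ := h2
        exact ⟨z, hz, fun w h3 h4 => h2 w h4 h3⟩
  obtain ⟨l, hl⟩ := ufc hB hBf
  refine ⟨k * (l+1), fun c g hg => ?_⟩
  have : ∀ i, ∃ x, Ev x (W c (g i)) ∧ ¬ B c x := by
    intro i
    obtain ⟨a, b, hab, h⟩ := hg i
    obtain ⟨x, ⟨h1, h2⟩, h3⟩ := (Set.Ioo_infinite hab).exists_notMem_finite (hBf c)
    exact ⟨x, ⟨a, b, h1, h2, h⟩, h3⟩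
  choose x hx hxB using this
  let idx : Fin (k*(l+1)+1) → Fin (l+1) := fun i => ⟨{y | B c y ∧ y < x i}.ncard, Nat.lt_succ_of_le 
    ((Set.ncard_le_ncard (fun y hy => hy.1) (hBf c)).trans (hl c))⟩
  obtain ⟨y, hy⟩ := Fintype.exists_lt_card_fiber_of_mul_lt_card (f := idx) (n := k) (by simp; nlinarith)
  let em := Finset.orderEmbOfCardLe (k := k+1) _ hy
  have hem : ∀ i, idx (em i) = y := by
    intro i
    have := Finset.orderEmbOfCardLe_mem _ hy i
    simpa using this
  have key : ∀ i j, x (em i) < x (em j) → ∀ e, x (em i) ≤ e → e ≤ x (em j) → ¬ B c e := by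
    intro i j hij e he1 he2 hBe
    have hne : e ≠ x (em j) := by rintro rfl; exact hxB _ hBe
    have he2 := lt_of_le_of_ne he2 hne
    have : {y | B c y ∧ y < x (em i)}.ncard < {y | B c y ∧ y < x (em j)}.ncard := by
      refine Set.ncard_lt_ncard ?_ ((hBf c).subset fun y hy => hy.1)
      refine ⟨fun y hy => ⟨hy.1, hy.2.trans hij⟩, fun hh => ?_⟩
      exact absurd (hh (show e ∈ _ from ⟨hBe, he2⟩)).2 (not_lt.2 he1)
    have e1 := congrArg Fin.val (hem i)
    have e2 := congrArg Fin.val (hem j)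
    simp only [idx] at e1 e2
    omega
  obtain ⟨i, j, hij, he⟩ := hov c (x (em 0)) (fun i => g (em i)) (by
    intro i
    rcases lt_trichotomy (x (em i)) (x (em 0)) with h | h | h
    · exact ev_extend (hW2 c _) h (hx (em i)) (fun e h1 h2 h3 h4 => key i 0 h e h1.le h2 ⟨_, h3, Or.inr h4⟩)
    · rw [← h]; exact (hx _).self
    · exact ev_extend' (hW2 c _) h (hx (em i)) (fun e h1 h2 h3 h4 => key 0 i h e h2 h1.le ⟨_, h3, Or.inl h4⟩))
  exact ⟨em i, em j, fun h => hij (em.injective h), he⟩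

theorem FF {Γ Λ : Type*} [Ctx L M Γ] [Ctx L M Λ] {m : ℕ} {W : Γ → Λ → (Fin m → M) → Prop} 
    (hW : Dfn L M (fun p : Γ × Λ × (Fin m → M) => W p.1 p.2.1 p.2.2))
    {E : Γ → Λ → Λ → Prop} (hE : ∀ c l l', E c l l' → ∀ x, W c l x ↔ W c l' x) {k : ℕ}
    (hov : ∀ c x (g : Fin (k+1) → Λ), (∀ i, W c (g i) x) → ∃ i j, i ≠ j ∧ E c (g i) (g j)) :
    ∃ r, ∀ c (g : Fin (r+1) → Λ), (∀ i, Fat m (W c (g i))) → ∃ i j, i ≠ j ∧ E c (g i) (g j) := by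
  induction m generalizing k with
  | zero => exact ⟨k, fun c g hg => hov c _ g hg⟩
  | succ m ih =>
    obtain ⟨r, hr⟩ := F1 (L := L) (Γ := Γ × (Fin m → M)) (Λ := Λ) 
      (W := fun c l t => W c.1 l (sn c.2 t)) (by
        exact Dfn.comp' hW (g := fun p : (Γ × (Fin m → M)) × Λ × M => (p.1.1, p.2.1, sn p.1.2 p.2.2)) (by fun_prop))
      (E := fun c => E c.1) (fun c l l' h x => hE c.1 l l' h _) (k := k) (fun c x g h => hov c.1 _ g h)
    exact ih (W := fun c l v => Inf (fun t => W c l (sn v t))) (by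
        refine Dfn.inf' ?_
        exact Dfn.comp' hW (g := fun p : (Γ × Λ × (Fin m → M)) × M => (p.1.1, p.1.2.1, sn p.1.2.2 p.2)) (by fun_prop))
      (fun c l l' h v => by simp only [hE c l l' h]) (fun c v g hg => hr (c, v) g hg)

end MS

open FirstOrder Set
set_option linter.unusedVariables false
set_option linter.unusedSectionVars false
set_option linter.style.haveILetI false
set_option linter.unusedSimpArgs false
namespace MS

/-- an irrational cut -/
structure Cut {M : Type*} [LinearOrder M] (T : M → Prop) (s0 s1 : M) : Prop where
  down : ∀ x y, x ≤ y → T y → T x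
  lo : T s0
  hi : ¬ T s1
  irr : ¬ ∃ s, IsLUB {x | T x} s

def Star (L : Language) (M : Type*) [L.Structure M] [LinearOrder M] {Γ : Type*} [Ctx L M Γ] 
    (C : Γ → Prop) : Prop :=
  ∃ P : M → Γ → Prop, Dfn L M (fun p : M × Γ => P p.1 p.2) ∧ ∃ (T : M → Prop) (s0 s1 : M), Cut T s0 s1 ∧
    ∃ Q : M → Prop, ((∀ s, Q s ↔ T s) ∨ (∀ s, Q s ↔ ¬ T s)) ∧ 
      ∀ s, s0 ≤ s → s ≤ s1 → (Q s → ∀ u, P s u → C u) ∧ (¬ Q s → ∀ u, C u → P s u)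

def AStat (L : Language) (M : Type*) [L.Structure M] [LinearOrder M] (Γ : Type*) [Ctx L M Γ] : Prop :=
  ∀ R : Γ → Γ → Prop, Dfn L M (fun p : Γ × Γ => R p.1 p.2) → (∀ u v w, R u v → R v w → R u w) → 
    (∀ u v, R u v ∨ R v u) → ∀ C : Γ → Prop, (∀ u v, R u v → C v → C u) → Dfn L M C ∨ Star L M C

variable {L : Language} {M : Type*} [L.Structure M] [LinearOrder M] [DenselyOrdered M]
  [NoMinOrder M] [NoMaxOrder M] [Nonempty M] [OM L M]

theorem lift {Γ Δ : Type*} [Ctx L M Γ] [Ctx L M Δ] (hΔ : AStat L M Δ) {R : Γ → Γ → Prop} 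
    (htot : ∀ u v, R u v ∨ R v u) {C : Γ → Prop} (hC : ∀ u v, R u v → C v → C u)
    {D : Δ → Γ → Prop} (hD : Dfn L M (fun p : Δ × Γ => D p.1 p.2)) 
    (hDd : ∀ d u v, R u v → D d v → D d u) : 
    Dfn L M (fun d => ∀ u, D d u → C u) ∨ Star L M C := by
  have hcomp : ∀ A B : Γ → Prop, (∀ u v, R u v → A v → A u) → (∀ u v, R u v → B v → B u) → 
      (∀ u, A u → B u) ∨ (∀ u, B u → A u) := by
    intro A B hA hB
    by_contra hn
    push Not at hn
    obtain ⟨⟨u, h1, h2⟩, v, h3, h4⟩ := hn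
    rcases htot u v with h | h
    · exact h2 (hB _ _ h h3)
    · exact h4 (hA _ _ h h1)
  rcases hΔ (fun d d' => ∀ u, D d u → D d' u) (by simp only [all_iff, imp_iff_not_or]; fun_prop)
    (fun u v w h1 h2 x hx => h2 x (h1 x hx)) (fun d d' => hcomp _ _ (hDd d) (hDd d')) 
    (fun d => ∀ u, D d u → C u) (fun d d' h1 h2 u hu => h2 u (h1 u hu)) with h | ⟨P, hP, T, s0, s1, hT, Q, hQ, h⟩
  · exact Or.inl h
  · by_cases hd : Dfn L M (fun d => ∀ u, D d u → C u)
    · exact Or.inl hd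
    right
    refine ⟨fun s u => ∃ d, P s d ∧ D d u, by fun_prop, T, s0, s1, hT, Q, hQ, fun s hs hs' => ⟨?_, ?_⟩⟩
    · rintro hq u ⟨d, h1, h2⟩
      exact (h s hs hs').1 hq d h1 u h2
    · intro hq u hu
      have h1 := (h s hs hs').2 hq
      have h2 : ∃ d, P s d ∧ ¬ ∀ u, D d u → C u := by
        by_contra hn
        push Not at hn
        refine hd (Dfn.congr (f := P s) (by fun_prop) fun d => propext ⟨h1 d, hn d⟩)
      obtain ⟨d, h3, h4⟩ := h2
      rcases hcomp _ _ (hDd d) hC with h5 | h5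
      · exact absurd h5 h4
      · exact ⟨d, h3, h5 u hu⟩

theorem Dfn.of_finite {F : M → Prop} (h : {x | F x}.Finite) : Dfn L M F := by
  have := h.to_subtype
  have h2 : Dfn L M (fun x : M => ∃ i : {x | F x}, x = (i : M)) := 
    Dfn.fex' (P := fun (x : M) (i : {x | F x}) => x = (i : M)) fun i => by fun_prop
  refine h2.congr fun x => propext ⟨fun hx => ⟨⟨x, hx⟩, rfl⟩, ?_⟩
  rintro ⟨i, rfl⟩
  exact i.2

theorem const_seg {A : M → Prop} (hA : Dfn L M A) {x y : M} (hxy : x < y) 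
    (h : ∀ z, x ≤ z → z ≤ y → Ev z A ∨ Ev z (fun w => ¬ A w)) : A x ↔ A y := by
  have h' : ∀ z, (Ev z A ∨ Ev z (fun w => ¬ A w)) → ∃ a b, a < z ∧ z < b ∧ ∀ w, a < w → w < b → 
     (∃ a b, a < w ∧ w < b ∧
    ((∀ y, a < y → y < b → A y) ∨ (∀ y, a < y → y < b → ¬ A y))) := by
    rintro z (⟨a, b, h1, h2, h3⟩ | ⟨a, b, h1, h2, h3⟩)
    · exact ⟨a, b, h1, h2, fun w h4 h5 => ⟨a, b, h4, h5, Or.inl h3⟩⟩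
    · exact ⟨a, b, h1, h2, fun w h4 h5 => ⟨a, b, h4, h5, Or.inr h3⟩⟩
  obtain ⟨a, b, h1, h2, h3⟩ := h' x (h x le_rfl hxy.le)
  obtain ⟨a', b', h1', h2', h3'⟩ := h' y (h y hxy.le le_rfl)
  refine const_of_no_bd hA (a := a) (b := b') (fun w hw hw' => ?_) x y h1 (hxy.trans h2') (h1.trans hxy) h2'
  rcases lt_or_ge w x with h4 | h4
  · exact h3 w hw (h4.trans h2)
  rcases lt_or_ge y w with h5 | h5
  · exact h3' w (h1'.trans h5) hw'
  obtain ⟨a2, b2, h6, h7, h8⟩ := h' w (h w h4 h5)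
  exact h8 w h6 h7

/-- locally increasing -/
def LI {M : Type*} [LT M] (R : M → M → Prop) (t : M) : Prop :=
  ∃ a b, a < t ∧ t < b ∧ ∀ x y, a < x → x < y → y < b → ¬ R y x
def LC {M : Type*} [LT M] (R : M → M → Prop) (t : M) : Prop :=
  ∃ a b, a < t ∧ t < b ∧ ∀ x y, a < x → x < b → a < y → y < b → R x y

theorem LI.ev {R : M → M → Prop} {t : M} (h : LI R t) : Ev t (LI R) := by
  obtain ⟨a, b, h1, h2, h⟩ := h
  exact ⟨a, b, h1, h2, fun x h3 h4 => ⟨a, b, h3, h4, h⟩⟩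
theorem LC.ev {R : M → M → Prop} {t : M} (h : LC R t) : Ev t (LC R) := by
  obtain ⟨a, b, h1, h2, h⟩ := h
  exact ⟨a, b, h1, h2, fun x h3 h4 => ⟨a, b, h3, h4, h⟩⟩
theorem two_pts {t a b a' b' : M} (h1 : a < t) (h2 : t < b) (h1' : a' < t) (h2' : t < b') : 
    ∃ y, a < y ∧ t < y ∧ y < b ∧ a' < y ∧ y < b' := by
  obtain ⟨y, h3, h4⟩ := exists_between (lt_min h2 h2')
  exact ⟨y, h1.trans h3, h3, h4.trans_le (min_le_left _ _), h1'.trans h3, h4.trans_le (min_le_right _ _)⟩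
theorem LI_not_LC {R : M → M → Prop} {t : M} (h : LI R t) : ¬ LC R t := by
  rintro ⟨a', b', h1', h2', h'⟩
  obtain ⟨a, b, h1, h2, h⟩ := h
  obtain ⟨y, h3, h4, h5, h6, h7⟩ := two_pts h1 h2 h1' h2'
  exact h t y h1 h4 h5 (h' y t h6 h7 h1' h2')
theorem LI_not_LD {R : M → M → Prop} (htot : ∀ u v, R u v ∨ R v u) {t : M} (h : LI R t) : ¬ LI (fun x y => R y x) t := by
  rintro ⟨a', b', h1', h2', h'⟩
  obtain ⟨a, b, h1, h2, h⟩ := h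
  obtain ⟨y, h3, h4, h5, h6, h7⟩ := two_pts h1 h2 h1' h2'
  rcases htot y t with h8 | h8
  · exact h t y h1 h4 h5 h8
  · exact h' t y h1' h4 h7 h8
theorem LD_not_LC {R : M → M → Prop} {t : M} (h : LI (fun x y => R y x) t) : ¬ LC R t := by
  intro h'
  refine LI_not_LC h ?_
  obtain ⟨a, b, h1, h2, h⟩ := h'
  exact ⟨a, b, h1, h2, fun x y h3 h4 h5 h6 => h y x h5 h6 h3 h4⟩

theorem glob_inc {R : M → M → Prop} (hR : Dfn L M (fun p : M × M => R p.1 p.2)) 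
    (htr : ∀ u v w, R u v → R v w → R u w) (htot : ∀ u v, R u v ∨ R v u) {x y : M} (hxy : x < y)
    (h : ∀ z, x ≤ z → z ≤ y → LI R z) : ¬ R y x := by
  have step : ∀ z, x < z → z ≤ y → (∀ w, x < w → w < z → ¬ R w x) → ¬ R z x := by
    intro z hz hzy hw hn
    obtain ⟨a, b, h1, h2, h3⟩ := h z hz.le hzy
    obtain ⟨w, hw1, hw2⟩ := exists_between (max_lt h1 hz)
    have hw3 := (le_max_left _ _).trans_lt hw1
    have hw4 := (le_max_right _ _).trans_lt hw1
    exact h3 w z hw3 hw2 h2 (htr _ _ _ hn ((htot w x).resolve_left (hw w hw4 hw2)))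
  have := ri (L := L) (P := fun w => ¬ R w x) (by fun_prop) (x := x) (b := y) (by
    obtain ⟨a, b, h1, h2, h3⟩ := h x le_rfl hxy.le
    exact ⟨b, h2, fun w h4 h5 => h3 x w h1 h4 h5⟩) (by
    intro z hz hzy hw
    have hz' := step z hz hzy.le hw
    refine ⟨hz', ?_⟩
    obtain ⟨a, b, h1, h2, h3⟩ := h z hz.le hzy.le
    refine ⟨b, h2, fun w h4 h5 h6 => ?_⟩
    exact h3 z w h1 h4 h5 (htr _ _ _ h6 ((htot z x).resolve_left hz')))
  exact step y hxy le_rfl this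

theorem glob_const {R : M → M → Prop} (hR : Dfn L M (fun p : M × M => R p.1 p.2)) 
    (htr : ∀ u v w, R u v → R v w → R u w) {x y : M} (hxy : x < y)
    (h : ∀ z, x ≤ z → z ≤ y → LC R z) : R y x ∧ R x y := by
  have step : ∀ z, x < z → z ≤ y → (∀ w, x < w → w < z → R w x ∧ R x w) → R z x ∧ R x z := by
    intro z hz hzy hw
    obtain ⟨a, b, h1, h2, h3⟩ := h z hz.le hzy
    obtain ⟨w, hw1, hw2⟩ := exists_between (max_lt h1 hz)
    have hw3 := (le_max_left _ _).trans_lt hw1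
    have hw4 := (le_max_right _ _).trans_lt hw1
    exact ⟨htr _ _ _ (h3 z w h1 h2 hw3 (hw2.trans h2)) (hw w hw4 hw2).1, 
      htr _ _ _ (hw w hw4 hw2).2 (h3 w z hw3 (hw2.trans h2) h1 h2)⟩
  have := ri (L := L) (P := fun w => R w x ∧ R x w) (by fun_prop) (x := x) (b := y) (by
    obtain ⟨a, b, h1, h2, h3⟩ := h x le_rfl hxy.le
    exact ⟨b, h2, fun w h4 h5 => ⟨h3 w x (h1.trans h4) h5 h1 h2, h3 x w h1 h2 (h1.trans h4) h5⟩⟩) (by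
    intro z hz hzy hw
    have hz' := step z hz hzy.le hw
    refine ⟨hz', ?_⟩
    obtain ⟨a, b, h1, h2, h3⟩ := h z hz.le hzy.le
    refine ⟨b, h2, fun w h4 h5 => ⟨?_, ?_⟩⟩
    · exact htr _ _ _ (h3 w z (h1.trans h4) h5 h1 h2) hz'.1
    · exact htr _ _ _ hz'.2 (h3 z w h1 h2 (h1.trans h4) h5))
  exact step y hxy le_rfl this

/-- initial segments of a convex definable set -/
theorem cut_or {C O : M → Prop} (hO : Dfn L M O) (hOc : ∀ x y z, O x → O z → x ≤ y → y ≤ z → O y)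
    (hC : ∀ x y, O x → O y → x ≤ y → C y → C x) : 
    Dfn L M (fun x => O x ∧ C x) ∨ ∃ T s0 s1, Cut T s0 s1 ∧ ∀ s, s0 ≤ s → s ≤ s1 → (C s ↔ T s) := by
  by_cases h0 : ∃ x, O x ∧ C x
  swap
  · left
    push Not at h0
    exact (Dfn.const' False).congr fun x => propext ⟨fun h => h0 x h.1 h.2, False.elim⟩
  by_cases h1 : ∃ x, O x ∧ ¬ C x
  swap
  · left
    push Not at h1
    exact hO.congr fun x => propext ⟨fun h => h.1, fun h => ⟨h, h1 x h⟩⟩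
  obtain ⟨s0, hs0, hs0'⟩ := h0
  obtain ⟨s1, hs1, hs1'⟩ := h1
  have hlt : s0 < s1 := by
    by_contra hn
    exact hs1' (hC _ _ hs1 hs0 (not_lt.1 hn) hs0')
  let T : M → Prop := fun x => ∃ y, (O y ∧ C y) ∧ x ≤ y
  have hTC : ∀ s, O s → (C s ↔ T s) := by
    intro s hs
    exact ⟨fun h => ⟨s, ⟨hs, h⟩, le_rfl⟩, fun ⟨y, h1, h2⟩ => hC _ _ hs h1.1 h2 h1.2⟩
  by_cases hlub : ∃ s, IsLUB {x | T x} s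
  · left
    obtain ⟨s, hs⟩ := hlub
    by_cases hsT : T s
    · refine Dfn.congr (f := fun x => O x ∧ x ≤ s) (by fun_prop) fun x => propext ?_
      constructor
      · rintro ⟨h1, h2⟩; exact ⟨h1, hs.1 ((hTC x h1).1 h2)⟩
      · rintro ⟨h1, h2⟩
        obtain ⟨y, h3, h4⟩ := hsT
        exact ⟨h1, (hTC x h1).2 ⟨y, h3, h2.trans h4⟩⟩
    · refine Dfn.congr (f := fun x => O x ∧ x < s) (by fun_prop) fun x => propext ?_
      constructor
      · rintro ⟨h1, h2⟩
        have h3 := (hTC x h1).1 h2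
        refine ⟨h1, lt_of_le_of_ne (hs.1 h3) ?_⟩
        rintro rfl; exact hsT h3
      · rintro ⟨h1, h2⟩
        obtain ⟨y, ⟨z, h3, h4⟩, h5⟩ := (lt_isLUB_iff hs).1 h2
        exact ⟨h1, (hTC x h1).2 ⟨z, h3, h5.le.trans h4⟩⟩
  · right
    refine ⟨T, s0, s1, ⟨?_, (hTC _ hs0).1 hs0', fun h => hs1' ((hTC _ hs1).2 h), hlub⟩, ?_⟩
    · rintro x y h ⟨z, h1, h2⟩
      exact ⟨z, h1, h.trans h2⟩
    · intro s h1 h2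
      exact hTC s (hOc _ _ _ hs0 hs1 h1 h2)

theorem astat_M : AStat L M M := by
  classical
  intro R hR htr htot C hC
  have hLI : Dfn L M (LI R) := by
    unfold LI; simp only [all_iff, imp_iff_not_or]; fun_prop
  have hLD : Dfn L M (LI (fun x y => R y x)) := by
    unfold LI; simp only [all_iff, imp_iff_not_or]; fun_prop
  have hLC : Dfn L M (LC R) := by
    unfold LC; simp only [all_iff, imp_iff_not_or]; fun_prop
  let F : M → Prop := fun t => ¬ (LC R t ∨ LI R t ∨ LI (fun x y => R y x) t)
  have hF : Dfn L M F := by simp only [F]; fun_prop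
  have hFf : {x | F x}.Finite := by
    rw [← not_inf_iff hF]
    rintro ⟨a, b, hab, h⟩
    obtain ⟨a', b', hab', hsub, h'⟩ := mono_pre (L := L) (R := fun p => R p.1 p.2) hR htr htot hab
    obtain ⟨t, ht, ht'⟩ := exists_between hab'
    refine h t (hsub t ht ht').1 (hsub t ht ht').2 ?_
    rcases h' with h' | h' | h'
    · exact Or.inl ⟨a', b', ht, ht', fun x y h1 h2 h3 h4 => h' x y h1 h2 h3 h4⟩
    · exact Or.inr (Or.inl ⟨a', b', ht, ht', fun x y h1 h2 h3 => h' x y h1 h2 h3⟩)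
    · exact Or.inr (Or.inr ⟨a', b', ht, ht', fun x y h1 h2 h3 => h' x y h1 h2 h3⟩)
  by_cases hstar : Star L M C
  · exact Or.inr hstar
  left
  let O : ℕ → M → Prop := fun j t => ¬ F t ∧ {y | F y ∧ y < t}.ncard = j
  have hO : ∀ j, Dfn L M (O j) := by
    intro j
    refine Dfn.and' (by fun_prop) (Dfn.ncard_eq (A := fun t y => F y ∧ y < t) j (by fun_prop) 
      (fun t => hFf.subset fun y hy => hy.1))
  have hno : ∀ j x z, O j x → O j z → ∀ y, x ≤ y → y ≤ z → ¬ F y := by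
    intro j x z hx hz y hxy hyz hFy
    have hne : y ≠ z := by rintro rfl; exact hz.1 hFy
    have hyz := lt_of_le_of_ne hyz hne
    have : {y | F y ∧ y < x}.ncard < {y | F y ∧ y < z}.ncard := by
      refine Set.ncard_lt_ncard ?_ (hFf.subset fun y hy => hy.1)
      refine ⟨fun y hy => ⟨hy.1, hy.2.trans (hxy.trans_lt hyz)⟩, fun hh => ?_⟩
      exact absurd (hh (show y ∈ _ from ⟨hFy, hyz⟩)).2 (not_lt.2 hxy)
    rw [hx.2, hz.2] at this
    exact lt_irrefl _ this
  have hOc : ∀ j x y z, O j x → O j z → x ≤ y → y ≤ z → O j y := by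
    intro j x y z hx hz hxy hyz
    refine ⟨hno j x z hx hz y hxy hyz, le_antisymm ?_ ?_⟩
    · rw [← hz.2]
      exact Set.ncard_le_ncard (fun w hw => ⟨hw.1, hw.2.trans_le hyz⟩) (hFf.subset fun y hy => hy.1)
    · rw [← hx.2]
      exact Set.ncard_le_ncard (fun w hw => ⟨hw.1, hw.2.trans_le hxy⟩) (hFf.subset fun y hy => hy.1)
  have htype : ∀ z, ¬ F z → (Ev z (LC R) ∨ Ev z (fun w => ¬ LC R w)) ∧ (Ev z (LI R) ∨ Ev z (fun w => ¬ LI R w)) ∧ 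
      (Ev z (LI (fun x y => R y x)) ∨ Ev z (fun w => ¬ LI (fun x y => R y x) w)) := by
    intro z hz
    rcases not_not.1 hz with h | h | h
    · exact ⟨Or.inl h.ev, Or.inr (h.ev.mono fun w hw h' => LI_not_LC h' hw), Or.inr (h.ev.mono fun w hw h' => LD_not_LC h' hw)⟩
    · exact ⟨Or.inr (h.ev.mono fun w hw => LI_not_LC hw), Or.inl h.ev, Or.inr (h.ev.mono fun w hw => LI_not_LD htot hw)⟩
    · exact ⟨Or.inr (h.ev.mono fun w hw => LD_not_LC hw), Or.inr (h.ev.mono fun w hw h' => LI_not_LD htot h' hw), Or.inl h.ev⟩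
  have hsame : ∀ j x y, O j x → O j y → (LC R x ↔ LC R y) ∧ (LI R x ↔ LI R y) ∧ 
      (LI (fun x y => R y x) x ↔ LI (fun x y => R y x) y) := by
    have : ∀ j x y, x < y → O j x → O j y → (LC R x ↔ LC R y) ∧ (LI R x ↔ LI R y) ∧ 
      (LI (fun x y => R y x) x ↔ LI (fun x y => R y x) y) := by
      intro j x y hxy hx hy
      have := fun z h1 h2 => htype z (hno j x y hx hy z h1 h2)
      exact ⟨const_seg hLC hxy (fun z h1 h2 => (this z h1 h2).1), 
        const_seg hLI hxy (fun z h1 h2 => (this z h1 h2).2.1), 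
        const_seg hLD hxy (fun z h1 h2 => (this z h1 h2).2.2)⟩
    intro j x y hx hy
    rcases lt_trichotomy x y with h | rfl | h
    · exact this j x y h hx hy
    · exact ⟨Iff.rfl, Iff.rfl, Iff.rfl⟩
    · have := this j y x h hy hx
      exact ⟨this.1.symm, this.2.1.symm, this.2.2.symm⟩
  have mkstar : ∀ T s0 s1, Cut T s0 s1 → (∃ Q : M → Prop, ((∀ s, Q s ↔ T s) ∨ (∀ s, Q s ↔ ¬ T s)) ∧ 
      ∀ s, s0 ≤ s → s ≤ s1 → (C s ↔ Q s)) → False := by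
    rintro T s0 s1 hT ⟨Q, hQ, h⟩
    refine hstar ⟨fun s u => R u s, by fun_prop, T, s0, s1, hT, Q, hQ, fun s h1 h2 => ⟨?_, ?_⟩⟩
    · intro hq u hu
      exact hC u s hu ((h s h1 h2).2 hq)
    · intro hq u hu
      refine (htot u s).resolve_right fun h3 => hq ((h s h1 h2).1 (hC _ _ h3 hu))
  have hpiece : ∀ j, Dfn L M (fun x => O j x ∧ C x) := by
    intro j
    by_cases hne : ∃ o, O j o
    swap
    · push Not at hne
      exact (Dfn.const' False).congr fun x => propext ⟨fun h => hne x h.1, False.elim⟩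
    obtain ⟨o, ho⟩ := hne
    rcases not_not.1 ho.1 with h | h | h
    · -- constant
      have hc : ∀ x y, O j x → O j y → x < y → R y x ∧ R x y := by
        intro x y hx hy hxy
        exact glob_const hR htr hxy (fun z h1 h2 => (hsame j o z ho (hOc j x z y hx hy h1 h2)).1.1 h)
      rcases cut_or (hO j) (hOc j) (C := C) (by
        intro x y hx hy hxy hCy
        rcases hxy.lt_or_eq with h | rfl
        · exact hC _ _ (hc x y hx hy h).2 hCy
        · exact hCy) with h | ⟨T, s0, s1, hT, h⟩
      · exact h
      · exact (mkstar T s0 s1 hT ⟨T, Or.inl fun _ => Iff.rfl, h⟩).elim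
    · have hc : ∀ x y, O j x → O j y → x < y → R x y := by
        intro x y hx hy hxy
        exact (htot x y).resolve_right (glob_inc hR htr htot hxy (fun z h1 h2 => (hsame j o z ho (hOc j x z y hx hy h1 h2)).2.1.1 h))
      rcases cut_or (hO j) (hOc j) (C := C) (by
        intro x y hx hy hxy hCy
        rcases hxy.lt_or_eq with h | rfl
        · exact hC _ _ (hc x y hx hy h) hCy
        · exact hCy) with h | ⟨T, s0, s1, hT, h⟩
      · exact h
      · exact (mkstar T s0 s1 hT ⟨T, Or.inl fun _ => Iff.rfl, h⟩).elim
    · have hc : ∀ x y, O j x → O j y → x < y → R y x := by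
        intro x y hx hy hxy
        exact (htot x y).resolve_left (glob_inc (R := fun x y => R y x) (by fun_prop) (fun u v w h1 h2 => htr _ _ _ h2 h1) (fun u v => htot _ _) hxy (fun z h1 h2 => (hsame j o z ho (hOc j x z y hx hy h1 h2)).2.2.1 h))
      rcases cut_or (hO j) (hOc j) (C := fun x => ¬ C x) (by
        intro x y hx hy hxy hCy
        rcases hxy.lt_or_eq with h | rfl
        · exact fun h' => hCy (hC _ _ (hc x y hx hy h) h')
        · exact hCy) with h | ⟨T, s0, s1, hT, h⟩
      · exact Dfn.congr (f := fun x => O j x ∧ ¬ (O j x ∧ ¬ C x)) ((hO j).and' h.not') (fun x => propext (by tauto))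
      · exact (mkstar T s0 s1 hT ⟨fun s => ¬ T s, Or.inr fun _ => Iff.rfl, fun s h1 h2 => by show C s ↔ ¬ T s; rw [← h s h1 h2, not_not]⟩).elim
  have h1 : Dfn L M (fun x => F x ∧ C x) := Dfn.of_finite (hFf.subset fun x hx => hx.1)
  have h2 : Dfn L M (fun x => (F x ∧ C x) ∨ ∃ j : Fin ({x | F x}.ncard + 1), O j x ∧ C x) := 
    h1.or' (Dfn.fex' fun j => hpiece j)
  refine h2.congr fun x => propext ⟨fun hx => ?_, ?_⟩
  · by_cases h : F x
    · exact Or.inl ⟨h, hx⟩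
    · exact Or.inr ⟨⟨_, Nat.lt_succ_of_le (Set.ncard_le_ncard (s := {y | F y ∧ y < x}) (fun y hy => hy.1) hFf)⟩, ⟨h, rfl⟩, hx⟩
  · rintro (h | ⟨j, h⟩)
    · exact h.2
    · exact h.2

end MS

open FirstOrder Set
set_option linter.unusedVariables false
set_option linter.unusedSectionVars false
set_option linter.style.haveILetI false
set_option linter.unusedSimpArgs false
namespace MS

variable {L : Language} {M : Type*} [L.Structure M] [LinearOrder M] [DenselyOrdered M]
  [NoMinOrder M] [NoMaxOrder M] [Nonempty M] [OM L M]

theorem astat_succ {m : ℕ} (ih : AStat L M (Fin m → M)) : AStat L M (Fin (m+1) → M) := by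
  classical
  intro R hR htr htot C hC
  by_contra hcon
  push Not at hcon
  obtain ⟨hnd, hns⟩ := hcon
  have hrefl : ∀ u, R u u := fun u => (htot u u).elim id id
  -- slices definable
  have hCx : ∀ x, Dfn L M (fun c : Fin m → M => C (sn c x)) := by
    intro x
    have := (lift ih htot hC (D := fun c u => R u (sn c x)) (by fun_prop) 
      (fun d u v h1 h2 => htr _ _ _ h1 h2)).resolve_right hns
    refine this.congr fun c => propext ⟨fun h u hu => hC _ _ hu h, fun h => h _ (hrefl _)⟩
  let Lx : M → (Fin (m+1) → M) → Prop := fun x u => ∃ c, C (sn c x) ∧ R u (sn c x)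
  have hLx : ∀ x, Dfn L M (Lx x) := by
    intro x
    exact Dfn.ex' (P := fun u c => C (sn c x) ∧ R u (sn c x))
      (Dfn.and' (Dfn.comp' (f := fun c => C (sn c x)) (hCx x) (Dfn.snd' Dfn.id')) (by fun_prop))
  have hLxC : ∀ x u, Lx x u → C u := fun x u ⟨c, h1, h2⟩ => hC _ _ h2 h1
  have hex : ∀ x, ∃ u, C u ∧ ¬ Lx x u := by
    intro x
    by_contra hn
    push Not at hn
    exact hnd ((hLx x).congr fun u => propext ⟨hn u, hLxC x u⟩)
  let S : M → (Fin (m+1) → M) → (Fin (m+1) → M) → Prop := fun x u u' => 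
    ∀ c, R u (sn c x) ↔ R u' (sn c x)
  have hS : Dfn L M (fun p : M × (Fin (m+1) → M) × (Fin (m+1) → M) => S p.1 p.2.1 p.2.2) := by
    simp only [S, all_iff]; fun_prop
  have hSsymm : ∀ x u v, S x u v → S x v u := fun x u v h c => (h c).symm
  have hStr : ∀ x u v w, S x u v → S x v w → S x u w := fun x u v w h h' c => (h c).trans (h' c)
  have hLxS : ∀ x u v, S x u v → Lx x u → Lx x v := fun x u v h ⟨c, h1, h2⟩ => ⟨c, h1, (h c).1 h2⟩
  have hsingle : ∀ x u, C u → ¬ Lx x u → ∀ c, R u (sn c x) ↔ ¬ C (sn c x) := by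
    intro x u h1 h2 c
    constructor
    · intro h3 h4; exact h2 ⟨c, h4, h3⟩
    · intro h3
      exact (htot _ _).resolve_right fun h4 => h3 (hC _ _ h4 h1)
  have hfat : ∀ x u0, C u0 → ¬ Lx x u0 → Fat (m+1) (S x u0) := by
    intro x u0 h1 h2
    by_contra hnf
    have hK : Dfn L M (S x u0) := 
      Dfn.comp' hS (g := fun u => (x, u0, u)) (by fun_prop)
    obtain ⟨I, hI, T, hT, hST, hρ⟩ := NF (L := L) (fun k _ => uf k) hK hnf
    have hp : ∀ i, Dfn L M (fun v => T i v ∧ C v) := by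
      intro i
      obtain ⟨d, hd, ρ, hρ1, hρ2⟩ := hρ i
      obtain rfl : d = m := by omega
      have hTi := hT i
      have := (lift ih htot hC (D := fun w u => ∃ v, T i v ∧ ρ v = w ∧ R u v) (by fun_prop) 
        (fun d u v h1 ⟨w, h2, h3, h4⟩ => ⟨w, h2, h3, htr _ _ _ h1 h4⟩)).resolve_right hns
      refine Dfn.congr (hTi.and' (Dfn.comp' this hρ1)) fun v => propext ?_
      constructor
      · rintro ⟨h1, h2⟩
        refine ⟨h1, ?_⟩
        rintro u ⟨v', h3, h4, h5⟩
        rw [hρ2 _ _ h3 h1 h4] at h5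
        exact hC _ _ h5 h2
      · rintro ⟨h1, h2⟩
        exact ⟨h1, h2 v ⟨v, h1, rfl, hrefl _⟩⟩
    refine hnd (Dfn.congr ((hLx x).or' (Dfn.fex' hp)) fun u => propext ?_)
    constructor
    · intro hu
      by_cases hl : Lx x u
      · exact Or.inl hl
      · right
        have : S x u0 u := fun c => by rw [hsingle x u0 h1 h2, hsingle x u hu hl]
        obtain ⟨i, hi⟩ := (hST u).1 this
        exact ⟨i, hi, hu⟩
    · rintro (h | ⟨i, _, h⟩)
      · exact hLxC x u h
      · exact h
  obtain ⟨r, hr⟩ := FF (L := L) (Γ := M) (Λ := Fin (m+1) → M) (W := S) hS (E := S) 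
    (fun x l l' h u => ⟨fun h' => hStr _ _ _ _ (hSsymm _ _ _ h) h', fun h' => hStr _ _ _ _ h h'⟩) (k := 1)
    (fun x u g hg => ⟨0, 1, by simp, hStr _ _ _ _ (hg 0) (hSsymm _ _ _ (hg 1))⟩)
  let G : ℕ → M → (Fin (m+1) → M) → Prop := fun i x u => 
    ¬ ∃ g : Fin (i+1) → Fin (m+1) → M, (¬ ∃ j k, j ≠ k ∧ S x (g j) (g k)) ∧ ∀ j, Fat (m+1) (S x (g j)) ∧ 
      (R (g j) u ∨ S x (g j) u)
  have hG : ∀ i, Dfn L M (fun p : M × (Fin (m+1) → M) => G i p.1 p.2) := by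
    intro i
    -- uncurry
    let D : (M × (Fin (m+1) → M)) → (Fin (i+1) × Fin (m+1) → M) → Prop := fun p g => 
      (¬ ∃ j k, j ≠ k ∧ S p.1 (fun t => g (j, t)) (fun t => g (k, t))) ∧ 
      ∀ j, Fat (m+1) (S p.1 (fun t => g (j, t))) ∧ (R (fun t => g (j, t)) p.2 ∨ S p.1 (fun t => g (j,t)) p.2)
    have hD : Dfn L M (fun q : (M × (Fin (m+1) → M)) × (Fin (i+1) × Fin (m+1) → M) => D q.1 q.2) := by
      refine Dfn.and' (Dfn.not' (Dfn.fex' fun j => Dfn.fex' fun k => ?_)) (Dfn.fall' fun j => ?_)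
      · refine Dfn.and' (Dfn.const' _) ?_
        exact Dfn.comp' hS (g := fun q : (M × (Fin (m+1) → M)) × (Fin (i+1) × Fin (m+1) → M) => 
          (q.1.1, (fun t => q.2 (j, t)), (fun t => q.2 (k, t)))) (by fun_prop)
      · refine Dfn.and' (Dfn.fat' ?_) (Dfn.or' ?_ ?_)
        · exact Dfn.comp' hS (g := fun q : ((M × (Fin (m+1) → M)) × (Fin (i+1) × Fin (m+1) → M)) × (Fin (m+1) → M) => 
          (q.1.1.1, (fun t => q.1.2 (j, t)), q.2)) (by fun_prop)
        · exact Dfn.comp' hR (g := fun q : (M × (Fin (m+1) → M)) × (Fin (i+1) × Fin (m+1) → M) => 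
          ((fun t => q.2 (j, t)), q.1.2)) (by fun_prop)
        · exact Dfn.comp' hS (g := fun q : (M × (Fin (m+1) → M)) × (Fin (i+1) × Fin (m+1) → M) => 
          (q.1.1, (fun t => q.2 (j, t)), q.1.2)) (by fun_prop)
    refine Dfn.congr (Dfn.not' (Dfn.ex' hD)) fun p => propext (not_congr ?_)
    constructor
    · rintro ⟨g, hg⟩
      exact ⟨fun q => g q.1 q.2, hg⟩
    · rintro ⟨g, hg⟩
      exact ⟨fun j t => g (j, t), hg⟩
  have hGd : ∀ i x u v, R u v → G i x v → G i x u := by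
    rintro i x u v huv hv ⟨g, h1, h2⟩
    refine hv ⟨g, h1, fun j => ⟨(h2 j).1, ?_⟩⟩
    rcases (h2 j).2 with h | h
    · exact Or.inl (htr _ _ _ h huv)
    · by_cases hg : R (g j) v
      · exact Or.inl hg
      · right
        have h3 := (htot _ _).resolve_left hg
        intro c
        exact ⟨fun h4 => htr _ _ _ h3 h4, fun h4 => (h c).2 (htr _ _ _ huv h4)⟩
  have hmax : ∀ x, ∃ i, i < r + 1 ∧ (∀ u, Lx x u → G i x u) ∧ (∀ u, G i x u → C u) := by
    intro x
    let Pr : ℕ → Prop := fun i => ∃ g : Fin i → Fin (m+1) → M, (¬ ∃ j k, j ≠ k ∧ S x (g j) (g k)) ∧ 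
      ∀ j, Fat (m+1) (S x (g j)) ∧ Lx x (g j)
    have hP0 : Pr 0 := ⟨fun j => j.elim0, fun ⟨j, _⟩ => j.elim0, fun j => j.elim0⟩
    have hPr : ¬ Pr (r+1) := by
      rintro ⟨g, h1, h2⟩
      exact h1 (hr x g fun j => (h2 j).1)
    obtain ⟨i, hi1, hi2, hi3⟩ : ∃ i, i < r + 1 ∧ Pr i ∧ ¬ Pr (i+1) := by
      by_contra hn
      push Not at hn
      have : ∀ i, i ≤ r + 1 → Pr i := by
        intro i
        induction i with
        | zero => exact fun _ => hP0
        | succ i ih => exact fun h => hn i (by omega) (ih (by omega))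
      exact hPr (this _ le_rfl)
    refine ⟨i, hi1, ?_, ?_⟩
    · rintro u hu ⟨g, h1, h2⟩
      refine hi3 ⟨g, h1, fun j => ⟨(h2 j).1, ?_⟩⟩
      rcases (h2 j).2 with h | h
      · obtain ⟨c, h3, h4⟩ := hu
        exact ⟨c, h3, htr _ _ _ h h4⟩
      · exact hLxS _ _ _ (hSsymm _ _ _ h) hu
    · intro u hu
      by_contra hCu
      obtain ⟨g, h1, h2⟩ := hi2
      obtain ⟨u0, hu0, hu0'⟩ := hex x
      refine hu ⟨Fin.snoc (α := fun _ => Fin (m+1) → M) g u0, ?_, ?_⟩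
      · rintro ⟨j, k, hjk, hs⟩
        induction j using Fin.lastCases with
        | last => 
          induction k using Fin.lastCases with
          | last => exact hjk rfl
          | cast k => 
            simp only [Fin.snoc_last, Fin.snoc_castSucc] at hs
            exact hu0' (hLxS _ _ _ (hSsymm _ _ _ hs) (h2 k).2)
        | cast j =>
          induction k using Fin.lastCases with
          | last => 
            simp only [Fin.snoc_last, Fin.snoc_castSucc] at hs
            exact hu0' (hLxS _ _ _ hs (h2 j).2)
          | cast k => 
            simp only [Fin.snoc_last, Fin.snoc_castSucc] at hs
            exact h1 ⟨j, k, fun h => hjk (by rw [h]), hs⟩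
      · have hle : ∀ w, C w → R w u := fun w hw => (htot _ _).resolve_right fun h => hCu (hC _ _ h hw)
        intro j
        induction j using Fin.lastCases with
        | last => 
          simp only [Fin.snoc_last]
          exact ⟨hfat x u0 hu0 hu0', Or.inl (hle _ hu0)⟩
        | cast j =>
          simp only [Fin.snoc_castSucc]
          exact ⟨(h2 j).1, Or.inl (hle _ (hLxC _ _ (h2 j).2))⟩
  have hCi : ∀ i, Dfn L M (fun x => ∀ u, G i x u → C u) := fun i => 
    (lift astat_M htot hC (hG i) (hGd i)).resolve_right hns
  have hfin : Dfn L M (fun u => ∃ i : Fin (r+1), ∃ x, (∀ u, G i x u → C u) ∧ G i x u) := by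
    refine Dfn.fex' fun i => Dfn.ex' (Dfn.and' ?_ ?_)
    · exact Dfn.comp' (hCi i) (Dfn.snd' Dfn.id')
    · exact Dfn.comp' (hG i) (g := fun p : (Fin (m+1) → M) × M => (p.2, p.1)) (by fun_prop)
  refine hnd (hfin.congr fun u => propext ⟨fun hu => ?_, ?_⟩)
  · obtain ⟨i, hi, h1, h2⟩ := hmax (u (Fin.last m))
    refine ⟨⟨i, hi⟩, u (Fin.last m), h2, h1 u ⟨ini u, ?_, ?_⟩⟩
    · rw [sn_ini]; exact hu
    · rw [sn_ini]; exact hrefl _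
  · rintro ⟨i, x, h1, h2⟩
    exact h1 u h2

theorem astat (m : ℕ) : AStat L M (Fin m → M) := by
  induction m with
  | zero =>
    intro R hR htr htot C hC
    left
    exact (Dfn.const' (C (fun i => i.elim0))).congr fun x => by
      congr 1; exact Subsingleton.elim _ _
  | succ m ih => exact astat_succ ih

end MS

open FirstOrder Set
set_option linter.unusedVariables false
set_option linter.unusedSectionVars false
set_option linter.style.haveILetI false
set_option linter.unusedSimpArgs false
namespace MS

/-- two-sided contexts -/
class TC (L : Language) (M N : Type*) [L.Structure M] [L.Structure N] (X X' : Type*)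
    [Ctx L M X] [Ctx L N X'] where
  k : Type
  kf : Finite k
  e₁ : (k → M) ≃ X
  e₂ : (k → N) ≃ X'
  d₁ : Dfn L M e₁
  d₂ : Dfn L N e₂
  i₁ : Dfn L M e₁.symm
  i₂ : Dfn L N e₂.symm

section
variable {L : Language} {M N : Type*} [L.Structure M] [L.Structure N]

instance tcM : TC L M N M N where
  k := Unit
  kf := inferInstance
  e₁ := Equiv.funUnique Unit M
  e₂ := Equiv.funUnique Unit N
  d₁ := Dfn.apply' (X := M) ()
  d₂ := Dfn.apply' (X := N) ()
  i₁ := Dfn.pi' fun _ => Dfn.id'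
  i₂ := Dfn.pi' fun _ => Dfn.id'

instance tcU : TC L M N Unit Unit where
  k := Empty
  kf := inferInstance
  e₁ := Equiv.equivPUnit _
  e₂ := Equiv.equivPUnit _
  d₁ := Dfn.const' ()
  d₂ := Dfn.const' ()
  i₁ := Dfn.pi' fun i => Empty.elim i
  i₂ := Dfn.pi' fun i => Empty.elim i

instance tcPi {I : Type} [Finite I] : TC L M N (I → M) (I → N) where
  k := I
  kf := inferInstance
  e₁ := Equiv.refl _
  e₂ := Equiv.refl _
  d₁ := Dfn.id'
  d₂ := Dfn.id'
  i₁ := Dfn.id'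
  i₂ := Dfn.id'

def sumE (A B : Type) (Z X Y : Type*) (e : (A → Z) ≃ X) (e' : (B → Z) ≃ Y) : (A ⊕ B → Z) ≃ X × Y where
  toFun w := (e (fun i => w (Sum.inl i)), e' (fun i => w (Sum.inr i)))
  invFun p := Sum.elim (e.symm p.1) (e'.symm p.2)
  left_inv w := by
    simp only [Equiv.symm_apply_apply]
    funext i
    cases i <;> rfl
  right_inv p := by simp

instance tcProd {X X' Y Y' : Type*} [Ctx L M X] [Ctx L N X'] [Ctx L M Y] [Ctx L N Y'] [a : TC L M N X X'] [b : TC L M N Y Y'] : 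
    TC L M N (X × Y) (X' × Y') where
  k := a.k ⊕ b.k
  kf := by
    have := a.kf; have := b.kf; infer_instance
  e₁ := sumE _ _ _ _ _ a.e₁ b.e₁
  e₂ := sumE _ _ _ _ _ a.e₂ b.e₂
  d₁ := by
    have := a.kf; have := b.kf
    have h1 := a.d₁; have h2 := b.d₁
    exact Dfn.mk' (Dfn.comp' h1 (Dfn.pi' fun i => Dfn.apply' _)) 
      (Dfn.comp' h2 (Dfn.pi' fun i => Dfn.apply' _))
  d₂ := by
    have := a.kf; have := b.kf
    have h1 := a.d₂; have h2 := b.d₂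
    exact Dfn.mk' (Dfn.comp' h1 (Dfn.pi' fun i => Dfn.apply' _)) 
      (Dfn.comp' h2 (Dfn.pi' fun i => Dfn.apply' _))
  i₁ := by
    have := a.kf; have := b.kf
    have h1 := a.i₁; have h2 := b.i₁
    refine Dfn.pi' fun i => ?_
    rcases i with i | i
    · exact Dfn.comp' (Dfn.apply' i) (Dfn.comp' h1 (Dfn.fst' Dfn.id'))
    · exact Dfn.comp' (Dfn.apply' i) (Dfn.comp' h2 (Dfn.snd' Dfn.id'))
  i₂ := by
    have := a.kf; have := b.kf
    have h1 := a.i₂; have h2 := b.i₂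
    refine Dfn.pi' fun i => ?_
    rcases i with i | i
    · exact Dfn.comp' (Dfn.apply' i) (Dfn.comp' h1 (Dfn.fst' Dfn.id'))
    · exact Dfn.comp' (Dfn.apply' i) (Dfn.comp' h2 (Dfn.snd' Dfn.id'))

variable {X X' Y Y' Z Z' : Type*} [Ctx L M X] [Ctx L N X'] [Ctx L M Y] [Ctx L N Y'] 
  [Ctx L M Z] [Ctx L N Z'] [TC L M N X X'] [TC L M N Y Y'] [TC L M N Z Z']

abbrev tE₁ (L : Language) (M : Type*) (N : Type*) [L.Structure M] [L.Structure N] (X : Type*) (X' : Type*) 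
    [Ctx L M X] [Ctx L N X'] [TC L M N X X'] : (TC.k L M N X X' → M) ≃ X := TC.e₁
abbrev tE₂ (L : Language) (M : Type*) (N : Type*) [L.Structure M] [L.Structure N] (X : Type*) (X' : Type*) 
    [Ctx L M X] [Ctx L N X'] [TC L M N X X'] : (TC.k L M N X X' → N) ≃ X' := TC.e₂

/-- transfer relation for predicates -/
def Tr (f : M ↪ₑ[L] N) (P : X → Prop) (P' : X' → Prop) : Prop :=
  ∃ φ : L.Formula (M ⊕ TC.k L M N X X'), 
    (∀ w, P (tE₁ L M N X X' w) ↔ φ.Realize (Sum.elim id w)) ∧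
    (∀ w, P' (tE₂ L M N X X' w) ↔ φ.Realize (Sum.elim f w))

/-- transfer relation for substitutions -/
def Ts (f : M ↪ₑ[L] N) (g : X → Y) (g' : X' → Y') : Prop :=
  ∃ σ : TC.k L M N Y Y' → M ⊕ TC.k L M N X X',
    (∀ w, (tE₁ L M N Y Y').symm (g (tE₁ L M N X X' w)) = (Sum.elim id w) ∘ σ) ∧
    (∀ w, (tE₂ L M N Y Y').symm (g' (tE₂ L M N X X' w)) = (Sum.elim f w) ∘ σ)

variable {f : M ↪ₑ[L] N}

def emb (f : M ↪ₑ[L] N) (X X' : Type*) [Ctx L M X] [Ctx L N X'] [TC L M N X X'] (x : X) : X' :=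
  tE₂ L M N X X' (f ∘ (tE₁ L M N X X').symm x)

@[simp] theorem emb_M (x : M) : emb f M N x = f x := rfl
@[simp] theorem emb_pi {I : Type} [Finite I] (x : I → M) : emb f (I → M) (I → N) x = f ∘ x := rfl
@[simp] theorem emb_prod (x : X × Y) : emb f (X × Y) (X' × Y') x = (emb f X X' x.1, emb f Y Y' x.2) := rfl

namespace Tr

theorem congr {P Q : X → Prop} {P' Q' : X' → Prop} (h : Tr f P P') (h1 : ∀ x, Q x ↔ P x) 
    (h2 : ∀ x, Q' x ↔ P' x) : Tr f Q Q' := by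
  obtain ⟨φ, a, b⟩ := h
  exact ⟨φ, fun w => (h1 _).trans (a w), fun w => (h2 _).trans (b w)⟩

theorem and {P Q : X → Prop} {P' Q' : X' → Prop} (h : Tr f P P') (h' : Tr f Q Q') :
    Tr f (fun x => P x ∧ Q x) (fun x => P' x ∧ Q' x) := by
  obtain ⟨φ, a, b⟩ := h
  obtain ⟨ψ, c, d⟩ := h'
  exact ⟨φ ⊓ ψ, fun w => by rw [Language.Formula.realize_inf, ← a, ← c], 
    fun w => by rw [Language.Formula.realize_inf, ← b, ← d]⟩

theorem not {P : X → Prop} {P' : X' → Prop} (h : Tr f P P')  :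
    Tr f (fun x => ¬ P x) (fun x => ¬ P' x) := by
  obtain ⟨φ, a, b⟩ := h
  exact ⟨φ.not, fun w => by rw [Language.Formula.realize_not, ← a], 
    fun w => by rw [Language.Formula.realize_not, ← b]⟩

theorem imp {P Q : X → Prop} {P' Q' : X' → Prop} (h : Tr f P P') (h' : Tr f Q Q') :
    Tr f (fun x => P x → Q x) (fun x => P' x → Q' x) :=
  (h.and h'.not).not.congr (fun x => by simp) (fun x => by simp)

theorem or {P Q : X → Prop} {P' Q' : X' → Prop} (h : Tr f P P') (h' : Tr f Q Q') :
    Tr f (fun x => P x ∨ Q x) (fun x => P' x ∨ Q' x) :=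
  (h.not.imp h').congr (fun x => by tauto) (fun x => by tauto)

theorem iff {P Q : X → Prop} {P' Q' : X' → Prop} (h : Tr f P P') (h' : Tr f Q Q') :
    Tr f (fun x => P x ↔ Q x) (fun x => P' x ↔ Q' x) :=
  ((h.imp h').and (h'.imp h)).congr (fun x => by tauto) (fun x => by tauto)

theorem const (p : Prop) : Tr f (fun _ : X => p) (fun _ : X' => p) := by
  by_cases hp : p
  · exact ⟨⊤, fun w => by simp [hp], fun w => by simp [hp]⟩
  · exact ⟨⊥, fun w => by simp [hp], fun w => by simp [hp]⟩

theorem ex {P : X → Y → Prop} {P' : X' → Y' → Prop} 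
    (h : Tr f (fun p : X × Y => P p.1 p.2) (fun p : X' × Y' => P' p.1 p.2)) :
    Tr f (fun x => ∃ y, P x y) (fun x => ∃ y, P' x y) := by
  obtain ⟨φ, a, b⟩ := h
  have : Finite (TC.k L M N Y Y') := TC.kf
  let ψ : L.Formula ((M ⊕ TC.k L M N X X') ⊕ TC.k L M N Y Y') := 
    φ.relabel (fun z => (Equiv.sumAssoc _ _ _).symm z)
  refine ⟨ψ.iExs _, fun w => ?_, fun w => ?_⟩
  · rw [Language.Formula.realize_iExs]
    refine Iff.trans (tE₁ L M N Y Y').surjective.exists ?_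
    refine exists_congr fun u => ?_
    rw [Language.Formula.realize_relabel]
    refine (a (Sum.elim w u)).trans (iff_of_eq (congrArg _ ?_))
    funext z
    rcases z with z | z | z <;> rfl
  · rw [Language.Formula.realize_iExs]
    refine Iff.trans (tE₂ L M N Y Y').surjective.exists ?_
    refine exists_congr fun u => ?_
    rw [Language.Formula.realize_relabel]
    refine (b (Sum.elim w u)).trans (iff_of_eq (congrArg _ ?_))
    funext z
    rcases z with z | z | z <;> rfl

theorem all {P : X → Y → Prop} {P' : X' → Y' → Prop} 
    (h : Tr f (fun p : X × Y => P p.1 p.2) (fun p : X' × Y' => P' p.1 p.2)) :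
    Tr f (fun x => ∀ y, P x y) (fun x => ∀ y, P' x y) :=
  (ex (P := fun x y => ¬ P x y) (P' := fun x y => ¬ P' x y) h.not).not.congr 
    (fun x => by simp) (fun x => by simp)

theorem sub {P : Y → Prop} {P' : Y' → Prop} (h : Tr f P P') {g : X → Y} {g' : X' → Y'} (hg : Ts f g g') :
    Tr f (fun x => P (g x)) (fun x => P' (g' x)) := by
  obtain ⟨φ, a, b⟩ := h
  obtain ⟨σ, c, d⟩ := hg
  refine ⟨φ.relabel (Sum.elim Sum.inl σ), fun w => ?_, fun w => ?_⟩
  · rw [Language.Formula.realize_relabel]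
    have := a ((tE₁ L M N Y Y').symm (g (tE₁ L M N X X' w)))
    rw [Equiv.apply_symm_apply] at this
    refine this.trans ?_
    rw [c]
    refine (iff_of_eq (congrArg _ ?_))
    funext z
    rcases z with z | z <;> rfl
  · rw [Language.Formula.realize_relabel]
    have := b ((tE₂ L M N Y Y').symm (g' (tE₂ L M N X X' w)))
    rw [Equiv.apply_symm_apply] at this
    refine this.trans ?_
    rw [d]
    refine (iff_of_eq (congrArg _ ?_))
    funext z
    rcases z with z | z <;> rfl

theorem fall {I : Type*} [Finite I] {P : X → I → Prop} {P' : X' → I → Prop} 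
    (h : ∀ i, Tr f (fun x => P x i) (fun x => P' x i)) :
    Tr f (fun x => ∀ i, P x i) (fun x => ∀ i, P' x i) := by
  classical
  cases nonempty_fintype I
  have : ∀ s : Finset I, Tr f (fun x => ∀ i ∈ s, P x i) (fun x => ∀ i ∈ s, P' x i) := by
    intro s
    induction s using Finset.induction_on with
    | empty => exact (const True).congr (by simp) (by simp)
    | insert a s _ ih => exact ((h a).and ih).congr (by simp) (by simp)
  exact (this Finset.univ).congr (by simp) (by simp)

theorem elem {P : X → Prop} {P' : X' → Prop} (h : Tr f P P') (x : X) : P' (emb f X X' x) ↔ P x := by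
  obtain ⟨φ, a, b⟩ := h
  have := a ((tE₁ L M N X X').symm x)
  rw [Equiv.apply_symm_apply] at this
  rw [this, emb, b, ← f.map_formula]
  refine (iff_of_eq (congrArg _ ?_))
  funext z
  rcases z with z | z <;> rfl

theorem dfn₁ {P : X → Prop} {P' : X' → Prop} (h : Tr f P P') : Dfn L M P := by
  obtain ⟨φ, a, b⟩ := h
  have : Finite (TC.k L M N X X') := TC.kf
  have : Dfn L M (fun w => P (tE₁ L M N X X' w)) := by
    rw [dfn_iff_definable, DP, Set.definable_iff_exists_formula_sum]
    refine ⟨φ.relabel (Sum.map (fun x => ⟨x, trivial⟩) id), ?_⟩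
    ext w
    rw [Set.mem_setOf_eq, Set.mem_setOf_eq, Language.Formula.realize_relabel, a]
    refine (iff_of_eq (congrArg _ ?_))
    funext z
    rcases z with z | z <;> rfl
  exact (Dfn.comp' (f := (fun w => P (tE₁ L M N X X' w))) this (TC.i₁ (L := L) (N := N) (X' := X'))).congr fun x => by simp

theorem dfn₂ {P : X → Prop} {P' : X' → Prop} (h : Tr f P P') : Dfn L N P' := by
  obtain ⟨φ, a, b⟩ := h
  have : Finite (TC.k L M N X X') := TC.kf
  have : Dfn L N (fun w => P' (tE₂ L M N X X' w)) := by
    rw [dfn_iff_definable, DP, Set.definable_iff_exists_formula_sum]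
    refine ⟨φ.relabel (Sum.map (fun x => ⟨f x, trivial⟩) id), ?_⟩
    ext w
    rw [Set.mem_setOf_eq, Set.mem_setOf_eq, Language.Formula.realize_relabel, b]
    refine (iff_of_eq (congrArg _ ?_))
    funext z
    rcases z with z | z <;> rfl
  exact (Dfn.comp' (f := (fun w => P' (tE₂ L M N X X' w))) this (TC.i₂ (L := L) (M := M) (X := X))).congr fun x => by simp

theorem of_dfn {P : X → Prop} (hP : Dfn L M P) : ∃ P' : X' → Prop, Tr f P P' := by
  have : Finite (TC.k L M N X X') := TC.kf
  have h1 : Dfn L M (fun w => P (tE₁ L M N X X' w)) := Dfn.comp' hP TC.d₁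
  rw [dfn_iff_definable, DP, Set.definable_iff_exists_formula_sum] at h1
  obtain ⟨φ, h⟩ := h1
  let ψ : L.Formula (M ⊕ TC.k L M N X X') := φ.relabel (Sum.map (fun x => x.1) id)
  refine ⟨fun x => ψ.Realize (Sum.elim f ((tE₂ L M N X X').symm x)), ψ, fun w => ?_, fun w => by simp⟩
  rw [Set.ext_iff] at h
  refine (h w).trans ?_
  rw [Set.mem_setOf_eq, Language.Formula.realize_relabel]
  refine (iff_of_eq (congrArg _ ?_))
  funext z
  rcases z with z | z <;> rfl

/-- an `N`-definable set is a fibre of an `M`-definable one -/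
theorem of_dfn₂ (f : M ↪ₑ[L] N) {G : X' → Prop} (hG : Dfn L N G) : ∃ (k : ℕ) (c : Fin k → N) (Γ : (Fin k → M) × X → Prop) 
    (Γ' : (Fin k → N) × X' → Prop), Tr f Γ Γ' ∧ ∀ x, G x ↔ Γ' (c, x) := by
  classical
  have : Finite (TC.k L M N X X') := TC.kf
  have h1 : Dfn L N (fun w => G (tE₂ L M N X X' w)) := Dfn.comp' hG TC.d₂
  rw [dfn_iff_definable, DP, Set.definable_iff_finitely_definable] at h1
  obtain ⟨A0, -, h1⟩ := h1
  rw [Set.definable_iff_exists_formula_sum] at h1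
  obtain ⟨φ, h⟩ := h1
  let e : A0 ≃ Fin A0.card := A0.equivFin
  let ψ : L.Formula (M ⊕ (Fin A0.card ⊕ TC.k L M N X X')) := φ.relabel (Sum.inr ∘ Sum.map e id)
  refine ⟨A0.card, fun i => (e.symm i).1, 
    fun p => ψ.Realize (Sum.elim id ((tE₁ L M N ((Fin A0.card → M) × X) ((Fin A0.card → N) × X')).symm p)), 
    fun p => ψ.Realize (Sum.elim f ((tE₂ L M N ((Fin A0.card → M) × X) ((Fin A0.card → N) × X')).symm p)), 
    ⟨ψ, fun w => by simp, fun w => by simp⟩, ?_⟩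
  intro x
  obtain ⟨w, rfl⟩ := (tE₂ L M N X X').surjective x
  rw [Set.ext_iff] at h
  refine (h w).trans ?_
  rw [Set.mem_setOf_eq]
  refine Iff.trans ?_ (Language.Formula.realize_relabel).symm
  refine (iff_of_eq (congrArg _ ?_))
  funext z
  rcases z with z | z
  · have : z = e.symm (e z) := by simp
    exact congrArg Subtype.val this
  · have : w = (tE₂ L M N X X').symm ((tE₂ L M N X X') w) := by simp
    exact congrFun this z

end Tr

namespace Ts
theorem id : Ts f (fun x : X => x) (fun x : X' => x) := 
  ⟨Sum.inr, fun w => by simp, fun w => by simp⟩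
theorem fst {g : X → Y × Z} {g' : X' → Y' × Z'} (h : Ts f g g') : 
    Ts f (fun x => (g x).1) (fun x => (g' x).1) := by
  obtain ⟨σ, a, b⟩ := h
  refine ⟨fun i => σ (Sum.inl i), fun w => ?_, fun w => ?_⟩
  · have := a w
    funext i; exact congrFun this (Sum.inl i)
  · have := b w
    funext i; exact congrFun this (Sum.inl i)
theorem snd {g : X → Y × Z} {g' : X' → Y' × Z'} (h : Ts f g g') : 
    Ts f (fun x => (g x).2) (fun x => (g' x).2) := by
  obtain ⟨σ, a, b⟩ := h
  refine ⟨fun i => σ (Sum.inr i), fun w => ?_, fun w => ?_⟩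
  · have := a w
    funext i; exact congrFun this (Sum.inr i)
  · have := b w
    funext i; exact congrFun this (Sum.inr i)
theorem mk {g : X → Y} {g' : X' → Y'} {h : X → Z} {h' : X' → Z'} (hg : Ts f g g') (hh : Ts f h h') : 
    Ts f (fun x => (g x, h x)) (fun x => (g' x, h' x)) := by
  obtain ⟨σ, a, b⟩ := hg
  obtain ⟨τ, c, d⟩ := hh
  refine ⟨Sum.elim σ τ, fun w => ?_, fun w => ?_⟩
  · funext i
    rcases i with i | i
    · exact congrFun (a w) i
    · exact congrFun (c w) i
  · funext i
    rcases i with i | i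
    · exact congrFun (b w) i
    · exact congrFun (d w) i
theorem ap {I : Type} [Finite I] {g : X → I → M} {g' : X' → I → N} (h : Ts f g g') (i : I) : 
    Ts f (fun x => g x i) (fun x => g' x i) := by
  obtain ⟨σ, a, b⟩ := h
  refine ⟨fun _ => σ i, fun w => ?_, fun w => ?_⟩
  · have := a w
    funext _; exact congrFun this i
  · have := b w
    funext _; exact congrFun this i
theorem pi {I : Type} [Finite I] {g : X → I → M} {g' : X' → I → N} 
    (h : ∀ i, Ts f (fun x => g x i) (fun x => g' x i)) : Ts f g g' := by
  choose σ a b using h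
  refine ⟨fun i => σ i (), fun w => ?_, fun w => ?_⟩
  · funext i; exact congrFun (a i w) ()
  · funext i; exact congrFun (b i w) ()
theorem cst (y : Y) : Ts f (fun _ : X => y) (fun _ : X' => emb f Y Y' y) := by
  refine ⟨fun i => Sum.inl ((tE₁ L M N Y Y').symm y i), fun w => ?_, fun w => ?_⟩
  · funext i; rfl
  · funext i; simp [emb]
theorem cs (c : M) : Ts f (fun _ : X => c) (fun _ : X' => f c) := cst c
theorem sn {m : ℕ} {c : X → Fin m → M} {c' : X' → Fin m → N} {t : X → M} {t' : X' → N} 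
    (hc : Ts f c c') (ht : Ts f t t') : Ts f (fun x => sn (c x) (t x)) (fun x => MS.sn (c' x) (t' x)) := by
  refine pi fun i => ?_
  induction i using Fin.lastCases with
  | last => simpa using ht
  | cast i => simpa using hc.ap i
theorem ini {m : ℕ} {c : X → Fin (m+1) → M} {c' : X' → Fin (m+1) → N} (hc : Ts f c c') : 
    Ts f (fun x => ini (c x)) (fun x => MS.ini (c' x)) := by
  refine pi fun i => ?_
  exact hc.ap _
end Ts

namespace Tr
theorem eq {s t : X → M} {s' t' : X' → N} (h : Ts f s s') (h' : Ts f t t') :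
    Tr f (fun x => s x = t x) (fun x => s' x = t' x) := by
  have : Tr f (fun x : M × M => x.1 = x.2) (fun x : N × N => x.1 = x.2) := by
    refine ⟨(Language.Term.var (Sum.inr (Sum.inl ()))).equal (Language.Term.var (Sum.inr (Sum.inr ()))), ?_, ?_⟩
    · intro w; rw [Language.Formula.realize_equal]; rfl
    · intro w; rw [Language.Formula.realize_equal]; rfl
  exact this.sub (h.mk h')
end Tr
end
end MS

open FirstOrder Set
set_option linter.unusedVariables false
set_option linter.unusedSectionVars false
set_option linter.style.haveILetI false
set_option linter.unusedSimpArgs false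
namespace MS

/-- boundary points -/
def Bd {α : Type*} [LT α] (A : α → Prop) (x : α) : Prop :=
  ¬ ∃ a b, a < x ∧ x < b ∧ ((∀ y, a < y → y < b → A y) ∨ (∀ y, a < y → y < b → ¬ A y))

section
variable {L : Language} {M N : Type*} [L.Structure M] [L.Structure N] [LinearOrder M] [LinearOrder N]
variable {X X' Y Y' Z Z' : Type*} [Ctx L M X] [Ctx L N X'] [Ctx L M Y] [Ctx L N Y'] 
  [Ctx L M Z] [Ctx L N Z'] [TC L M N X X'] [TC L M N Y Y'] [TC L M N Z Z']

class TL (f : M ↪ₑ[L] N) : Prop where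
  lt : Tr f (fun x : M × M => x.1 < x.2) (fun x : N × N => x.1 < x.2)

variable {f : M ↪ₑ[L] N} [hf : TL f]

theorem Tr.lt {s t : X → M} {s' t' : X' → N} (h : Ts f s s') (h' : Ts f t t') :
    Tr f (fun x => s x < t x) (fun x => s' x < t' x) := TL.lt.sub (h.mk h')
theorem Tr.le {s t : X → M} {s' t' : X' → N} (h : Ts f s s') (h' : Ts f t t') :
    Tr f (fun x => s x ≤ t x) (fun x => s' x ≤ t' x) := 
  (Tr.lt h' h).not.congr (fun x => by simp) (fun x => by simp)

theorem Tr.forall_iff {P : X → Prop} {P' : X' → Prop} (h : Tr f P P') : (∀ x, P' x) ↔ ∀ x, P x := by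
  have : Tr f (fun _ : Unit => ∀ x, P x) (fun _ : Unit => ∀ x, P' x) := 
    Tr.all (h.sub (Ts.snd Ts.id))
  exact this.elem ()
theorem Tr.exists_iff {P : X → Prop} {P' : X' → Prop} (h : Tr f P P') : (∃ x, P' x) ↔ ∃ x, P x := by
  have := h.not.forall_iff
  rw [← not_iff_not]; simpa using this

theorem tr_bd {A : X → M → Prop} {A' : X' → N → Prop} 
    (h : Tr f (fun p : X × M => A p.1 p.2) (fun p : X' × N => A' p.1 p.2)) : 
    Tr f (fun p : X × M => Bd (A p.1) p.2) (fun p : X' × N => Bd (A' p.1) p.2) := by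
  unfold Bd
  refine Tr.not (Tr.ex (Tr.ex (Tr.and (Tr.lt ?_ ?_) (Tr.and (Tr.lt ?_ ?_) 
    (Tr.or (Tr.all (Tr.imp (Tr.lt ?_ ?_) (Tr.imp (Tr.lt ?_ ?_) ?_))) 
     (Tr.all (Tr.imp (Tr.lt ?_ ?_) (Tr.imp (Tr.lt ?_ ?_) (Tr.not ?_)))))))))
  · exact Ts.id.fst.snd
  · exact Ts.id.fst.fst.snd
  · exact Ts.id.fst.fst.snd
  · exact Ts.id.snd
  · exact Ts.id.fst.fst.snd
  · exact Ts.id.snd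
  · exact Ts.id.snd
  · exact Ts.id.fst.snd
  · exact h.sub (Ts.id.fst.fst.fst.fst.mk Ts.id.snd)
  · exact Ts.id.fst.fst.snd
  · exact Ts.id.snd
  · exact Ts.id.snd
  · exact Ts.id.fst.snd
  · exact h.sub (Ts.id.fst.fst.fst.fst.mk Ts.id.snd)

theorem tr_al {A : X → M → Prop} {A' : X' → N → Prop} (k : ℕ)
    (h : Tr f (fun p : X × M => A p.1 p.2) (fun p : X' × N => A' p.1 p.2)) : 
    Tr f (fun x => AL k (A x)) (fun x => AL k (A' x)) := by
  unfold AL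
  refine Tr.ex (Tr.and (Tr.fall fun i => Tr.fall fun j => Tr.imp (Tr.const _) (Tr.lt ?_ ?_)) (Tr.fall fun i => ?_))
  · exact Ts.id.snd.ap _
  · exact Ts.id.snd.ap _
  · exact h.sub (Ts.id.fst.mk (Ts.id.snd.ap i))

theorem al_of_infinite {α : Type*} [LinearOrder α] {A : α → Prop} (h : {x | A x}.Infinite) (k : ℕ) : AL k A := by
  obtain ⟨t, ht, hk⟩ := h.exists_subset_card_eq k
  let o := t.orderEmbOfFin hk
  exact ⟨o, fun i j hij => o.strictMono hij, fun i => ht (t.orderEmbOfFin_mem hk i)⟩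

theorem tr_dense [DenselyOrdered M] (hf : TL f) : DenselyOrdered N := by
  have : Tr f (fun p : M × M => p.1 < p.2 → ∃ c, p.1 < c ∧ c < p.2) 
    (fun p : N × N => p.1 < p.2 → ∃ c, p.1 < c ∧ c < p.2) :=
    Tr.imp (Tr.lt Ts.id.fst Ts.id.snd) (Tr.ex (Tr.and (Tr.lt Ts.id.fst.fst Ts.id.snd) 
      (Tr.lt Ts.id.snd Ts.id.fst.snd)))
  exact ⟨fun a b h => this.forall_iff.2 (fun p h => exists_between h) (a, b) h⟩
theorem tr_nomin [NoMinOrder M] (hf : TL f) : NoMinOrder N := by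
  have : Tr f (fun p : M => ∃ c, c < p) (fun p : N => ∃ c, c < p) :=
    Tr.ex (Tr.lt Ts.id.snd Ts.id.fst)
  exact ⟨fun a => this.forall_iff.2 exists_lt a⟩
theorem tr_nomax [NoMaxOrder M] (hf : TL f) : NoMaxOrder N := by
  have : Tr f (fun p : M => ∃ c, p < c) (fun p : N => ∃ c, p < c) :=
    Tr.ex (Tr.lt Ts.id.fst Ts.id.snd)
  exact ⟨fun a => this.forall_iff.2 exists_gt a⟩

variable  [DenselyOrdered M] [NoMinOrder M] [NoMaxOrder M] [Nonempty M] [OM L M]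

theorem dfn_bd {X : Type*} [Obj L M X] {A : X → M → Prop} (hA : Dfn L M (fun p : X × M => A p.1 p.2)) : 
    Dfn L M (fun p : X × M => Bd (A p.1) p.2) := by
  unfold Bd
  simp only [all_iff, imp_iff_not_or]; fun_prop

theorem tr_om (hf : TL f) : OM L N where
  lt := hf.lt.dfn₂
  fin := by
    intro A hA
    obtain ⟨k, c, Γ, Γ', hT, hG⟩ := Tr.of_dfn₂ (X := M) f hA
    obtain rfl : A = fun y => Γ' (c, y) := funext fun y => propext (hG y)
    have hT' : Tr f (fun p : (Fin k → M) × M => Γ (p.1, p.2)) (fun p : (Fin k → N) × N => Γ' (p.1, p.2)) := hT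
    have h1 := tr_bd (A := fun c y => Γ (c, y)) (A' := fun c y => Γ' (c, y)) hT'
    obtain ⟨K, hK⟩ := ufc (Z := fun (c : Fin k → M) y => Bd (fun y => Γ (c, y)) y) h1.dfn₁ 
      (fun v => OM.fin (L := L) (fun y => Γ (v, y)) (Dfn.comp' hT.dfn₁ (by fun_prop)))
    by_contra hinf
    have h2 := (tr_al (A := fun c y => Bd (fun y => Γ (c, y)) y) (A' := fun c y => Bd (fun y => Γ' (c, y)) y) (K+1) h1).not
    refine h2.forall_iff.2 ?_ c (al_of_infinite hinf _)
    intro v hv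
    have hv := (AL_iff (A := fun y => Bd (fun y => Γ (v, y)) y) 
      (OM.fin (L := L) (fun y => Γ (v, y)) (Dfn.comp' hT.dfn₁ (by fun_prop))) (K+1)).1 hv
    have := hK v
    omega
  lub := by
    intro A hA h1 h2
    obtain ⟨k, c, Γ, Γ', hT, hG⟩ := Tr.of_dfn₂ (X := M) f hA
    obtain rfl : A = fun y => Γ' (c, y) := funext fun y => propext (hG y)
    have : Tr f (fun c : Fin k → M => (∃ x, Γ (c, x)) → (∃ b, ∀ x, Γ (c, x) → x ≤ b) → 
        ∃ s, (∀ x, Γ (c, x) → x ≤ s) ∧ ∀ b, (∀ x, Γ (c, x) → x ≤ b) → s ≤ b)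
       (fun c : Fin k → N => (∃ x, Γ' (c, x)) → (∃ b, ∀ x, Γ' (c, x) → x ≤ b) → 
        ∃ s, (∀ x, Γ' (c, x) → x ≤ s) ∧ ∀ b, (∀ x, Γ' (c, x) → x ≤ b) → s ≤ b) := by
      refine Tr.imp (Tr.ex (hT.sub (Ts.id.fst.mk Ts.id.snd))) (Tr.imp (Tr.ex (Tr.all (Tr.imp (hT.sub (Ts.id.fst.fst.mk Ts.id.snd)) 
        (Tr.le Ts.id.snd Ts.id.fst.snd)))) (Tr.ex (Tr.and (Tr.all (Tr.imp (hT.sub (Ts.id.fst.fst.mk Ts.id.snd)) 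
        (Tr.le Ts.id.snd Ts.id.fst.snd))) (Tr.all (Tr.imp (Tr.all (Tr.imp (hT.sub (Ts.id.fst.fst.fst.mk Ts.id.snd)) 
        (Tr.le Ts.id.snd Ts.id.fst.snd))) (Tr.le Ts.id.fst.snd Ts.id.snd))))))
    obtain ⟨s, h3, h4⟩ := this.forall_iff.2 (by
      intro v h1 h2
      obtain ⟨s, h3, h4⟩ := OM.lub (L := L) (fun y => Γ (v, y)) (Dfn.comp' hT.dfn₁ (by fun_prop)) h1 h2
      exact ⟨s, fun x hx => h3 hx, fun b hb => h4 hb⟩) c h1 h2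
    exact ⟨s, fun x hx => h3 x hx, fun b hb => h4 b hb⟩
  glb := by
    intro A hA h1 h2
    obtain ⟨k, c, Γ, Γ', hT, hG⟩ := Tr.of_dfn₂ (X := M) f hA
    obtain rfl : A = fun y => Γ' (c, y) := funext fun y => propext (hG y)
    have : Tr f (fun c : Fin k → M => (∃ x, Γ (c, x)) → (∃ b, ∀ x, Γ (c, x) → b ≤ x) → 
        ∃ s, (∀ x, Γ (c, x) → s ≤ x) ∧ ∀ b, (∀ x, Γ (c, x) → b ≤ x) → b ≤ s)
       (fun c : Fin k → N => (∃ x, Γ' (c, x)) → (∃ b, ∀ x, Γ' (c, x) → b ≤ x) → 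
        ∃ s, (∀ x, Γ' (c, x) → s ≤ x) ∧ ∀ b, (∀ x, Γ' (c, x) → b ≤ x) → b ≤ s) := by
      refine Tr.imp (Tr.ex (hT.sub (Ts.id.fst.mk Ts.id.snd))) (Tr.imp (Tr.ex (Tr.all (Tr.imp (hT.sub (Ts.id.fst.fst.mk Ts.id.snd)) 
        (Tr.le Ts.id.fst.snd Ts.id.snd)))) (Tr.ex (Tr.and (Tr.all (Tr.imp (hT.sub (Ts.id.fst.fst.mk Ts.id.snd)) 
        (Tr.le Ts.id.fst.snd Ts.id.snd))) (Tr.all (Tr.imp (Tr.all (Tr.imp (hT.sub (Ts.id.fst.fst.fst.mk Ts.id.snd)) 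
        (Tr.le Ts.id.fst.snd Ts.id.snd))) (Tr.le Ts.id.snd Ts.id.fst.snd))))))
    obtain ⟨s, h3, h4⟩ := this.forall_iff.2 (by
      intro v h1 h2
      obtain ⟨s, h3, h4⟩ := OM.glb (L := L) (fun y => Γ (v, y)) (Dfn.comp' hT.dfn₁ (by fun_prop)) h1 h2
      exact ⟨s, fun x hx => h3 hx, fun b hb => h4 hb⟩) c h1 h2
    exact ⟨s, fun x hx => h3 x hx, fun b hb => h4 b hb⟩

end
end MS

open FirstOrder Set
set_option linter.unusedVariables false
set_option linter.unusedSectionVars false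
set_option linter.style.haveILetI false
set_option linter.unusedSimpArgs false
namespace MS

/-- initial convex component -/
def IC {α : Type*} [LinearOrder α] (A : α → Prop) (y : α) : Prop :=
  A y ∧ ∀ z, A z → z < y → ∀ w, z ≤ w → w ≤ y → A w

section one
variable {L : Language} {M : Type*} [L.Structure M] [LinearOrder M] [DenselyOrdered M]
  [NoMinOrder M] [NoMaxOrder M] [Nonempty M] [OM L M]

theorem IC.convex {A : M → Prop} {x y z : M} (hx : IC A x) (hz : IC A z) (h1 : x ≤ y) (h2 : y ≤ z) : IC A y := by
  rcases h1.eq_or_lt with rfl | h1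
  · exact hx
  have hy : A y := hz.2 x hx.1 (h1.trans_le h2) y h1.le h2
  exact ⟨hy, fun w hw hwy v h3 h4 => hz.2 w hw (hwy.trans_le h2) v h3 (h4.trans h2)⟩

theorem IC.nonempty {A : M → Prop} (hA : Dfn L M A) (hx : ∃ x, A x) : ∃ y, IC A y := by
  obtain ⟨b, h | h⟩ := @top_const L M _ (dualLO M) dualDense dualMin dualMax _ OM.dual A hA
  · change ∀ y, y < b → A y at h
    obtain ⟨y, hy⟩ := exists_lt b
    exact ⟨y, h y hy, fun z _ _ w _ h4 => h w (h4.trans_lt hy)⟩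
  · change ∀ y, y < b → ¬ A y at h
    obtain ⟨s, hs⟩ := OM.glb (L := L) A hA hx ⟨b, fun x hx => not_lt.1 fun h1 => h x h1 hx⟩
    by_cases hAs : A s
    · exact ⟨s, hAs, fun z hz hzs => absurd (hs.1 hz) (not_le.2 hzs)⟩
    obtain ⟨b', hb, h1 | h1⟩ := right_const hA s
    · obtain ⟨y, hy1, hy2⟩ := exists_between hb
      refine ⟨y, h1 y hy1 hy2, fun z hz hzy w hw1 hw2 => h1 w ?_ (hw2.trans_lt hy2)⟩
      have : s ≤ z := hs.1 hz
      rcases this.eq_or_lt with rfl | h3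
      · exact absurd hz hAs
      · exact h3.trans_le hw1
    · have : b' ≤ s := hs.2 fun x hx => by
        have h2 : s ≤ x := hs.1 hx
        rcases h2.eq_or_lt with rfl | h3
        · exact absurd hx hAs
        · exact not_lt.1 fun h4 => h1 x h3 h4 hx
      exact absurd this (not_le.2 hb)

theorem exists_bd {A : M → Prop} (hA : Dfn L M A) {x y : M} (hx : A x) (hy : ¬ A y) :
    ∃ z, ((x ≤ z ∧ z ≤ y) ∨ (y ≤ z ∧ z ≤ x)) ∧ Bd A z := by
  by_contra hn
  push Not at hn
  have key : ∀ z, ¬ Bd A z → Ev z A ∨ Ev z (fun w => ¬ A w) := by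
    intro z hz
    obtain ⟨a, b, h1, h2, h | h⟩ := not_not.1 hz
    · exact Or.inl ⟨a, b, h1, h2, h⟩
    · exact Or.inr ⟨a, b, h1, h2, h⟩
  rcases lt_trichotomy x y with h | h | h
  · exact hy ((const_seg hA h fun z h1 h2 => key z (hn z (Or.inl ⟨h1, h2⟩))).1 hx)
  · exact hy (h ▸ hx)
  · exact hy ((const_seg hA h fun z h1 h2 => key z (hn z (Or.inr ⟨h1, h2⟩))).2 hx)

end one

section
variable {L : Language} {M N : Type*} [L.Structure M] [L.Structure N] [LinearOrder M] [LinearOrder N]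
variable {X X' Y Y' Z Z' : Type*} [Ctx L M X] [Ctx L N X'] [Ctx L M Y] [Ctx L N Y'] 
  [Ctx L M Z] [Ctx L N Z'] [TC L M N X X'] [TC L M N Y Y'] [TC L M N Z Z']
variable {f : M ↪ₑ[L] N} [hf : TL f]

theorem tr_ic {A : X → M → Prop} {A' : X' → N → Prop} 
    (h : Tr f (fun p : X × M => A p.1 p.2) (fun p : X' × N => A' p.1 p.2)) : 
    Tr f (fun p : X × M => IC (A p.1) p.2) (fun p : X' × N => IC (A' p.1) p.2) := by
  unfold IC
  refine Tr.and (h.sub Ts.id) (Tr.all (Tr.imp (h.sub (Ts.id.fst.fst.mk Ts.id.snd)) (Tr.imp (Tr.lt Ts.id.snd Ts.id.fst.snd) 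
    (Tr.all (Tr.imp (Tr.le Ts.id.fst.snd Ts.id.snd) (Tr.imp (Tr.le Ts.id.snd Ts.id.fst.fst.snd) 
    (h.sub (Ts.id.fst.fst.fst.mk Ts.id.snd))))))))

theorem f_lt (hf : TL f) {a b : M} : f a < f b ↔ a < b := hf.lt.elem (a, b)
theorem f_le (hf : TL f) {a b : M} : f a ≤ f b ↔ a ≤ b := by 
  rw [← not_lt, ← not_lt, f_lt hf]

theorem tr_sub {P Q : X → Prop} {P' Q' : X' → Prop} (h : Tr f P P') (h' : Tr f Q Q') 
    (h1 : ∀ x, P x → Q x) : ∀ x, P' x → Q' x := (h.imp h').forall_iff.2 h1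

/-- an unrealized cut -/
structure CT (f : M ↪ₑ[L] N) (T : M → Prop) : Prop where
  down : ∀ x y, x ≤ y → T y → T x
  lo : ∃ a, T a
  hi : ∃ b, ¬ T b
  up : ∀ s, T s → ∃ s', s < s' ∧ T s'
  dn : ∀ s, ¬ T s → ∃ s', s' < s ∧ ¬ T s'
  nr : ∀ y : N, (∃ s, T s ∧ y < f s) ∨ (∃ s, ¬ T s ∧ f s < y)

theorem CT.of_cut (hf : TL f) (htame : ∀ s : N, (∀ t : M, f t < s) ∨ (∃ m : M, IsLUB {t : M | f t < s} m))
    {T : M → Prop} {s0 s1 : M} (h : Cut T s0 s1) : CT f T := by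
  have up : ∀ s, T s → ∃ s', s < s' ∧ T s' := by
    intro s hs
    by_contra hn
    push Not at hn
    exact h.irr ⟨s, fun x hx => not_lt.1 fun h1 => hn x h1 hx, fun b hb => hb hs⟩
  have hlt : ∀ a b, T a → ¬ T b → a < b := fun a b h1 h2 => not_le.1 fun h3 => h2 (h.down _ _ h3 h1)
  refine ⟨h.down, ⟨s0, h.lo⟩, ⟨s1, h.hi⟩, up, ?_, ?_⟩
  · intro s hs
    by_contra hn
    push Not at hn
    exact h.irr ⟨s, fun x hx => (hlt x s hx hs).le, fun b hb => not_lt.1 fun h1 => by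
      obtain ⟨s', h2, h3⟩ := up b (hn b h1)
      exact absurd (hb h3) (not_le.2 h2)⟩
  · intro y
    by_contra hn
    push Not at hn
    obtain ⟨h1, h2⟩ := hn
    have : {t : M | f t < y} = {x | T x} := by
      ext t
      constructor
      · intro ht
        by_contra h3
        exact absurd (h2 t h3) (not_le.2 ht)
      · intro ht
        obtain ⟨s', h3, h4⟩ := up t ht
        exact ((f_lt hf).2 h3).trans_le (h1 s' h4)
    rcases htame y with h3 | h3
    · exact absurd (h2 s1 h.hi) (not_le.2 (h3 s1))
    · rw [this] at h3; exact h.irr h3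

def Nr (T : M → Prop) (A : M → Prop) : Prop := ∃ a b, T a ∧ ¬ T b ∧ ∀ s, a < s → s < b → A s
def Nr' (f : M ↪ₑ[L] N) (T : M → Prop) (A : N → Prop) : Prop := 
  ∃ a b, T a ∧ ¬ T b ∧ ∀ s, f a < s → s < f b → A s

variable {T : M → Prop} 

theorem Nr.mono {A B : M → Prop} (h : Nr T A) (h' : ∀ s, A s → B s) : Nr T B := by
  obtain ⟨a, b, h1, h2, h3⟩ := h
  exact ⟨a, b, h1, h2, fun s h4 h5 => h' s (h3 s h4 h5)⟩
theorem Nr'.mono {A B : N → Prop} (h : Nr' f T A) (h' : ∀ s, A s → B s) : Nr' f T B := by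
  obtain ⟨a, b, h1, h2, h3⟩ := h
  exact ⟨a, b, h1, h2, fun s h4 h5 => h' s (h3 s h4 h5)⟩
theorem Nr.and {A B : M → Prop} (h : Nr T A) (h' : Nr T B) : Nr T (fun s => A s ∧ B s) := by
  obtain ⟨a, b, h1, h2, h3⟩ := h
  obtain ⟨a', b', h1', h2', h3'⟩ := h'
  refine ⟨max a a', min b b', ?_, ?_, fun s h4 h5 => ⟨h3 s ((le_max_left _ _).trans_lt h4) (h5.trans_le (min_le_left _ _)), 
    h3' s ((le_max_right _ _).trans_lt h4) (h5.trans_le (min_le_right _ _))⟩⟩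
  · rcases max_choice a a' with h | h <;> rw [h] <;> assumption
  · rcases min_choice b b' with h | h <;> rw [h] <;> assumption
theorem Nr'.and (hf : TL f) {A B : N → Prop} (h : Nr' f T A) (h' : Nr' f T B) : Nr' f T (fun s => A s ∧ B s) := by
  obtain ⟨a, b, h1, h2, h3⟩ := h
  obtain ⟨a', b', h1', h2', h3'⟩ := h'
  refine ⟨max a a', min b b', ?_, ?_, fun s h4 h5 => ⟨h3 s (((f_le hf).2 (le_max_left _ _)).trans_lt h4) 
    (h5.trans_le ((f_le hf).2 (min_le_left _ _))), 
    h3' s (((f_le hf).2 (le_max_right _ _)).trans_lt h4) (h5.trans_le ((f_le hf).2 (min_le_right _ _)))⟩⟩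
  · rcases max_choice a a' with h | h <;> rw [h] <;> assumption
  · rcases min_choice b b' with h | h <;> rw [h] <;> assumption

theorem Nr.ex (hT : CT f T) {A : M → Prop} (h : Nr T A) : (∃ s, T s ∧ A s) ∧ (∃ s, ¬ T s ∧ A s) := by
  obtain ⟨a, b, h1, h2, h3⟩ := h
  obtain ⟨s, h4, h5⟩ := hT.up a h1
  obtain ⟨s', h6, h7⟩ := hT.dn b h2
  have hlt : ∀ a b, T a → ¬ T b → a < b := fun a b h1 h2 => not_le.1 fun h3 => h2 (hT.down _ _ h3 h1)
  exact ⟨⟨s, h5, h3 s h4 (hlt _ _ h5 h2)⟩, ⟨s', h7, h3 s' (hlt _ _ h1 h7) h6⟩⟩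

theorem Nr'.to {A : M → Prop} {A' : N → Prop} (hf : TL f) (hA : Tr f A A') (h : Nr' f T A') : Nr T A := by
  obtain ⟨a, b, h1, h2, h3⟩ := h
  exact ⟨a, b, h1, h2, fun s h4 h5 => (hA.elem s).1 (h3 (f s) ((f_lt hf).2 h4) ((f_lt hf).2 h5))⟩

variable [DenselyOrdered N] [NoMinOrder N] [NoMaxOrder N] [Nonempty N] [OM L N]

theorem Nr'.decide (hf : TL f) (hT : CT f T) {B : N → Prop} (hB : Dfn L N B) : 
    Nr' f T B ∨ Nr' f T (fun s => ¬ B s) := by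
  obtain ⟨a0, ha0⟩ := hT.lo
  obtain ⟨b0, hb0⟩ := hT.hi
  have h1 : ∀ d : N, Nr' f T (fun s => s ≠ d) := by
    intro d
    rcases hT.nr d with ⟨s, h1, h2⟩ | ⟨s, h1, h2⟩
    · exact ⟨s, b0, h1, hb0, fun y h3 _ => (h2.trans h3).ne'⟩
    · exact ⟨a0, s, ha0, h1, fun y _ h3 => (h3.trans h2).ne⟩
  have h2 : ∀ F : Set N, F.Finite → Nr' f T (fun s => s ∉ F) := by
    intro F hF
    induction F, hF using Set.Finite.induction_on with
    | empty => exact ⟨a0, b0, ha0, hb0, fun _ _ _ => by simp⟩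
    | insert _ _ ih => exact (ih.and hf (h1 _)).mono fun s hs => fun h => (Set.mem_insert_iff.1 h).elim hs.2 hs.1
  obtain ⟨a, b, h3, h4, h5⟩ := h2 _ (OM.fin (L := L) B hB)
  have h6 := const_of_no_bd hB (fun x h7 h8 => not_not.1 (h5 x h7 h8))
  by_cases h7 : ∃ y, f a < y ∧ y < f b ∧ B y
  · obtain ⟨y, h8, h9, h10⟩ := h7
    exact Or.inl ⟨a, b, h3, h4, fun s h11 h12 => (h6 y s h8 h9 h11 h12).1 h10⟩
  · push Not at h7
    exact Or.inr ⟨a, b, h3, h4, h7⟩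

variable [DenselyOrdered M] [NoMinOrder M] [NoMaxOrder M] [Nonempty M] [OM L M]

def QStat (f : M ↪ₑ[L] N) (T : M → Prop) (m : ℕ) : Prop :=
  ∀ (Y : M → (Fin m → M) → Prop) (Y' : N → (Fin m → N) → Prop), 
    Tr f (fun p : M × (Fin m → M) => Y p.1 p.2) (fun p : N × (Fin m → N) => Y' p.1 p.2) → 
    Nr T (fun t => ∃ u, Y t u) → ∀ G : N → (Fin m → N) → Prop, Dfn L N (fun p : N × (Fin m → N) => G p.1 p.2) → 
    ∃ (Y1 : M → (Fin m → M) → Prop) (Y1' : N → (Fin m → N) → Prop), 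
      Tr f (fun p : M × (Fin m → M) => Y1 p.1 p.2) (fun p : N × (Fin m → N) => Y1' p.1 p.2) ∧
      (∀ t u, Y1 t u → Y t u) ∧ Nr T (fun t => ∃ u, Y1 t u) ∧ 
      (Nr' f T (fun t => ∀ u, Y1' t u → G t u) ∨ Nr' f T (fun t => ∀ u, Y1' t u → ¬ G t u))

theorem qstat_zero (hf : TL f) (hT : CT f T) : QStat f T 0 := by
  intro Y Y' hY hne G hG
  refine ⟨Y, Y', hY, fun _ _ h => h, hne, ?_⟩
  refine (Nr'.decide hf hT (B := fun t => G t default) (Dfn.comp' hG (g := fun t => (t, default)) (by fun_prop))).imp ?_ ?_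
  · intro h; exact h.mono fun t ht u _ => by rwa [Subsingleton.elim u default]
  · intro h; exact h.mono fun t ht u _ => by rwa [Subsingleton.elim u default]

theorem qstat_succ (hf : TL f) (hT : CT f T) {m : ℕ} (ih : QStat f T m) : QStat f T (m+1) := by
  intro Y Y' hY hne G hG
  -- building the answer
  have build : ∀ (Yk : M → (Fin m → M) → Prop) (Yk' : N → (Fin m → N) → Prop) (S : M → (Fin m → M) → M → Prop) 
      (S' : N → (Fin m → N) → N → Prop), 
      Tr f (fun p : M × (Fin m → M) => Yk p.1 p.2) (fun p : N × (Fin m → N) => Yk' p.1 p.2) → 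
      Tr f (fun p : (M × (Fin m → M)) × M => S p.1.1 p.1.2 p.2) (fun p : (N × (Fin m → N)) × N => S' p.1.1 p.1.2 p.2) → 
      (∀ t c y, S t c y → Y t (sn c y)) → Nr T (fun t => ∃ c, Yk t c ∧ ∃ y, S t c y) → 
      (Nr' f T (fun t => ∀ c, Yk' t c → ∀ y, S' t c y → G t (sn c y)) ∨ 
       Nr' f T (fun t => ∀ c, Yk' t c → ∀ y, S' t c y → ¬ G t (sn c y))) → 
      ∃ (Y1 : M → (Fin (m+1) → M) → Prop) (Y1' : N → (Fin (m+1) → N) → Prop), 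
      Tr f (fun p : M × (Fin (m+1) → M) => Y1 p.1 p.2) (fun p : N × (Fin (m+1) → N) => Y1' p.1 p.2) ∧
      (∀ t u, Y1 t u → Y t u) ∧ Nr T (fun t => ∃ u, Y1 t u) ∧ 
      (Nr' f T (fun t => ∀ u, Y1' t u → G t u) ∨ Nr' f T (fun t => ∀ u, Y1' t u → ¬ G t u)) := by
    intro Yk Yk' S S' hYk hS hSY hn hdec
    refine ⟨fun t u => Yk t (ini u) ∧ S t (ini u) (u (Fin.last m)), 
      fun t u => Yk' t (ini u) ∧ S' t (ini u) (u (Fin.last m)), ?_, ?_, ?_, ?_⟩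
    · exact (hYk.sub (Ts.id.fst.mk Ts.id.snd.ini)).and (hS.sub ((Ts.id.fst.mk Ts.id.snd.ini).mk (Ts.id.snd.ap _)))
    · intro t u h
      have := hSY _ _ _ h.2
      simpa using this
    · refine hn.mono ?_
      rintro t ⟨c, h1, y, h2⟩
      exact ⟨sn c y, by simpa using h1, by simpa using h2⟩
    · refine hdec.imp (fun h => h.mono fun t ht u hu => ?_) (fun h => h.mono fun t ht u hu => ?_)
      · simpa using ht _ hu.1 _ hu.2
      · simpa using ht _ hu.1 _ hu.2
  let Ys : M → (Fin m → M) → M → Prop := fun t c y => IC (fun y => Y t (sn c y)) y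
  let Ys' : N → (Fin m → N) → N → Prop := fun t c y => IC (fun y => Y' t (sn c y)) y
  have hYs : Tr f (fun p : (M × (Fin m → M)) × M => Ys p.1.1 p.1.2 p.2) (fun p : (N × (Fin m → N)) × N => Ys' p.1.1 p.1.2 p.2) := 
    tr_ic (A := fun (p : M × (Fin m → M)) y => Y p.1 (sn p.2 y)) (A' := fun (p : N × (Fin m → N)) y => Y' p.1 (sn p.2 y)) 
      (hY.sub (Ts.id.fst.fst.mk (Ts.id.fst.snd.sn Ts.id.snd)))
  have hY0 : Tr f (fun p : M × (Fin m → M) => ∃ y, Ys p.1 p.2 y) (fun p : N × (Fin m → N) => ∃ y, Ys' p.1 p.2 y) := 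
    Tr.ex hYs
  have hYd := hY.dfn₁
  have hYsd := hYs.dfn₂
  have hne0 : Nr T (fun t => ∃ c, ∃ y, Ys t c y) := by
    refine hne.mono ?_
    rintro t ⟨u, hu⟩
    refine ⟨ini u, IC.nonempty (L := L) (A := fun y => Y t (sn (ini u) y)) 
      (Dfn.comp' hYd (g := fun y => (t, sn (ini u) y)) (by fun_prop)) ⟨u (Fin.last m), by simpa using hu⟩⟩
  have hYsY : ∀ t c y, Ys t c y → Y t (sn c y) := fun t c y h => h.1
  have hG1 : Dfn L N (fun p : N × (Fin m → N) => ∀ y, Ys' p.1 p.2 y → G p.1 (sn p.2 y)) := by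
    simp only [all_iff, imp_iff_not_or]
    refine Dfn.not' (Dfn.ex' (Dfn.not' (Dfn.or' (Dfn.not' hYsd) ?_)))
    exact Dfn.comp' hG (g := fun q : (N × (Fin m → N)) × N => (q.1.1, sn q.1.2 q.2)) (by fun_prop)
  have hG2 : Dfn L N (fun p : N × (Fin m → N) => ∀ y, Ys' p.1 p.2 y → ¬ G p.1 (sn p.2 y)) := by
    simp only [all_iff, imp_iff_not_or]
    refine Dfn.not' (Dfn.ex' (Dfn.not' (Dfn.or' (Dfn.not' hYsd) (Dfn.not' ?_))))
    exact Dfn.comp' hG (g := fun q : (N × (Fin m → N)) × N => (q.1.1, sn q.1.2 q.2)) (by fun_prop)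
  obtain ⟨Y1, Y1', hY1, hY10, hne1, hd1 | hd1⟩ := ih (fun t c => ∃ y, Ys t c y) (fun t c => ∃ y, Ys' t c y) 
    hY0 hne0 (fun t c => ∀ y, Ys' t c y → G t (sn c y)) hG1
  · exact build Y1 Y1' Ys Ys' hY1 hYs hYsY (hne1.mono fun t ⟨c, hc⟩ => ⟨c, hc, hY10 _ _ hc⟩) (Or.inl hd1)
  obtain ⟨Y2, Y2', hY2, hY21, hne2, hd2 | hd2⟩ := ih Y1 Y1' 
    hY1 hne1 (fun t c => ∀ y, Ys' t c y → ¬ G t (sn c y)) hG2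
  · exact build Y2 Y2' Ys Ys' hY2 hYs hYsY (hne2.mono fun t ⟨c, hc⟩ => ⟨c, hc, hY10 _ _ (hY21 _ _ hc)⟩) (Or.inr hd2)
  have hsub := tr_sub hY2 hY1 (fun x hx => hY21 _ _ hx)
  have hbd : Nr' f T (fun t => ∀ c, Y2' t c → ∃ y, Ys' t c y ∧ Bd (fun y => G t (sn c y)) y) := by
    refine (hd1.and hf hd2).mono ?_
    rintro t ⟨h1, h2⟩ c hc
    have h1 := h1 c (hsub (t, c) hc)
    have h2 := h2 c hc
    push Not at h1 h2
    obtain ⟨y1, h3, h4⟩ := h1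
    obtain ⟨y2, h5, h6⟩ := h2
    obtain ⟨z, h7, h8⟩ := exists_bd (L := L) (A := fun y => G t (sn c y)) 
      (Dfn.comp' hG (g := fun y => (t, sn c y)) (by fun_prop)) h6 h4
    refine ⟨z, ?_, h8⟩
    rcases h7 with ⟨h7, h9⟩ | ⟨h7, h9⟩
    · exact h5.convex h3 h7 h9
    · exact h3.convex h5 h7 h9
  obtain ⟨k, a, Γ, Γ', hΓ, hGΓ⟩ := Tr.of_dfn₂ (X := M × (Fin (m+1) → M)) f hG
  obtain ⟨p, q, hp, hq, hpq⟩ := hbd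
  have hB : Tr f (fun z : ((Fin k → M) × (M × (Fin m → M))) × M => Bd (fun y => Γ (z.1.1, z.1.2.1, sn z.1.2.2 y)) z.2) 
     (fun z : ((Fin k → N) × (N × (Fin m → N))) × N => Bd (fun y => Γ' (z.1.1, z.1.2.1, sn z.1.2.2 y)) z.2) := 
    tr_bd (A := fun (z : (Fin k → M) × (M × (Fin m → M))) y => Γ (z.1, z.2.1, sn z.2.2 y)) 
      (A' := fun (z : (Fin k → N) × (N × (Fin m → N))) y => Γ' (z.1, z.2.1, sn z.2.2 y)) 
      (hΓ.sub (Ts.id.fst.fst.mk (Ts.id.fst.snd.fst.mk (Ts.id.fst.snd.snd.sn Ts.id.snd))))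
  have hΞ : Tr f (fun a : Fin k → M => ∀ t, p < t → t < q → ∀ c, Y2 t c → ∃ y, Ys t c y ∧ Bd (fun y => Γ (a, t, sn c y)) y) 
     (fun a : Fin k → N => ∀ t, f p < t → t < f q → ∀ c, Y2' t c → ∃ y, Ys' t c y ∧ Bd (fun y => Γ' (a, t, sn c y)) y) := by
    refine Tr.all (Tr.imp (Tr.lt (Ts.cs p) Ts.id.snd) (Tr.imp (Tr.lt Ts.id.snd (Ts.cs q)) (Tr.all 
      (Tr.imp (hY2.sub (Ts.id.fst.snd.mk Ts.id.snd)) (Tr.ex (Tr.and ?_ ?_))))))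
    · exact hYs.sub ((Ts.id.fst.fst.snd.mk Ts.id.fst.snd).mk Ts.id.snd)
    · exact hB.sub ((Ts.id.fst.fst.fst.mk (Ts.id.fst.fst.snd.mk Ts.id.fst.snd)).mk Ts.id.snd)
  obtain ⟨a0, ha0⟩ := hΞ.exists_iff.1 ⟨a, fun t h1 h2 c hc => by
    obtain ⟨y, h3, h4⟩ := hpq t h1 h2 c hc
    refine ⟨y, h3, ?_⟩
    have : (fun y => G t (sn c y)) = (fun y => Γ' (a, t, sn c y)) := funext fun y => propext (hGΓ (t, sn c y))
    rwa [this] at h4⟩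
  let B : M → (Fin m → M) → M → Prop := fun t c y => Ys t c y ∧ Bd (fun y => Γ (a0, t, sn c y)) y
  let B' : N → (Fin m → N) → N → Prop := fun t c y => Ys' t c y ∧ Bd (fun y => Γ' (f ∘ a0, t, sn c y)) y
  have hBB : Tr f (fun p : (M × (Fin m → M)) × M => B p.1.1 p.1.2 p.2) (fun p : (N × (Fin m → N)) × N => B' p.1.1 p.1.2 p.2) := 
    Tr.and hYs (hB.sub (((Ts.cst a0).mk Ts.id.fst).mk Ts.id.snd))
  let S : M → (Fin m → M) → M → Prop := fun t c y => B t c y ∧ ∀ z, z < y → ¬ B t c z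
  let S' : N → (Fin m → N) → N → Prop := fun t c y => B' t c y ∧ ∀ z, z < y → ¬ B' t c z
  have hS : Tr f (fun p : (M × (Fin m → M)) × M => S p.1.1 p.1.2 p.2) (fun p : (N × (Fin m → N)) × N => S' p.1.1 p.1.2 p.2) := 
    Tr.and hBB (Tr.all (Tr.imp (Tr.lt Ts.id.snd Ts.id.fst.snd) (Tr.not (hBB.sub (Ts.id.fst.fst.mk Ts.id.snd)))))
  have hSd := hS.dfn₂
  have hG3 : Dfn L N (fun p : N × (Fin m → N) => ∃ y, S' p.1 p.2 y ∧ G p.1 (sn p.2 y)) := by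
    refine (Dfn.ex' (Dfn.and' hSd ?_))
    exact Dfn.comp' hG (g := fun q : (N × (Fin m → N)) × N => (q.1.1, sn q.1.2 q.2)) (by fun_prop)
  have hΓd := hΓ.dfn₁
  have hSne : ∀ t c, p < t → t < q → Y2 t c → ∃ y, S t c y := by
    intro t c h1 h2 h3
    have hfin : {y | B t c y}.Finite := (OM.fin (L := L) (fun y => Γ (a0, t, sn c y)) 
      (Dfn.comp' hΓd (g := fun y => (a0, t, sn c y)) (by fun_prop))).subset fun y hy => hy.2
    obtain ⟨y, hy, hmin⟩ := Set.exists_min_image _ id hfin (ha0 t h1 h2 c h3)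
    exact ⟨y, hy, fun z hz hBz => absurd (hmin z hBz) (not_le.2 hz)⟩
  have hSu : ∀ t c y z, S' t c y → S' t c z → y = z := by
    intro t c y z h1 h2
    rcases lt_trichotomy y z with h | h | h
    · exact absurd h1.1 (h2.2 y h)
    · exact h
    · exact absurd h2.1 (h1.2 z h)
  obtain ⟨Y3, Y3', hY3, hY32, hne3, hd3⟩ := ih Y2 Y2' 
    hY2 hne2 (fun t c => ∃ y, S' t c y ∧ G t (sn c y)) hG3
  refine build Y3 Y3' S S' hY3 hS (fun t c y h => h.1.1.1) ?_ ?_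
  · have : Nr T (fun t => p < t ∧ t < q) := ⟨p, q, hp, hq, fun s h1 h2 => ⟨h1, h2⟩⟩
    refine (this.and hne3).mono ?_
    rintro t ⟨⟨h1, h2⟩, c, hc⟩
    exact ⟨c, hc, hSne t c h1 h2 (hY32 _ _ hc)⟩
  · refine hd3.imp (fun h => h.mono fun t ht c hc y hy => ?_) (fun h => h.mono fun t ht c hc y hy hg => ?_)
    · obtain ⟨z, h1, h2⟩ := ht c hc
      rwa [hSu _ _ _ _ hy h1]
    · exact ht c hc ⟨y, hy, hg⟩

theorem qstat (hf : TL f) (hT : CT f T) (m : ℕ) : QStat f T m := by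
  induction m with
  | zero => exact qstat_zero hf hT
  | succ m ih => exact qstat_succ hf hT ih

end
end MS

open FirstOrder Set
set_option linter.unusedVariables false
set_option linter.unusedSectionVars false
set_option linter.style.haveILetI false
set_option linter.unusedSimpArgs false
namespace MS
section
variable {L : Language} {M N : Type*} [L.Structure M] [L.Structure N] [LinearOrder M] [LinearOrder N]
variable {f : M ↪ₑ[L] N} [hf : TL f]
variable [DenselyOrdered N] [NoMinOrder N] [NoMaxOrder N] [Nonempty N] [OM L N]
variable [DenselyOrdered M] [NoMinOrder M] [NoMaxOrder M] [Nonempty M] [OM L M]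

theorem star_aux (hf : TL f) {m : ℕ} {C : (Fin m → M) → Prop} {E : (Fin m → N) → Prop} (hE : Dfn L N E) 
    (hC : ∀ u, C u ↔ E (f ∘ u)) {P : M → (Fin m → M) → Prop} 
    (hP : Dfn L M (fun p : M × (Fin m → M) => P p.1 p.2)) {T : M → Prop} {s0 s1 : M} (hcut : Cut T s0 s1) 
    (hT : CT f T)
    (h1 : ∀ s, s0 ≤ s → s ≤ s1 → T s → ∀ u, P s u → C u) 
    (h2 : ∀ s, s0 ≤ s → s ≤ s1 → ¬ T s → ∀ u, C u → P s u) : Dfn L M C := by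
  have hltm : Dfn L M (fun p : M × M => p.1 < p.2) := OM.lt
  have hlt : ∀ a b, T a → ¬ T b → a < b := fun a b h1 h2 => not_le.1 fun h3 => h2 (hT.down _ _ h3 h1)
  let R : M → (Fin m → M) → Prop := fun s u => ∃ x, s0 ≤ x ∧ x ≤ s ∧ P x u
  have hR : Dfn L M (fun p : M × (Fin m → M) => R p.1 p.2) := by
    have := Dfn.comp' hP (g := fun q : (M × (Fin m → M)) × M => (q.2, q.1.2)) (by fun_prop)
    refine Dfn.ex' (Dfn.and' ?_ (Dfn.and' ?_ this))
    · exact Dfn.le' (by fun_prop) (by fun_prop)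
    · exact Dfn.le' (by fun_prop) (by fun_prop)
  have hmono : ∀ s s' u, s ≤ s' → R s u → R s' u := fun s s' u h ⟨x, a, b, c⟩ => ⟨x, a, b.trans h, c⟩
  have r1 : ∀ s, T s → ∀ u, R s u → C u := fun s hs u ⟨x, a, b, c⟩ => 
    h1 x a (hlt _ _ (hT.down _ _ b hs) hcut.hi).le (hT.down _ _ b hs) u c
  have r2 : ∀ s, ¬ T s → s ≤ s1 → ∀ u, C u → R s u := fun s hs hs1 u hu => 
    ⟨s, (hlt _ _ hcut.lo hs).le, le_rfl, h2 s (hlt _ _ hcut.lo hs).le hs1 hs u hu⟩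
  let Y : M → (Fin m → M) → Prop := fun s u => 
    (∀ x, s < x → R x u) ∧ (∀ x, x < s → ¬ R x u)
  have hY : Dfn L M (fun p : M × (Fin m → M) => Y p.1 p.2) := by
    have := Dfn.comp' hR (g := fun q : (M × (Fin m → M)) × M => (q.2, q.1.2)) (by fun_prop)
    refine Dfn.and' (Dfn.all' (Dfn.imp' ?_ this)) (Dfn.all' (Dfn.imp' ?_ (Dfn.not' this)))
    · exact Dfn.lt' (by fun_prop) (by fun_prop)
    · exact Dfn.lt' (by fun_prop) (by fun_prop)
  have y1 : ∀ s u, T s → Y s u → C u := by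
    intro s u hs hy
    obtain ⟨x, a, b⟩ := hT.up s hs
    exact r1 x b u (hy.1 x a)
  have y2 : ∀ s u, ¬ T s → s ≤ s1 → Y s u → ¬ C u := by
    intro s u hs hs1 hy hc
    obtain ⟨x, a, b⟩ := hT.dn s hs
    exact hy.2 x a (r2 x b (a.le.trans hs1) u hc)
  obtain ⟨Y0', hY'⟩ := Tr.of_dfn (X' := N × (Fin m → N)) (f := f) hY
  let Y' : N → (Fin m → N) → Prop := fun t u => Y0' (t, u)
  replace hY' : Tr f (fun p : M × (Fin m → M) => Y p.1 p.2) (fun p : N × (Fin m → N) => Y' p.1 p.2) := hY'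
  have hA : Tr f (fun t : M => ∃ u, Y t u) (fun t : N => ∃ u, Y' t u) := Tr.ex hY'
  rcases Nr'.decide hf hT hA.dfn₂ with hd | hd
  · exfalso
    have hne := Nr'.to hf hA hd
    obtain ⟨Y1, Y1', hY1, hY1Y, hne1, hdec⟩ := qstat hf hT m Y Y' hY' hne (fun t u => E u) 
      (Dfn.comp' hE (g := fun p : N × (Fin m → N) => p.2) (by fun_prop))
    have hs1 : Nr T (fun t => t < s1) := ⟨s0, s1, hcut.lo, hcut.hi, fun s _ h => h⟩
    rcases hdec with ⟨a, b, ha, hb, h⟩ | ⟨a, b, ha, hb, h⟩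
    · have : Nr T (fun t => ∀ u, Y1 t u → C u) := ⟨a, b, ha, hb, fun s h3 h4 u hu => (hC u).2 
        (h (f s) ((f_lt hf).2 h3) ((f_lt hf).2 h4) (f ∘ u) ((hY1.elem (s, u)).2 hu))⟩
      obtain ⟨-, s, hs, ⟨h5, h6⟩, u, hu⟩ := Nr.ex hT ((this.and hs1).and hne1)
      exact y2 s u hs h6.le (hY1Y _ _ hu) (h5 u hu)
    · have : Nr T (fun t => ∀ u, Y1 t u → ¬ C u) := ⟨a, b, ha, hb, fun s h3 h4 u hu hc => 
        (h (f s) ((f_lt hf).2 h3) ((f_lt hf).2 h4) (f ∘ u) ((hY1.elem (s, u)).2 hu)) ((hC u).1 hc)⟩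
      obtain ⟨⟨s, hs, h5, u, hu⟩, -⟩ := Nr.ex hT (this.and hne1)
      exact h5 u hu (y1 s u hs (hY1Y _ _ hu))
  · have hne := Nr'.to hf hA.not hd
    have hs1 : Nr T (fun t => s0 < t ∧ t < s1) := ⟨s0, s1, hcut.lo, hcut.hi, fun s h h' => ⟨h, h'⟩⟩
    obtain ⟨a, b, ha, hb, h⟩ := hne.and hs1
    obtain ⟨s, as, hs⟩ := hT.up a ha
    obtain ⟨s', bs, hs'⟩ := hT.dn b hb
    have hss : s < s' := hlt _ _ hs hs'
    have key : ∀ u, C u ↔ R s u := by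
      intro u
      refine ⟨fun hc => ?_, r1 s hs u⟩
      by_contra hn
      have h5 := r2 s' hs' (h s' (as.trans hss) bs).2.2.le u hc
      have hRd : Dfn L M (fun x => R x u) := Dfn.comp' hR (g := fun x => (x, u)) (by fun_prop)
      obtain ⟨σ, hσ⟩ := OM.glb (L := L) (fun x => R x u) hRd ⟨s', h5⟩ ⟨s, fun x hx => not_lt.1 fun h6 => hn (hmono _ _ _ h6.le hx)⟩
      have h6 : s ≤ σ := hσ.2 fun x hx => not_lt.1 fun h6 => hn (hmono _ _ _ h6.le hx)
      have h7 : σ ≤ s' := hσ.1 h5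
      refine (h σ (as.trans_le h6) (h7.trans_lt bs)).1 ⟨u, fun x hx => ?_, fun x hx h8 => ?_⟩
      · by_contra h8
        exact absurd (hσ.2 (fun z hz => not_lt.1 fun h9 => h8 (hmono _ _ _ h9.le hz))) (not_le.2 hx)
      · exact absurd (hσ.1 h8) (not_le.2 hx)
    exact Dfn.congr (Dfn.comp' hR (g := fun u => (s, u)) (by fun_prop)) (fun u => propext (key u))

theorem star_trace (hf : TL f) (htame : ∀ s : N, (∀ t : M, f t < s) ∨ (∃ m : M, IsLUB {t : M | f t < s} m))
    {m : ℕ} {C : (Fin m → M) → Prop} {E : (Fin m → N) → Prop} (hE : Dfn L N E) 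
    (hC : ∀ u, C u ↔ E (f ∘ u)) (h : Star L M C) : Dfn L M C := by
  obtain ⟨P, hP, T, s0, s1, hcut, Q, hQ | hQ, h⟩ := h
  · exact star_aux hf hE hC hP hcut (CT.of_cut hf htame hcut) (fun s a b hs => (h s a b).1 ((hQ s).2 hs)) 
      (fun s a b hs => (h s a b).2 (fun h => hs ((hQ s).1 h)))
  · have := star_aux hf (C := fun u => ¬ C u) (Dfn.not' hE) (fun u => not_congr (hC u)) 
      (P := fun s u => ¬ P s u) (Dfn.not' hP) hcut (CT.of_cut hf htame hcut) 
      (fun s a b hs u hp hc => hp ((h s a b).2 (fun h => (hQ s).1 h hs) u hc)) 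
      (fun s a b hs u hp hc => hp ((h s a b).1 ((hQ s).2 hs) u hc))
    exact Dfn.congr (Dfn.not' this) (fun u => by rw [not_not])
end
end MS

open FirstOrder Set
set_option linter.unusedVariables false
set_option linter.unusedSectionVars false
set_option linter.style.haveILetI false
set_option linter.unusedSimpArgs false
namespace MS

/-- there is an alternating chain of length `j + 1` below `y` -/
def W {α : Type*} [LinearOrder α] (φ : α → Prop) : ℕ → α → Prop
  | 0, y => ∃ z, z ≤ y ∧ φ z
  | j+1, y => ∃ z, z ≤ y ∧ W φ j z ∧ (φ z ↔ Even (j+1))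

theorem W.mono {α : Type*} [LinearOrder α] {φ : α → Prop} {j : ℕ} {y z : α} (h : W φ j y) (hyz : y ≤ z) : W φ j z := by
  cases j with
  | zero => obtain ⟨x, h1, h2⟩ := h; exact ⟨x, h1.trans hyz, h2⟩
  | succ j => obtain ⟨x, h1, h2⟩ := h; exact ⟨x, h1.trans hyz, h2⟩

theorem W.dec {α : Type*} [LinearOrder α] {φ : α → Prop} {j : ℕ} {y : α} (h : W φ (j+1) y) : W φ j y := by
  obtain ⟨x, h1, h2, h3⟩ := h
  exact h2.mono h1

theorem W.iff {α : Type*} [LinearOrder α] {φ : α → Prop} {B : ℕ} (hB : ∀ y, ¬ W φ B y) (y : α) : 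
    φ y ↔ ∃ j : Fin B, Even j.1 ∧ W φ j.1 y ∧ ¬ W φ (j.1+1) y := by
  constructor
  · intro h
    have h0 : W φ 0 y := ⟨y, le_rfl, h⟩
    have : ∃ j, j < B ∧ W φ j y ∧ ¬ W φ (j+1) y := by
      by_contra hn
      push Not at hn
      have : ∀ j, j ≤ B → W φ j y := by
        intro j
        induction j with
        | zero => intro _; exact h0
        | succ j ih => intro hj; exact hn j hj (ih (by omega))
      exact hB y (this B le_rfl)
    obtain ⟨j, h1, h2, h3⟩ := this
    refine ⟨⟨j, h1⟩, ?_, h2, h3⟩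
    by_contra h4
    exact h3 ⟨y, le_rfl, h2, by simp only [h, true_iff]; exact Nat.even_add_one.2 h4⟩
  · rintro ⟨⟨j, hj⟩, h1, h2, h3⟩
    by_contra h4
    exact h3 ⟨y, le_rfl, h2, by simp only [h4, false_iff]; exact fun h5 => Nat.even_add_one.1 h5 h1⟩

section one
variable {L : Language} {M : Type*} [L.Structure M] [LinearOrder M] [DenselyOrdered M]
  [NoMinOrder M] [NoMaxOrder M] [Nonempty M] [OM L M]

theorem W.bound {φ : M → Prop} (hφ : Dfn L M φ) (j : ℕ) : ∀ y, W φ (2*j) y → 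
    ∃ z, z ≤ y ∧ φ z ∧ j ≤ {x | Bd φ x ∧ x ≤ z}.ncard := by
  have hfin : {x | Bd φ x}.Finite := OM.fin (L := L) φ hφ
  have hfin' : ∀ z, {x | Bd φ x ∧ x ≤ z}.Finite := fun z => hfin.subset fun x hx => hx.1
  induction j with
  | zero => rintro y ⟨z, h1, h2⟩; exact ⟨z, h1, h2, Nat.zero_le _⟩
  | succ j ih => 
    rintro y ⟨y2, h1, ⟨y1, h2, h3, h4⟩, h5⟩
    have e1 : φ y2 := h5.2 ⟨j+1, by change 2*j+1+1 = _; ring⟩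
    have e2 : ¬ φ y1 := fun h => by
      have := h4.1 h
      change Even (2 * j + 1) at this
      rw [Nat.even_iff] at this; omega
    obtain ⟨y0, h6, h7, h8⟩ := ih y1 h3
    have h9 : y0 < y1 := lt_of_le_of_ne h6 (by rintro rfl; exact e2 h7)
    obtain ⟨z, hz, hbd⟩ := exists_bd hφ e1 e2
    have hz' : y1 ≤ z ∧ z ≤ y2 := by
      rcases hz with hz | hz
      · exact ⟨h2.trans hz.1, hz.2.trans h2⟩
      · exact hz
    refine ⟨y2, h1, e1, ?_⟩
    have hsub : insert z {x | Bd φ x ∧ x ≤ y0} ⊆ {x | Bd φ x ∧ x ≤ y2} := by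
      rintro x (rfl | hx)
      · exact ⟨hbd, hz'.2⟩
      · exact ⟨hx.1, hx.2.trans (h9.le.trans h2)⟩
    have := Set.ncard_le_ncard hsub (hfin' y2)
    rw [Set.ncard_insert_of_notMem (fun h => absurd (h9.trans_le hz'.1) (not_lt.2 h.2)) (hfin' y0)] at this
    omega

theorem W.unif {X : Type*} [Ctx L M X] {φ : X → M → Prop} (hφ : Dfn L M (fun p : X × M => φ p.1 p.2)) : 
    ∃ B, ∀ v y, ¬ W (φ v) B y := by
  have hv : ∀ v, Dfn L M (φ v) := fun v => Dfn.comp' hφ (g := fun y => (v, y)) (by fun_prop)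
  obtain ⟨K, hK⟩ := ufc (Z := fun v y => Bd (φ v) y) (dfn_bd hφ) (fun v => OM.fin (L := L) (φ v) (hv v))
  refine ⟨2*(K+1), fun v y h => ?_⟩
  obtain ⟨z, h1, h2, h3⟩ := W.bound (hv v) (K+1) y h
  have h4 := Set.ncard_le_ncard (s := {x | Bd (φ v) x ∧ x ≤ z}) (t := {x | Bd (φ v) x}) (fun x hx => hx.1) 
    (OM.fin (L := L) (φ v) (hv v))
  have := hK v
  omega
end one

section
variable {L : Language} {M N : Type*} [L.Structure M] [L.Structure N] [LinearOrder M] [LinearOrder N]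
variable {X X' : Type*} [Ctx L M X] [Ctx L N X'] [TC L M N X X']
variable {f : M ↪ₑ[L] N} [hf : TL f]

theorem tr_W {φ : X → M → Prop} {φ' : X' → N → Prop} 
    (h : Tr f (fun p : X × M => φ p.1 p.2) (fun p : X' × N => φ' p.1 p.2)) (j : ℕ) : 
    Tr f (fun p : X × M => W (φ p.1) j p.2) (fun p : X' × N => W (φ' p.1) j p.2) := by
  induction j with
  | zero => 
    exact Tr.ex (P := fun (p : X × M) z => z ≤ p.2 ∧ φ p.1 z) (P' := fun (p : X' × N) z => z ≤ p.2 ∧ φ' p.1 z) 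
      ((Tr.le Ts.id.snd Ts.id.fst.snd).and (h.sub (Ts.id.fst.fst.mk Ts.id.snd)))
  | succ j ih =>
    exact Tr.ex (P := fun (p : X × M) z => z ≤ p.2 ∧ W (φ p.1) j z ∧ (φ p.1 z ↔ Even (j+1))) 
      (P' := fun (p : X' × N) z => z ≤ p.2 ∧ W (φ' p.1) j z ∧ (φ' p.1 z ↔ Even (j+1))) 
      ((Tr.le Ts.id.snd Ts.id.fst.snd).and ((ih.sub (Ts.id.fst.fst.mk Ts.id.snd)).and 
        ((h.sub (Ts.id.fst.fst.mk Ts.id.snd)).iff (Tr.const _))))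

variable [DenselyOrdered N] [NoMinOrder N] [NoMaxOrder N] [Nonempty N] [OM L N]
variable [DenselyOrdered M] [NoMinOrder M] [NoMaxOrder M] [Nonempty M] [OM L M]

theorem main (hf : TL f) (htame : ∀ s : N, (∀ t : M, f t < s) ∨ (∃ m : M, IsLUB {t : M | f t < s} m)) (n : ℕ) : 
    ∀ (a : Fin n → N) (m : ℕ) (Φ : (Fin m → M) × (Fin n → M) → Prop) (Φ' : (Fin m → N) × (Fin n → N) → Prop), 
      Tr f Φ Φ' → Dfn L M (fun u => Φ' (f ∘ u, a)) := by
  induction n with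
  | zero => 
    intro a m Φ Φ' h
    refine (Dfn.comp' h.dfn₁ (g := fun u => (u, default)) (by fun_prop)).congr fun u => propext ?_
    rw [← h.elem (u, default), Subsingleton.elim a (f ∘ default)]
    rfl
  | succ n ih =>
    intro a m Φ Φ' h
    let φ : (Fin m → M) × (Fin n → M) → M → Prop := fun p y => Φ (p.1, sn p.2 y)
    let φ' : (Fin m → N) × (Fin n → N) → N → Prop := fun p y => Φ' (p.1, sn p.2 y)
    have hφ : Tr f (fun p : ((Fin m → M) × (Fin n → M)) × M => φ p.1 p.2) 
        (fun p : ((Fin m → N) × (Fin n → N)) × N => φ' p.1 p.2) := 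
      h.sub (Ts.id.fst.fst.mk (Ts.id.fst.snd.sn Ts.id.snd))
    obtain ⟨B, hB⟩ := W.unif hφ.dfn₁
    have hB' : ∀ v y, ¬ W (φ' v) B y := fun v y => 
      (tr_W hφ B).not.forall_iff.2 (fun p => hB p.1 p.2) (v, y)
    have hW : ∀ j, Dfn L M (fun u => W (φ' (f ∘ u, ini a)) j (a (Fin.last n))) := by
      intro j
      have hT := tr_W hφ j
      have hR : Tr f (fun q : (Fin (m+m) → M) × (Fin n → M) => ∀ y, W (φ (fun i => q.1 (Fin.natAdd m i), q.2)) j y → 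
            W (φ (fun i => q.1 (Fin.castAdd m i), q.2)) j y)
          (fun q : (Fin (m+m) → N) × (Fin n → N) => ∀ y, W (φ' (fun i => q.1 (Fin.natAdd m i), q.2)) j y → 
            W (φ' (fun i => q.1 (Fin.castAdd m i), q.2)) j y) := 
        Tr.all ((hT.sub (((Ts.pi fun i => Ts.id.fst.fst.ap _).mk Ts.id.fst.snd).mk Ts.id.snd)).imp 
          (hT.sub (((Ts.pi fun i => Ts.id.fst.fst.ap _).mk Ts.id.fst.snd).mk Ts.id.snd)))
      have hR1 := ih (ini a) _ _ _ hR
      let R : (Fin m → M) → (Fin m → M) → Prop := fun u v => ∀ y, W (φ' (f ∘ v, ini a)) j y → W (φ' (f ∘ u, ini a)) j y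
      have hRd : Dfn L M (fun p : (Fin m → M) × (Fin m → M) => R p.1 p.2) := by
        refine (Dfn.comp' hR1 (g := fun p : (Fin m → M) × (Fin m → M) => Fin.append p.1 p.2) ?_).congr fun p => propext ?_
        · refine Dfn.pi' fun i => ?_
          induction i using Fin.addCases with
          | left i => simp only [Fin.append_left]; fun_prop
          | right i => simp only [Fin.append_right]; fun_prop
        · simp only [Function.comp_apply, Fin.append_left, Fin.append_right]
          rfl
      have htot : ∀ u v, R u v ∨ R v u := by
        intro u v
        by_contra hn
        push Not at hn
        obtain ⟨h1, h2⟩ := hn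
        simp only [R, not_forall] at h1 h2
        obtain ⟨y, h3, h4⟩ := h1
        obtain ⟨z, h5, h6⟩ := h2
        rcases le_total y z with h7 | h7
        · exact h6 (h3.mono h7)
        · exact h4 (h5.mono h7)
      rcases astat m R hRd (fun u v w h1 h2 y hy => h1 y (h2 y hy)) htot 
        (fun u => W (φ' (f ∘ u, ini a)) j (a (Fin.last n))) (fun u v h1 h2 => h1 _ h2) with h1 | h1
      · exact h1
      · exact star_trace hf htame (E := fun u => W (φ' (u, ini a)) j (a (Fin.last n))) 
          (Dfn.comp' hT.dfn₂ (g := fun u : Fin m → N => ((u, ini a), a (Fin.last n))) (by fun_prop)) (fun u => Iff.rfl) h1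
    have : Dfn L M (fun u => ∃ j : Fin B, Even j.1 ∧ W (φ' (f ∘ u, ini a)) j.1 (a (Fin.last n)) ∧ 
        ¬ W (φ' (f ∘ u, ini a)) (j.1+1) (a (Fin.last n))) := by
      refine Dfn.fex' fun j => Dfn.and' ?_ ((hW j.1).and' (hW (j.1+1)).not')
      fun_prop
    refine this.congr fun u => propext ?_
    rw [← W.iff (hB' _)]
    change _ ↔ Φ' (f ∘ u, sn (ini a) (a (Fin.last n)))
    simp
end
end MS

open FirstOrder Set
set_option linter.unusedVariables false
set_option linter.unusedSectionVars false
set_option linter.style.haveILetI false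
set_option linter.unusedSimpArgs false
namespace MS
section
variable {M : Type*} [LinearOrder M]

/-- local constancy -/
def LocC (A : M → Prop) (x : M) : Prop :=
  ∃ a b, a < x ∧ x < b ∧ ((∀ y, a < y → y < b → A y) ∨ (∀ y, a < y → y < b → ¬ A y))

theorem LocC.not {A : M → Prop} {x : M} (h : LocC A x) : LocC (fun y => ¬ A y) x := by
  obtain ⟨a, b, h1, h2, h | h⟩ := h
  · exact ⟨a, b, h1, h2, Or.inr fun y h3 h4 h5 => h5 (h y h3 h4)⟩
  · exact ⟨a, b, h1, h2, Or.inl h⟩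

theorem LocC.or {A B : M → Prop} {x : M} (h : LocC A x) (h' : LocC B x) : LocC (fun y => A y ∨ B y) x := by
  obtain ⟨a, b, h1, h2, h⟩ := h
  obtain ⟨c, d, h3, h4, h'⟩ := h'
  refine ⟨max a c, min b d, max_lt h1 h3, lt_min h2 h4, ?_⟩
  rcases h with h | h
  · exact Or.inl fun y h5 h6 => Or.inl (h y ((le_max_left _ _).trans_lt h5) (h6.trans_le (min_le_left _ _)))
  rcases h' with h' | h'
  · exact Or.inl fun y h5 h6 => Or.inr (h' y ((le_max_right _ _).trans_lt h5) (h6.trans_le (min_le_right _ _)))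
  · refine Or.inr fun y h5 h6 h7 => ?_
    rcases h7 with h7 | h7
    · exact h y ((le_max_left _ _).trans_lt h5) (h6.trans_le (min_le_left _ _)) h7
    · exact h' y ((le_max_right _ _).trans_lt h5) (h6.trans_le (min_le_right _ _)) h7

theorem LocC.congr {A B : M → Prop} {x : M} (h : LocC A x) (hAB : ∀ y, B y ↔ A y) : LocC B x := by
  have : B = A := funext fun y => propext (hAB y)
  rwa [this]

variable [DenselyOrdered M] [NoMinOrder M] [NoMaxOrder M] [Nonempty M]

theorem LocC.lt {a x : M} (h : x ≠ a) : LocC (fun y => y < a) x := by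
  obtain ⟨p, hp⟩ := exists_lt x
  obtain ⟨q, hq⟩ := exists_gt x
  rcases lt_or_gt_of_ne h with h | h
  · exact ⟨p, a, hp, h, Or.inl fun y _ h => h⟩
  · exact ⟨a, q, h, hq, Or.inr fun y h _ h' => lt_asymm h h'⟩

theorem LocC.gt {a x : M} (h : x ≠ a) : LocC (fun y => a < y) x := by
  obtain ⟨p, hp⟩ := exists_lt x
  obtain ⟨q, hq⟩ := exists_gt x
  rcases lt_or_gt_of_ne h with h | h
  · exact ⟨p, a, hp, h, Or.inr fun y _ h h' => lt_asymm h h'⟩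
  · exact ⟨a, q, h, hq, Or.inl fun y h _ => h⟩

theorem LocC.const (p : Prop) (x : M) : LocC (fun _ => p) x := by
  obtain ⟨a, hp⟩ := exists_lt x
  obtain ⟨b, hq⟩ := exists_gt x
  by_cases h : p
  · exact ⟨a, b, hp, hq, Or.inl fun _ _ _ => h⟩
  · exact ⟨a, b, hp, hq, Or.inr fun _ _ _ => h⟩

def Basic (t : Set M) : Prop := (∃ a : M, t = {a}) ∨ (∃ a b : M, t = Set.Ioo a b) ∨
        (∃ a : M, t = Set.Ioi a) ∨ (∃ a : M, t = Set.Iio a) ∨ t = Set.univ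

theorem Basic.lc {t : Set M} (h : Basic t) : {x | ¬ LocC (fun y => y ∈ t) x}.Finite := by
  have fin2 : ∀ a b : M, ({a, b} : Set M).Finite := fun a b => Set.toFinite _
  rcases h with ⟨a, rfl⟩ | ⟨a, b, rfl⟩ | ⟨a, rfl⟩ | ⟨a, rfl⟩ | rfl
  · refine (fin2 a a).subset fun x hx => ?_
    by_contra hn
    have hn' : x ≠ a := by simpa using hn
    exact hx (((LocC.lt hn').or (LocC.gt hn')).not.congr fun y => by
      rw [Set.mem_singleton_iff, ← ne_iff_lt_or_gt, not_not])
  · refine (fin2 a b).subset fun x hx => ?_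
    by_contra hn
    have hn' : x ≠ a ∧ x ≠ b := by simpa using hn
    exact hx (((LocC.gt hn'.1).not.or (LocC.lt hn'.2).not).not.congr fun y => by
      rw [Set.mem_Ioo]; tauto)
  · refine (fin2 a a).subset fun x hx => ?_
    by_contra hn
    have hn' : x ≠ a := by simpa using hn
    exact hx (LocC.gt hn')
  · refine (fin2 a a).subset fun x hx => ?_
    by_contra hn
    have hn' : x ≠ a := by simpa using hn
    exact hx (LocC.lt hn')
  · refine Set.finite_empty.subset fun x hx => hx ((LocC.const True x).congr fun y => by simp)

theorem lc_sUnion (F : Finset (Set M)) (hF : ∀ t ∈ F, Basic t) : {x | ¬ LocC (fun y => y ∈ ⋃₀ (F : Set (Set M))) x}.Finite := by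
  classical
  induction F using Finset.induction_on with
  | empty => exact Set.finite_empty.subset fun x hx => hx ((LocC.const False x).congr fun y => by simp)
  | insert t F _ ih => 
    refine ((hF t (by simp)).lc.union (ih fun t ht => hF t (by simp [ht]))).subset fun x hx => ?_
    by_contra hn
    rw [Set.mem_union, not_or] at hn
    exact hx (((not_not.1 hn.1).or (not_not.1 hn.2)).congr fun y => by simp)

theorem lub_sUnion (F : Finset (Set M)) (hF : ∀ t ∈ F, Basic t) : 
    ¬ BddAbove (⋃₀ (F : Set (Set M))) ∨ ⋃₀ (F : Set (Set M)) = ∅ ∨ ∃ x, IsLUB (⋃₀ (F : Set (Set M))) x := by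
  classical
  induction F using Finset.induction_on with
  | empty => right; left; simp
  | insert t F _ ih =>
    rw [Finset.coe_insert, Set.sUnion_insert]
    have ht : ¬ BddAbove t ∨ t = ∅ ∨ ∃ x, IsLUB t x := by
      rcases hF t (by simp) with ⟨a, rfl⟩ | ⟨a, b, rfl⟩ | ⟨a, rfl⟩ | ⟨a, rfl⟩ | rfl
      · exact Or.inr (Or.inr ⟨a, isLUB_singleton⟩)
      · by_cases h : a < b
        · exact Or.inr (Or.inr ⟨b, isLUB_Ioo h⟩)
        · exact Or.inr (Or.inl (Set.Ioo_eq_empty h))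
      · exact Or.inl (not_bddAbove_Ioi a)
      · exact Or.inr (Or.inr ⟨a, isLUB_Iio⟩)
      · exact Or.inl not_bddAbove_univ
    rcases ih fun t ht => hF t (by simp [ht]) with h | h | ⟨x, h⟩
    · exact Or.inl fun h' => h (h'.mono Set.subset_union_right)
    · rw [h, Set.union_empty]; exact ht
    · rcases ht with h' | h' | ⟨y, h'⟩
      · exact Or.inl fun h1 => h' (h1.mono Set.subset_union_left)
      · rw [h', Set.empty_union]; exact Or.inr (Or.inr ⟨x, h⟩)
      · exact Or.inr (Or.inr ⟨_, h'.union h⟩)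

theorem glb_sUnion (F : Finset (Set M)) (hF : ∀ t ∈ F, Basic t) : 
    ¬ BddBelow (⋃₀ (F : Set (Set M))) ∨ ⋃₀ (F : Set (Set M)) = ∅ ∨ ∃ x, IsGLB (⋃₀ (F : Set (Set M))) x := by
  classical
  induction F using Finset.induction_on with
  | empty => right; left; simp
  | insert t F _ ih =>
    rw [Finset.coe_insert, Set.sUnion_insert]
    have ht : ¬ BddBelow t ∨ t = ∅ ∨ ∃ x, IsGLB t x := by
      rcases hF t (by simp) with ⟨a, rfl⟩ | ⟨a, b, rfl⟩ | ⟨a, rfl⟩ | ⟨a, rfl⟩ | rfl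
      · exact Or.inr (Or.inr ⟨a, isGLB_singleton⟩)
      · by_cases h : a < b
        · exact Or.inr (Or.inr ⟨a, isGLB_Ioo h⟩)
        · exact Or.inr (Or.inl (Set.Ioo_eq_empty h))
      · exact Or.inr (Or.inr ⟨a, isGLB_Ioi⟩)
      · exact Or.inl (not_bddBelow_Iio a)
      · exact Or.inl not_bddBelow_univ
    rcases ih fun t ht => hF t (by simp [ht]) with h | h | ⟨x, h⟩
    · exact Or.inl fun h' => h (h'.mono Set.subset_union_right)
    · rw [h, Set.union_empty]; exact ht
    · rcases ht with h' | h' | ⟨y, h'⟩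
      · exact Or.inl fun h1 => h' (h1.mono Set.subset_union_left)
      · rw [h', Set.empty_union]; exact Or.inr (Or.inr ⟨x, h⟩)
      · exact Or.inr (Or.inr ⟨_, h'.union h⟩)
end

section
variable {L : Language} {M N : Type*} [L.Structure M] [L.Structure N] [LinearOrder M] [LinearOrder N]

theorem om_of [DenselyOrdered M] [NoMinOrder M] [NoMaxOrder M] [Nonempty M] 
    (hlt : Set.Definable (∅ : Set M) L {v : Fin 2 → M | v 0 < v 1})
    (h : ∀ s : Set M, Set.Definable₁ (Set.univ : Set M) L s →
      ∃ F : Finset (Set M), s = ⋃₀ (F : Set (Set M)) ∧ ∀ t ∈ F, Basic t) : OM L M where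
  lt := by
    have h1 : Dfn L M (fun v : Fin 2 → M => v 0 < v 1) := dfn_iff_definable.2 (hlt.mono (Set.empty_subset _))
    refine Dfn.comp' h1 (g := fun p : M × M => ![p.1, p.2]) (Dfn.pi' fun i => ?_)
    fin_cases i
    · exact Dfn.fst' Dfn.id'
    · exact Dfn.snd' Dfn.id'
  fin := by
    intro A hA
    obtain ⟨F, h1, h2⟩ := h _ (dfn_iff_definable₁.1 hA)
    have := lc_sUnion F h2
    rw [← h1] at this
    exact this
  lub := by
    rintro A hA ⟨x, hx⟩ ⟨b, hb⟩
    obtain ⟨F, h1, h2⟩ := h _ (dfn_iff_definable₁.1 hA)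
    have := lub_sUnion F h2
    rw [← h1] at this
    rcases this with h3 | h3 | h3
    · exact absurd ⟨b, hb⟩ h3
    · exact absurd (show x ∈ {x | A x} from hx) (by rw [h3]; simp)
    · exact h3
  glb := by
    rintro A hA ⟨x, hx⟩ ⟨b, hb⟩
    obtain ⟨F, h1, h2⟩ := h _ (dfn_iff_definable₁.1 hA)
    have := glb_sUnion F h2
    rw [← h1] at this
    rcases this with h3 | h3 | h3
    · exact absurd ⟨b, hb⟩ h3
    · exact absurd (show x ∈ {x | A x} from hx) (by rw [h3]; simp)
    · exact h3

theorem tl_of (f : M ↪ₑ[L] N) (horder : ∃ φ : L.Formula (Fin 2),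
      (∀ v : Fin 2 → M, φ.Realize v ↔ v 0 < v 1) ∧
      (∀ v : Fin 2 → N, φ.Realize v ↔ v 0 < v 1)) : TL f := by
  obtain ⟨φ, h1, h2⟩ := horder
  let σ : Fin 2 → M ⊕ (Unit ⊕ Unit) := ![Sum.inr (Sum.inl ()), Sum.inr (Sum.inr ())]
  refine ⟨⟨φ.relabel σ, fun w => ?_, fun w => ?_⟩⟩
  · rw [Language.Formula.realize_relabel, h1]; rfl
  · rw [Language.Formula.realize_relabel, h2]; rfl

theorem tr_of (f : M ↪ₑ[L] N) {m n : ℕ} {D : Set (Fin m ⊕ Fin n → N)} (hD : Set.Definable (Set.range f) L D) : 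
    ∃ Φ : (Fin m → M) × (Fin n → M) → Prop, Tr f Φ (fun p : (Fin m → N) × (Fin n → N) => Sum.elim p.1 p.2 ∈ D) := by
  rw [Set.definable_iff_exists_formula_sum] at hD
  obtain ⟨φ, rfl⟩ := hD
  choose g hg using fun x : Set.range f => x.2
  refine ⟨fun p => (φ.relabel (Sum.map g id)).Realize (Sum.elim id (Sum.elim p.1 p.2)), 
    φ.relabel (Sum.map g id), fun w => ?_, fun w => ?_⟩
  · have : Sum.elim (tE₁ L M N ((Fin m → M) × (Fin n → M)) ((Fin m → N) × (Fin n → N)) w).1 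
      (tE₁ L M N ((Fin m → M) × (Fin n → M)) ((Fin m → N) × (Fin n → N)) w).2 = w := by
      funext i; rcases i with i | i <;> rfl
    beta_reduce
    rw [this]
  · have : Sum.elim (tE₂ L M N ((Fin m → M) × (Fin n → M)) ((Fin m → N) × (Fin n → N)) w).1 
      (tE₂ L M N ((Fin m → M) × (Fin n → M)) ((Fin m → N) × (Fin n → N)) w).2 = w := by
      funext i; rcases i with i | i <;> rfl
    beta_reduce
    rw [this, Language.Formula.realize_relabel, Set.mem_setOf_eq]
    have h2 : Sum.elim (f : M → N) w ∘ Sum.map g id = Sum.elim (fun x : Set.range f => (x : N)) w := by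
      funext i; rcases i with i | i
      · exact hg i
      · rfl
    rw [h2]
end
end MS

/-- Marker–Steinhorn Theorem: if `N` is a tame elementary extension of an
o-minimal structure `M` (every cut `{t ∈ M : t < s}`, `s ∈ N`, has a supremum in `M ∪ {+∞}`),
then the type of every tuple of `N` over `M` is definable: for every formula `φ(u,v)` with
parameters from `M`, the set `{u ∈ M^m : N ⊨ φ(u,a)}` is definable in `M`. -/
theorem statement12 (L : FirstOrder.Language) (M N : Type*) [L.Structure M] [L.Structure N]
    [LinearOrder M] [LinearOrder N] (hM : IsOMinimal L M)
    (f : M ↪ₑ[L] N)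
    (horder : ∃ φ : L.Formula (Fin 2),
      (∀ v : Fin 2 → M, φ.Realize v ↔ v 0 < v 1) ∧
      (∀ v : Fin 2 → N, φ.Realize v ↔ v 0 < v 1))
    (htame : ∀ s : N, (∀ t : M, f t < s) ∨ (∃ m : M, IsLUB {t : M | f t < s} m))
    (n : ℕ) (a : Fin n → N) (m : ℕ) (D : Set (Fin m ⊕ Fin n → N))
    (hD : Set.Definable (Set.range f) L D) :
    Set.Definable (Set.univ : Set M) L {u : Fin m → M | Sum.elim (f ∘ u) a ∈ D} := by
  obtain ⟨h1, h2, h3, h4, h5, h6⟩ := hM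
  have hOM : MS.OM L M := MS.om_of h5 h6
  have hf : MS.TL f := MS.tl_of f horder
  have : DenselyOrdered N := MS.tr_dense hf
  have : NoMinOrder N := MS.tr_nomin hf
  have : NoMaxOrder N := MS.tr_nomax hf
  have : Nonempty N := h1.map f
  have : MS.OM L N := MS.tr_om hf
  obtain ⟨Φ, hΦ⟩ := MS.tr_of f hD
  exact MS.dfn_iff_definable.1 (MS.main hf htame n a m _ _ hΦ)
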